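/- arXiv:2101.00811 — 2 statements merged into one kernel-verified Lean document; each statement's English description precedes it below -/
import Mathlib

section
/- Let K be an imaginary quadratic number field, k ∈ ℕ, κ = 2^{k-1}, Q, N ≥ 1 real, and (a_n)_{n ∈ 𝓞_K} any sequence of complex numbers. Then for any ε > 0, Σ_{q ∈ 𝓞_K \ {0}, N(q) ≤ Q} Σ_{r mod q^k, (r,q)=1} |Σ_{n ∈ 𝓞_K, N(n) ≤ N} a_n · ẽ_K(nr/q^k)|² ≪_{k,ε} (QN)^ε (Q^{k+1} + N·Q^{1-1/κ} + N^{1-1/κ}·Q^{1+k/κ}) · Σ_{n ∈ 𝓞_K, N(n) ≤ N} |a_n|², where the inner sum over r runs over a complete set of residues modulo q^k coprime to q. -/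
open NumberField

/-- The additive character ẽ_K(z) = exp(2πi(z/√D_K - z̄/√D_K)), where D_K is the
discriminant of K and √D_K = i·√(-D_K) is a fixed square root (D_K < 0 for K imaginary
quadratic). -/
noncomputable def eK (K : Type) [Field K] [NumberField K] (z : ℂ) : ℂ :=
  Complex.exp (2 * (Real.pi : ℂ) * Complex.I *
    (z / (Complex.I * Real.sqrt (-(NumberField.discr K : ℝ))) -
      (starRingEnd ℂ) z / (Complex.I * Real.sqrt (-(NumberField.discr K : ℝ)))))

open Finset in
/-- Character orthogonality on a finite abelian group, in the form of Parseval's identity. -/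
theorem sum_norm_sq_sum_addChar {G ι : Type*} [AddCommGroup G] [Fintype G]
    (χ : ι → AddChar G ℂ) (S : Finset ι) (hχ : Set.InjOn χ S) (a : ι → ℂ) :
    ∑ x, ‖∑ n ∈ S, a n * χ n x‖ ^ 2 = Fintype.card G * ∑ n ∈ S, ‖a n‖ ^ 2 := by
  classical
  have horth : ∀ n ∈ S, ∀ m ∈ S, ∑ x, χ n x * starRingEnd ℂ (χ m x) =
      if n = m then (Fintype.card G : ℂ) else 0 := by
    intro n hn m hm
    have h1 : ∀ x, χ n x * starRingEnd ℂ (χ m x) = (χ n - χ m) x := by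
      intro x
      rw [AddChar.sub_apply', div_eq_mul_inv, ← AddChar.inv_apply_eq_conj]
    simp_rw [h1]
    rw [AddChar.sum_eq_ite]
    by_cases h : n = m
    · simp [h]
    · rw [if_neg h, if_neg]
      rw [sub_eq_zero]
      exact fun h' => h (hχ hn hm h')
  have key : (∑ x, ((‖∑ n ∈ S, a n * χ n x‖ ^ 2 : ℝ) : ℂ)) =
      ((Fintype.card G * ∑ n ∈ S, ‖a n‖ ^ 2 : ℝ) : ℂ) := by
    calc (∑ x, ((‖∑ n ∈ S, a n * χ n x‖ ^ 2 : ℝ) : ℂ))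
        = ∑ x, ∑ n ∈ S, ∑ m ∈ S,
            a n * starRingEnd ℂ (a m) * (χ n x * starRingEnd ℂ (χ m x)) := by
          refine sum_congr rfl fun x _ => ?_
          push_cast
          rw [← Complex.mul_conj', map_sum, sum_mul_sum]
          refine sum_congr rfl fun n _ => sum_congr rfl fun m _ => ?_
          rw [map_mul]; ring
      _ = ∑ n ∈ S, ∑ m ∈ S, a n * starRingEnd ℂ (a m) *
            ∑ x, (χ n x * starRingEnd ℂ (χ m x)) := by
          rw [sum_comm]
          refine sum_congr rfl fun n _ => ?_
          rw [sum_comm]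
          exact sum_congr rfl fun m _ => by rw [mul_sum]
      _ = ∑ n ∈ S, a n * starRingEnd ℂ (a n) * (Fintype.card G : ℂ) := by
          refine sum_congr rfl fun n hn => ?_
          rw [sum_congr rfl fun m hm => by rw [horth n hn m hm]]
          simp [hn]
      _ = _ := by
          push_cast
          rw [mul_sum]
          refine sum_congr rfl fun n _ => ?_
          rw [Complex.mul_conj']; ring
  exact_mod_cast key

open Finset Pointwise in
/-- The large sieve inequality on a finite abelian group: if the characters `χ n` are close to `1`
on a set `B` and at most `P` of the points `x p` lie in any translate of `B - B` centred at one of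
them, then the sampled exponential sum is controlled by `P * |G| / |B|`. -/
theorem large_sieve_addChar {G ι J : Type*} [AddCommGroup G] [Fintype G] [DecidableEq G]
    (χ : ι → AddChar G ℂ) (S : Finset ι) (hχ : Set.InjOn χ S)
    (B : Finset G) (hB0 : B.Nonempty) (hB : ∀ n ∈ S, ∀ t ∈ B, ‖χ n t - 1‖ ≤ 1 / 2)
    (F : Finset J) (x : J → G) (P : ℝ) (hP0 : 0 ≤ P)
    (hP : ∀ p₀ ∈ F, (#{p ∈ F | x p - x p₀ ∈ B - B} : ℝ) ≤ P) (a : ι → ℂ) :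
    ∑ p ∈ F, ‖∑ n ∈ S, a n * χ n (x p)‖ ^ 2 ≤
      4 * P * (Fintype.card G / #B) * ∑ n ∈ S, ‖a n‖ ^ 2 := by
  classical
  have hBpos : (0 : ℝ) < #B := by exact_mod_cast hB0.card_pos
  set w : ι → ℂ := fun n => (∑ t ∈ B, χ n t) / #B with hw
  have hw1 : ∀ n ∈ S, 1 / 2 ≤ ‖w n‖ := by
    intro n hn
    have h1 : w n - 1 = (∑ t ∈ B, (χ n t - 1)) / #B := by
      rw [hw, sum_sub_distrib]
      have : (#B : ℂ) ≠ 0 := by exact_mod_cast hBpos.ne'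
      field_simp
      simp
    have h2 : ‖w n - 1‖ ≤ 1 / 2 := by
      rw [h1, norm_div, Complex.norm_natCast, div_le_iff₀ hBpos]
      calc _ ≤ ∑ t ∈ B, ‖χ n t - 1‖ := norm_sum_le _ _
        _ ≤ ∑ t ∈ B, (1 / 2 : ℝ) := sum_le_sum fun t ht => hB n hn t ht
        _ = _ := by simp; ring
    have h3 := norm_sub_norm_le (1 : ℂ) (1 - w n)
    rw [sub_sub_cancel, norm_one, norm_sub_rev] at h3
    linarith
  set b : ι → ℂ := fun n => a n / w n with hb
  have hb1 : ∀ n ∈ S, ‖b n‖ ^ 2 ≤ 4 * ‖a n‖ ^ 2 := by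
    intro n hn
    have := hw1 n hn
    have h2 : ‖b n‖ ≤ 2 * ‖a n‖ := by
      rw [hb]
      simp only [norm_div]
      rw [div_le_iff₀ (by linarith)]
      nlinarith [norm_nonneg (a n)]
    nlinarith [norm_nonneg (b n), norm_nonneg (a n)]
  set T : G → ℂ := fun y => ∑ n ∈ S, b n * χ n y with hT
  have hrep : ∀ y, ∑ n ∈ S, a n * χ n y = (∑ t ∈ B, T (y + t)) / #B := by
    intro y
    simp only [hT]
    rw [sum_comm, sum_div]
    refine sum_congr rfl fun n hn => ?_
    have hwn : w n ≠ 0 := by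
      intro h
      have := hw1 n hn
      rw [h, norm_zero] at this
      linarith
    simp_rw [AddChar.map_add_eq_mul, ← mul_assoc]
    rw [← mul_sum, mul_div_assoc]
    change _ = b n * χ n y * w n
    simp only [hb]
    field_simp
  have hpt : ∀ y, ‖∑ n ∈ S, a n * χ n y‖ ^ 2 ≤ (∑ t ∈ B, ‖T (y + t)‖ ^ 2) / #B := by
    intro y
    rw [hrep, norm_div, Complex.norm_natCast, div_pow, div_le_div_iff₀ (by positivity) hBpos]
    have h1 : ‖∑ t ∈ B, T (y + t)‖ ^ 2 ≤ #B * ∑ t ∈ B, ‖T (y + t)‖ ^ 2 :=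
      (pow_le_pow_left₀ (norm_nonneg _) (norm_sum_le _ _) 2).trans sq_sum_le_card_mul_sum_sq
    calc _ ≤ (#B * ∑ t ∈ B, ‖T (y + t)‖ ^ 2) * #B := by gcongr
      _ = _ := by ring
  have hcount : ∀ y : G, (#{p ∈ F | y - x p ∈ B} : ℝ) ≤ P := by
    intro y
    rcases ({p ∈ F | y - x p ∈ B} : Finset J).eq_empty_or_nonempty with h | ⟨p₀, hp₀⟩
    · rw [h]; simpa using hP0
    · rw [mem_filter] at hp₀
      refine le_trans ?_ (hP p₀ hp₀.1)
      norm_cast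
      refine card_le_card fun p hp => ?_
      rw [mem_filter] at hp ⊢
      refine ⟨hp.1, ?_⟩
      rw [show x p - x p₀ = (y - x p₀) - (y - x p) by abel]
      exact sub_mem_sub hp₀.2 hp.2
  calc ∑ p ∈ F, ‖∑ n ∈ S, a n * χ n (x p)‖ ^ 2
      ≤ ∑ p ∈ F, (∑ t ∈ B, ‖T (x p + t)‖ ^ 2) / #B := sum_le_sum fun p _ => hpt _
    _ = (∑ p ∈ F, ∑ y, if y - x p ∈ B then ‖T y‖ ^ 2 else 0) / #B := by
        rw [← sum_div]
        congr 1
        refine sum_congr rfl fun p _ => ?_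
        rw [← sum_filter]
        refine sum_nbij' (fun t => x p + t) (fun y => y - x p) ?_ ?_ ?_ ?_ ?_ <;> simp
    _ = (∑ y, #{p ∈ F | y - x p ∈ B} * ‖T y‖ ^ 2) / #B := by
        rw [sum_comm]
        congr 1
        refine sum_congr rfl fun y _ => ?_
        rw [← sum_filter, sum_const, nsmul_eq_mul]
    _ ≤ (∑ y, P * ‖T y‖ ^ 2) / #B := by
        gcongr with y _
        exact hcount y
    _ = P * (Fintype.card G * ∑ n ∈ S, ‖b n‖ ^ 2) / #B := by
        rw [← mul_sum, sum_norm_sq_sum_addChar χ S hχ]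
    _ ≤ P * (Fintype.card G * ∑ n ∈ S, 4 * ‖a n‖ ^ 2) / #B := by
        gcongr with n hn
        exact hb1 n hn
    _ = _ := by rw [← mul_sum]; ring

/-- `z` lies within `δ` of the image of the ring `R` in `ℂ`. -/
def NearRing {R : Type*} [CommRing R] (s : R →+* ℂ) (δ : ℝ) (z : ℂ) : Prop :=
  ∃ w : R, ‖z - s w‖ ≤ δ

theorem NearRing.sub {R : Type*} [CommRing R] {s : R →+* ℂ} {δ δ' : ℝ} {z z' : ℂ}
    (h : NearRing s δ z) (h' : NearRing s δ' z') : NearRing s (δ + δ') (z - z') := by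
  obtain ⟨w, hw⟩ := h
  obtain ⟨w', hw'⟩ := h'
  refine ⟨w - w', ?_⟩
  rw [map_sub, show z - z' - (s w - s w') = (z - s w) - (z' - s w') by ring]
  exact (norm_sub_le _ _).trans (add_le_add hw hw')

/-- All `d`-fold differences of `f` with steps `h₁, …, h_d` are constant, equal to
`c * s h₁ * ⋯ * s h_d`. -/
def HasLeadingDiff {R : Type*} [CommRing R] (s : R →+* ℂ) : ℕ → (R → ℂ) → ℂ → Prop
  | 0, f, c => ∀ q, f q = c
  | d + 1, f, c => ∀ h, HasLeadingDiff s d (fun q => f (q + h) - f q) (c * s h)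

theorem HasLeadingDiff.add {R : Type*} [CommRing R] {s : R →+* ℂ} {d : ℕ} :
    ∀ {f g : R → ℂ} {c e : ℂ}, HasLeadingDiff s d f c → HasLeadingDiff s d g e →
      HasLeadingDiff s d (fun q => f q + g q) (c + e) := by
  induction d with
  | zero => intro f g c e hf hg q; simp only [hf q, hg q]
  | succ d ih =>
    intro f g c e hf hg h
    have := ih (hf h) (hg h)
    rw [add_mul]
    convert this using 2
    ring

theorem HasLeadingDiff.zero {R : Type*} [CommRing R] (s : R →+* ℂ) (d : ℕ) :
    HasLeadingDiff s d (fun _ => 0) 0 := by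
  induction d with
  | zero => intro q; rfl
  | succ d ih => intro h; simpa using ih

theorem HasLeadingDiff.sum {R ι : Type*} [CommRing R] {s : R →+* ℂ} {d : ℕ} (t : Finset ι)
    {f : ι → R → ℂ} {c : ι → ℂ} (hf : ∀ i ∈ t, HasLeadingDiff s d (f i) (c i)) :
    HasLeadingDiff s d (fun q => ∑ i ∈ t, f i q) (∑ i ∈ t, c i) := by
  classical
  induction t using Finset.induction_on with
  | empty => simpa using HasLeadingDiff.zero s d
  | insert i t hi ih =>
    simp_rw [Finset.sum_insert hi]
    exact (hf i (Finset.mem_insert_self i t)).add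
      (ih fun j hj => hf j (Finset.mem_insert_of_mem hj))

theorem hasLeadingDiff_pow_of_le {R : Type*} [CommRing R] (s : R →+* ℂ) (d : ℕ) :
    ∀ (j : ℕ) (c : ℂ), j ≤ d →
      HasLeadingDiff s d (fun q => s q ^ j * c) (if j = d then d.factorial * c else 0) := by
  induction d with
  | zero =>
    intro j c hj q
    obtain rfl : j = 0 := by omega
    simp
  | succ d ih =>
    intro j c hj h
    have h1 : (fun q => s (q + h) ^ j * c - s q ^ j * c) =
        fun q => ∑ i ∈ Finset.range j, s q ^ i * (s h ^ (j - i) * (j.choose i) * c) := by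
      funext q
      rw [map_add, add_pow, Finset.sum_range_succ]
      simp only [Nat.sub_self, pow_zero, Nat.choose_self, Nat.cast_one, mul_one]
      rw [add_mul, add_sub_cancel_right, Finset.sum_mul]
      exact Finset.sum_congr rfl fun i _ => by ring
    rw [h1]
    have h2 := HasLeadingDiff.sum (s := s) (d := d) (Finset.range j)
      (fun i hi => ih i (s h ^ (j - i) * (j.choose i) * c)
        (by have := Finset.mem_range.1 hi; omega))
    convert h2 using 1
    split_ifs with hjd
    · subst hjd
      rw [Finset.sum_ite_eq' (Finset.range (d + 1)) d
        (fun i => (d.factorial : ℂ) * (s h ^ (d + 1 - i) * ((d + 1).choose i) * c))]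
      simp [Nat.factorial_succ]
      ring
    · rw [zero_mul]
      refine (Finset.sum_eq_zero fun i hi => ?_).symm
      rw [if_neg]
      have := Finset.mem_range.1 hi
      omega

theorem hasLeadingDiff_pow {R : Type*} [CommRing R] (s : R →+* ℂ) (d : ℕ) (c : ℂ) :
    HasLeadingDiff s d (fun q => s q ^ d * c) (d.factorial * c) := by
  simpa using hasLeadingDiff_pow_of_le s d d c le_rfl

open Finset in
theorem card_sq_le_sum_card_shift {R : Type*} [AddCommGroup R] [DecidableEq R] (A H : Finset R)
    (hH : ∀ x ∈ A, ∀ y ∈ A, x - y ∈ H) :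
    #A ^ 2 ≤ ∑ h ∈ H, #{q ∈ A | q + h ∈ A} := by
  rw [sq, ← card_product, ← card_sigma]
  refine card_le_card_of_injOn (fun p => ⟨p.2 - p.1, p.1⟩) ?_ ?_
  · rintro ⟨x, y⟩ hp
    simp only [coe_product, Set.mem_prod, mem_coe] at hp
    simp [hp.1, hp.2, hH _ hp.2 _ hp.1]
  · rintro ⟨x, y⟩ _ ⟨x', y'⟩ _ h
    simp only [Sigma.mk.injEq, heq_eq_eq] at h
    obtain ⟨h1, rfl⟩ := h
    simpa using h1

open Finset Classical in
/-- Weyl differencing in combinatorial form. -/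
theorem card_pow_le_of_hasLeadingDiff {R : Type*} [CommRing R] (s : R →+* ℂ) (H : Finset R)
    (d : ℕ) : ∀ (f : R → ℂ) (c : ℂ) (δ : ℝ) (A : Finset R), (∀ x ∈ A, ∀ y ∈ A, x - y ∈ H) →
      HasLeadingDiff s (d + 1) f c → (∀ q ∈ A, NearRing s δ (f q)) →
      #A ^ 2 ^ d ≤ #H ^ (2 ^ d - (d + 1)) *
        #{v ∈ Fintype.piFinset (fun _ : Fin (d + 1) => H) |
          NearRing s (2 ^ (d + 1) * δ) (c * ∏ i, s (v i))} := by
  induction d with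
  | zero =>
    intro f c δ A hA hf hnear
    simp only [zero_add, pow_zero, pow_one, Nat.sub_self, one_mul]
    rcases A.eq_empty_or_nonempty with rfl | ⟨x₀, hx₀⟩
    · simp
    refine card_le_card_of_injOn (fun q _ => q - x₀) ?_ ?_
    · intro q hq
      simp only [coe_filter, Fintype.mem_piFinset, Set.mem_ofPred_eq]
      refine ⟨fun _ => hA q hq x₀ hx₀, ?_⟩
      have h1 := (hnear q hq).sub (hnear x₀ hx₀)
      have h2 := hf (q - x₀) x₀
      simp only [add_sub_cancel] at h2
      rw [h2] at h1
      simpa [two_mul] using h1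
    · intro q _ q' _ h
      have := congrFun h 0
      simpa using this
  | succ d ih =>
    intro f c δ A hA hf hnear
    rcases A.eq_empty_or_nonempty with rfl | ⟨x₀, hx₀⟩
    · simp
    have hHpos : 0 < #H := card_pos.2 ⟨_, hA x₀ hx₀ x₀ hx₀⟩
    set W : R → Finset (Fin (d + 1) → R) := fun h =>
      {v ∈ Fintype.piFinset (fun _ : Fin (d + 1) => H) |
          NearRing s (2 ^ (d + 2) * δ) (c * s h * ∏ i, s (v i))} with hW
    have hstep : ∀ h ∈ H, #{q ∈ A | q + h ∈ A} ^ 2 ^ d ≤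
        #H ^ (2 ^ d - (d + 1)) * #(W h) := by
      intro h _
      have := ih (fun q => f (q + h) - f q) (c * s h) (2 * δ) {q ∈ A | q + h ∈ A}
        (fun x hx y hy => hA x (mem_filter.1 hx).1 y (mem_filter.1 hy).1) (hf h) (by
          intro q hq
          rw [mem_filter] at hq
          rw [two_mul]
          exact (hnear _ hq.2).sub (hnear _ hq.1))
      rwa [← mul_assoc, ← pow_succ] at this
    have hsig : ∑ h ∈ H, #(W h) ≤ #{v ∈ Fintype.piFinset (fun _ : Fin (d + 1 + 1) => H) |
          NearRing s (2 ^ (d + 1 + 1) * δ) (c * ∏ i, s (v i))} := by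
      rw [← card_sigma]
      refine card_le_card_of_injOn (fun p => Fin.cons p.1 p.2) ?_ ?_
      · rintro ⟨h, v⟩ hp
        simp only [hW, coe_sigma, Set.mem_sigma_iff, mem_coe, mem_filter,
          Fintype.mem_piFinset] at hp
        simp only [coe_filter, Fintype.mem_piFinset, Set.mem_ofPred_eq]
        refine ⟨Fin.cases hp.1 hp.2.1, ?_⟩
        rw [Fin.prod_univ_succ]
        simpa [mul_assoc] using hp.2.2
      · rintro ⟨h, v⟩ _ ⟨h', v'⟩ _ heq
        obtain ⟨rfl, rfl⟩ := Fin.cons_inj.1 heq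
        rfl
    have hpos : 0 < 2 ^ d := by positivity
    have hd : d + 1 ≤ 2 ^ d := Nat.lt_two_pow_self
    have hpow : (∑ h ∈ H, #{q ∈ A | q + h ∈ A}) ^ 2 ^ d ≤
        #H ^ (2 ^ d - 1) * ∑ h ∈ H, #{q ∈ A | q + h ∈ A} ^ 2 ^ d := by
      obtain ⟨n, hn⟩ : ∃ n, 2 ^ d = n + 1 := ⟨2 ^ d - 1, by omega⟩
      rw [hn, Nat.add_sub_cancel]
      have := pow_sum_div_card_le_sum_pow (s := H)
        (f := fun h => (#{q ∈ A | q + h ∈ A} : ℝ)) (fun _ _ => by positivity) n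
      rw [div_le_iff₀ (by positivity)] at this
      rw [mul_comm]
      exact_mod_cast this
    calc #A ^ 2 ^ (d + 1) = (#A ^ 2) ^ 2 ^ d := by rw [← pow_mul, pow_succ, mul_comm]
      _ ≤ (∑ h ∈ H, #{q ∈ A | q + h ∈ A}) ^ 2 ^ d :=
          Nat.pow_le_pow_left (card_sq_le_sum_card_shift A H hA) _
      _ ≤ #H ^ (2 ^ d - 1) * ∑ h ∈ H, #{q ∈ A | q + h ∈ A} ^ 2 ^ d := hpow
      _ ≤ #H ^ (2 ^ d - 1) * ∑ h ∈ H, #H ^ (2 ^ d - (d + 1)) * #(W h) := by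
          gcongr with h hh
          exact hstep h hh
      _ = #H ^ (2 ^ (d + 1) - (d + 1 + 1)) * ∑ h ∈ H, #(W h) := by
          rw [← mul_sum, ← mul_assoc, ← pow_add]
          congr 2
          rw [pow_succ]
          omega
      _ ≤ _ := by gcongr

/-- Any disc of radius `ρ` contains at most `C * (1 + ρ ^ 2)` points of the image of `R`. -/
def LatticeBound {R : Type*} [CommRing R] (s : R →+* ℂ) (C : ℝ) : Prop :=
  ∀ (S : Finset R) (c : ℂ) (ρ : ℝ), 0 ≤ ρ → (∀ m ∈ S, ‖s m - c‖ ≤ ρ) →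
    (S.card : ℝ) ≤ C * (1 + ρ ^ 2)

/-- A nonzero `m` has `O(‖s m‖ ^ ε)` divisors, for every `ε > 0`. -/
def DivisorBound {R : Type*} [CommRing R] (s : R →+* ℂ) : Prop :=
  ∀ ε : ℝ, 0 < ε → ∃ C : ℝ, 0 < C ∧ ∀ m : R, m ≠ 0 → ∀ S : Finset R, (∀ h ∈ S, h ∣ m) →
    (S.card : ℝ) ≤ C * ‖s m‖ ^ ε

theorem LatticeBound.finite {R : Type*} [CommRing R] {s : R →+* ℂ} {C : ℝ}
    (hC : LatticeBound s C) (ρ : ℝ) : {m : R | ‖s m‖ ≤ ρ}.Finite := by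
  by_contra hinf
  rw [Set.not_finite] at hinf
  obtain ⟨n, hn⟩ := exists_nat_gt (C * (1 + ρ ^ 2))
  obtain ⟨t, ht, hcard⟩ := hinf.exists_subset_card_eq n
  rcases t.eq_empty_or_nonempty with rfl | ⟨x, hx⟩
  · obtain ⟨x, hx⟩ := hinf.nonempty
    have := hC ∅ 0 ρ ((norm_nonneg _).trans hx) (by simp)
    simp only [Finset.card_empty] at this hcard
    rw [← hcard] at hn
    exact absurd hn (not_lt.2 this)
  · have := hC t 0 ρ ((norm_nonneg _).trans (ht hx)) (fun m hm => by simpa using ht hm)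
    rw [hcard] at this
    linarith

open Finset Classical in
theorem card_piFinset_prod_le {R : Type*} [CommRing R] [IsDomain R] (H : Finset R) (k : ℕ)
    (p : R → Prop) (D : ℕ)
    (hD : ∀ m ≠ 0, (∃ v ∈ Fintype.piFinset (fun _ : Fin k => H), ∏ i, v i = m) →
      #{h ∈ H | h ∣ m} ≤ D)
    (L : Finset R)
    (hL : ∀ v ∈ Fintype.piFinset (fun _ : Fin k => H), ∏ i, v i ≠ 0 → p (∏ i, v i) →
      ∏ i, v i ∈ L) :
    #{v ∈ Fintype.piFinset (fun _ : Fin k => H) | p (∏ i, v i)} ≤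
      k * #H ^ (k - 1) + D ^ k * #L := by
  set V := {v ∈ Fintype.piFinset (fun _ : Fin k => H) | p (∏ i, v i)} with hV
  have hzero : #{v ∈ V | ∏ i, v i = 0} ≤ k * #H ^ (k - 1) := by
    calc #{v ∈ V | ∏ i, v i = 0}
        ≤ #(univ.biUnion fun i : Fin k => Fintype.piFinset
            (Function.update (fun _ : Fin k => H) i {0})) := by
          refine card_le_card fun v hv => ?_
          simp only [hV, mem_filter, Fintype.mem_piFinset, prod_eq_zero_iff, mem_univ,
            true_and] at hv
          obtain ⟨⟨hvH, _⟩, i, hi⟩ := hv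
          simp only [mem_biUnion, mem_univ, true_and, Fintype.mem_piFinset]
          refine ⟨i, fun j => ?_⟩
          by_cases hij : j = i
          · subst hij; simp [hi]
          · simp [Function.update_of_ne hij, hvH j]
      _ ≤ ∑ i : Fin k, #(Fintype.piFinset (Function.update (fun _ : Fin k => H) i {0})) :=
          card_biUnion_le
      _ = ∑ i : Fin k, #H ^ (k - 1) := by
          refine sum_congr rfl fun i _ => ?_
          rw [Fintype.card_piFinset, ← mul_prod_erase univ _ (mem_univ i)]
          rw [prod_congr rfl (g := fun _ => #H)]
          · simp [card_erase_of_mem]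
          · intro j hj
            rw [Function.update_of_ne (ne_of_mem_erase hj)]
      _ = _ := by simp
  have hnz : #{v ∈ V | ¬ ∏ i, v i = 0} ≤ D ^ k * #L := by
    refine (card_le_mul_card_image (f := fun v : Fin k → R => ∏ i, v i) _ (D ^ k) ?_).trans ?_
    · intro m hm
      obtain ⟨v₀, hv₀, rfl⟩ := mem_image.1 hm
      rw [mem_filter] at hv₀
      calc _ ≤ #(Fintype.piFinset fun _ : Fin k => {h ∈ H | h ∣ ∏ i, v₀ i}) := by
            refine card_le_card fun v hv => ?_
            rw [mem_filter, mem_filter, hV, mem_filter, Fintype.mem_piFinset] at hv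
            rw [Fintype.mem_piFinset]
            intro i
            rw [mem_filter]
            refine ⟨hv.1.1.1 i, ?_⟩
            rw [← hv.2]
            exact dvd_prod_of_mem _ (mem_univ i)
        _ = #{h ∈ H | h ∣ ∏ i, v₀ i} ^ k := by simp
        _ ≤ D ^ k := by
            gcongr
            exact hD _ hv₀.2 ⟨v₀, (mem_filter.1 hv₀.1).1, rfl⟩
    · gcongr
      intro m hm
      obtain ⟨v, hv, rfl⟩ := mem_image.1 hm
      rw [mem_filter, hV, mem_filter] at hv
      exact hL v hv.1.1 hv.2 hv.1.2
  rw [← card_filter_add_card_filter_not (s := V) (fun v => ∏ i, v i = 0)]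
  exact add_le_add hzero hnz

open Finset in
/-- Counting the multiples of a fraction `r₀ / q₀` with small distance to the ring. -/
theorem card_near_multiples_le {R : Type*} [CommRing R] [IsDomain R] (s : R →+* ℂ)
    (hs : Function.Injective s) {C : ℝ} (hC : LatticeBound s C)
    (b q₀ r₀ : R) (hb : b ≠ 0) (hq₀ : q₀ ≠ 0) (hcop : IsCoprime r₀ q₀)
    (L : Finset R) (Y δ : ℝ) (hY : 0 ≤ Y) (hδ : 0 ≤ δ)
    (hL : ∀ m ∈ L, ‖s m‖ ≤ Y ∧ NearRing s δ (s b * s m * (s r₀ / s q₀))) :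
    (#L : ℝ) ≤ C * (1 + (2 * ‖s b‖ * Y / ‖s q₀‖) ^ 2) * (C * (1 + (δ * ‖s q₀‖) ^ 2)) := by
  classical
  have hsq : s q₀ ≠ 0 := by rwa [Ne, map_eq_zero_iff s hs]
  have hsqpos : 0 < ‖s q₀‖ := norm_pos_iff.2 hsq
  choose! w hw using fun m hm => (hL m hm).2
  set u : R → R := fun m => b * m * r₀ - w m * q₀ with hu
  have himg : (#(L.image u) : ℝ) ≤ C * (1 + (δ * ‖s q₀‖) ^ 2) := by
    refine hC _ 0 _ (by positivity) fun y hy => ?_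
    obtain ⟨m, hm, rfl⟩ := mem_image.1 hy
    have := hw m hm
    have h2 : s (u m) - 0 = (s b * s m * (s r₀ / s q₀) - s (w m)) * s q₀ := by
      simp only [hu, map_sub, map_mul]
      field_simp
      ring
    rw [h2, norm_mul]
    gcongr
  have hfib : ∀ y ∈ L.image u, (#{m ∈ L | u m = y} : ℝ) ≤
      C * (1 + (2 * ‖s b‖ * Y / ‖s q₀‖) ^ 2) := by
    intro y hy
    obtain ⟨m₀, hm₀, rfl⟩ := mem_image.1 hy
    have hdiv : ∀ m ∈ L, u m = u m₀ → ∃ t, b * (m - m₀) = q₀ * t := by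
      intro m _ h
      have h1 : q₀ ∣ b * (m - m₀) * r₀ := ⟨w m - w m₀, by
        simp only [hu] at h
        linear_combination h⟩
      exact hcop.symm.dvd_of_dvd_mul_right h1
    choose! t ht using hdiv
    have hinj : Set.InjOn t ({m ∈ L | u m = u m₀} : Finset R) := by
      intro x hx x' hx' h
      simp only [coe_filter, Set.mem_ofPred_eq] at hx hx'
      have h1 := ht x hx.1 hx.2
      have h2 := ht x' hx'.1 hx'.2
      rw [h, ← h2] at h1
      have := mul_left_cancel₀ hb h1
      simpa using this
    rw [← card_image_of_injOn hinj]
    refine hC _ 0 _ (by positivity) fun z hz => ?_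
    obtain ⟨m, hm, rfl⟩ := mem_image.1 hz
    rw [mem_filter] at hm
    have h1 := congrArg (fun x => ‖s x‖) (ht m hm.1 hm.2)
    simp only [map_mul, map_sub, norm_mul] at h1
    rw [sub_zero, le_div_iff₀ hsqpos, mul_comm, ← h1]
    have h2 : ‖s m - s m₀‖ ≤ Y + Y :=
      (norm_sub_le _ _).trans (add_le_add (hL m hm.1).1 (hL m₀ hm₀).1)
    calc _ ≤ ‖s b‖ * (Y + Y) := by gcongr
      _ = _ := by ring
  have hC0 : 0 ≤ C * (1 + (2 * ‖s b‖ * Y / ‖s q₀‖) ^ 2) := by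
    have := hC ∅ 0 (2 * ‖s b‖ * Y / ‖s q₀‖) (by positivity) (by simp)
    simpa using this
  calc (#L : ℝ) = ∑ y ∈ L.image u, (#{m ∈ L | u m = y} : ℝ) := by
        exact_mod_cast card_eq_sum_card_image u L
    _ ≤ ∑ y ∈ L.image u, C * (1 + (2 * ‖s b‖ * Y / ‖s q₀‖) ^ 2) := sum_le_sum hfib
    _ = C * (1 + (2 * ‖s b‖ * Y / ‖s q₀‖) ^ 2) * #(L.image u) := by
        rw [sum_const, nsmul_eq_mul, mul_comm]
    _ ≤ _ := by gcongr

theorem LatticeBound.one_le {R : Type*} [CommRing R] {s : R →+* ℂ} {C : ℝ}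
    (hC : LatticeBound s C) : 1 ≤ C := by
  have := hC {0} 0 0 le_rfl (by simp)
  simpa using this

set_option maxHeartbeats 1000000 in
open Finset in
/-- The number of `q` of norm at most `2 X` whose `(d + 1)`-st power dilates a reduced fraction
with denominator `q₀ ^ (d + 1)` close to the ring. -/
theorem card_near_powers_pow_le {R : Type*} [CommRing R] [IsDomain R] (s : R →+* ℂ)
    (hs : Function.Injective s) {C : ℝ} (hC : LatticeBound s C) (hD : DivisorBound s)
    (d : ℕ) (ε : ℝ) (hε : 0 < ε) :
    ∃ C' : ℝ, 0 < C' ∧ ∀ X : ℝ, 1 ≤ X → ∀ δ : ℝ, 0 ≤ δ → ∀ q₀ r₀ : R, IsCoprime r₀ q₀ →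
      X ≤ ‖s q₀‖ ^ 2 → ‖s q₀‖ ^ 2 ≤ 2 * X → ∀ A : Finset R,
      (∀ q ∈ A, ‖s q‖ ^ 2 ≤ 2 * X ∧
        NearRing s δ (s q ^ (d + 1) * (s r₀ / s q₀ ^ (d + 1)))) →
      (#A : ℝ) ^ 2 ^ d ≤ C' * X ^ ε * (X ^ (2 ^ d - 1) + X ^ 2 ^ d * δ ^ 2) := by
  classical
  have hC1 := hC.one_le
  set k : ℕ := d + 1 with hk
  have hkpos : (0 : ℝ) < k := by rw [hk]; positivity
  obtain ⟨E, hE, hdiv⟩ := hD (ε / k ^ 2) (by positivity)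
  have hdk : k ≤ 2 ^ d := Nat.lt_two_pow_self
  set B : ℝ := 9 * C with hB
  set C₁ : ℝ := C * (1 + 4 * (k.factorial : ℝ) ^ 2 * 8 ^ k) * (C * 8 ^ k) with hC₁
  refine ⟨2 * (B ^ (2 ^ d - k) * (k * B ^ (k - 1) + E ^ k * 8 ^ ε * C₁)), by positivity, ?_⟩
  intro X hX δ hδ q₀ r₀ hcop hX1 hX2 A hA
  have hX0 : 0 < X := by linarith
  have hq₀ : q₀ ≠ 0 := by
    rintro rfl
    simp at hX1
    linarith
  set H : Finset R := (hC.finite (√(8 * X))).toFinset with hH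
  have hHmem : ∀ m, m ∈ H ↔ ‖s m‖ ≤ √(8 * X) := fun m => by simp [hH]
  have hHcard : (#H : ℝ) ≤ B * X := by
    have := hC H 0 (√(8 * X)) (by positivity) (fun m hm => by simpa using (hHmem m).1 hm)
    rw [Real.sq_sqrt (by positivity)] at this
    calc (#H : ℝ) ≤ C * (1 + 8 * X) := this
      _ ≤ C * (9 * X) := by gcongr; linarith
      _ = _ := by ring
  set Y : ℝ := √(8 * X) ^ k with hY
  have hY2 : Y ^ 2 = (8 * X) ^ k := by
    rw [hY, ← pow_mul, mul_comm k 2, pow_mul, Real.sq_sqrt (by positivity)]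
  have hY0 : 0 ≤ Y := by positivity
  set p : R → Prop := fun m =>
    NearRing s (2 ^ k * δ) ((k.factorial : ℂ) * (s r₀ / s q₀ ^ k) * s m) with hp
  set L : Finset R := {m ∈ (hC.finite Y).toFinset | p m} with hL
  have hprodY : ∀ v ∈ Fintype.piFinset (fun _ : Fin k => H), ‖s (∏ i, v i)‖ ≤ Y := by
    intro v hv
    rw [Fintype.mem_piFinset] at hv
    rw [map_prod, norm_prod]
    calc _ ≤ ∏ _i : Fin k, √(8 * X) :=
          prod_le_prod (fun _ _ => norm_nonneg _) fun i _ => (hHmem _).1 (hv i)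
      _ = Y := by simp [hY]
  set D : ℕ := ⌊E * Y ^ (ε / k ^ 2)⌋₊ with hDdef
  have hcount := card_piFinset_prod_le H k p D
    (by
      rintro m hm ⟨v, hv, rfl⟩
      apply Nat.le_floor
      refine (hdiv _ hm _ (fun h hh => (mem_filter.1 hh).2)).trans ?_
      gcongr
      exact hprodY v hv) L
    (by
      intro v hv _ hpv
      rw [hL, mem_filter]
      refine ⟨?_, hpv⟩
      simpa using hprodY v hv)
  have hAcard := card_pow_le_of_hasLeadingDiff s H d
    (fun q => s q ^ k * (s r₀ / s q₀ ^ k)) (k.factorial * (s r₀ / s q₀ ^ k)) δ A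
    (by
      intro x hx y hy
      rw [hHmem, map_sub]
      refine (norm_sub_le _ _).trans ?_
      have h1 : ‖s x‖ ≤ √(2 * X) := Real.le_sqrt_of_sq_le (hA x hx).1
      have h2 : ‖s y‖ ≤ √(2 * X) := Real.le_sqrt_of_sq_le (hA y hy).1
      have h3 : √(8 * X) = 2 * √(2 * X) := by
        rw [show 8 * X = 2 ^ 2 * (2 * X) by ring, Real.sqrt_mul (by positivity),
          Real.sqrt_sq (by norm_num)]
      linarith)
    (hasLeadingDiff_pow s k _) (fun q hq => (hA q hq).2)
  have hLcard : (#L : ℝ) ≤ C₁ * (1 + X ^ k * δ ^ 2) := by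
    have hb : ((k.factorial : ℕ) : R) ≠ 0 := by
      intro h
      have := congrArg s h
      simp [Nat.factorial_ne_zero] at this
    have h1 := card_near_multiples_le s hs hC (k.factorial : R) (q₀ ^ k) r₀ hb
      (pow_ne_zero _ hq₀) hcop.pow_right L Y (2 ^ k * δ) hY0 (by positivity)
      (by
        intro m hm
        rw [hL, mem_filter] at hm
        refine ⟨by simpa using hm.1, ?_⟩
        have := hm.2
        simp only [hp] at this
        simp only [map_natCast, map_pow]
        convert this using 1
        ring)
    refine h1.trans ?_
    have hqX : (X ^ k) ≤ ‖s (q₀ ^ k)‖ ^ 2 := by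
      rw [map_pow, norm_pow, ← pow_mul, mul_comm k 2, pow_mul]
      gcongr
    have hqX2 : ‖s (q₀ ^ k)‖ ^ 2 ≤ 2 ^ k * X ^ k := by
      rw [map_pow, norm_pow, ← pow_mul, mul_comm k 2, pow_mul, ← mul_pow]
      gcongr
    rw [hC₁, mul_assoc (C * (1 + 4 * (k.factorial : ℝ) ^ 2 * 8 ^ k))]
    have hfac : ‖s (k.factorial : R)‖ = k.factorial := by simp
    gcongr ?_ * ?_
    · gcongr
      rw [hfac, div_pow, mul_pow, mul_pow, hY2, mul_pow,
        div_le_iff₀ (lt_of_lt_of_le (by positivity) hqX)]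
      calc (2 : ℝ) ^ 2 * (k.factorial : ℝ) ^ 2 * (8 ^ k * X ^ k)
          = 4 * (k.factorial : ℝ) ^ 2 * 8 ^ k * X ^ k := by ring
        _ ≤ _ := by gcongr
    · rw [mul_assoc C (8 ^ k)]
      gcongr
      have h8 : (1 : ℝ) ≤ 8 ^ k := one_le_pow₀ (by norm_num)
      calc 1 + (2 ^ k * δ * ‖s (q₀ ^ k)‖) ^ 2
          = 1 + (2 ^ k) ^ 2 * δ ^ 2 * ‖s (q₀ ^ k)‖ ^ 2 := by ring
        _ ≤ 1 + (2 ^ k) ^ 2 * δ ^ 2 * (2 ^ k * X ^ k) := by gcongr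
        _ = 1 + 8 ^ k * (X ^ k * δ ^ 2) := by
            rw [show (8 : ℝ) ^ k = (2 ^ k) ^ 2 * 2 ^ k by
              rw [← pow_mul, mul_comm k 2, pow_mul, ← mul_pow]; norm_num]
            ring
        _ ≤ _ := by rw [mul_add]; linarith
  have hDk : (D : ℝ) ^ k ≤ E ^ k * 8 ^ ε * X ^ ε := by
    have h1 : (D : ℝ) ≤ E * Y ^ (ε / k ^ 2) := Nat.floor_le (by positivity)
    calc (D : ℝ) ^ k ≤ (E * Y ^ (ε / k ^ 2)) ^ k := by gcongr
      _ = E ^ k * √(8 * X) ^ ε := by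
          rw [mul_pow, hY, ← Real.rpow_natCast (√(8 * X)) k, ← Real.rpow_mul (by positivity),
            ← Real.rpow_natCast (_ ^ _) k, ← Real.rpow_mul (by positivity)]
          congr 2
          field_simp
      _ ≤ E ^ k * (8 * X) ^ ε := by
          gcongr
          rw [Real.sqrt_le_left (by positivity)]
          nlinarith
      _ = _ := by rw [Real.mul_rpow (by norm_num) hX0.le]; ring
  have hXε : 1 ≤ X ^ ε := Real.one_le_rpow hX hε.le
  have h1 : (#A : ℝ) ^ 2 ^ d ≤
      (#H : ℝ) ^ (2 ^ d - k) * (k * (#H : ℝ) ^ (k - 1) + (D : ℝ) ^ k * #L) := by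
    have h2 : #A ^ 2 ^ d ≤ #H ^ (2 ^ d - k) * (k * #H ^ (k - 1) + D ^ k * #L) := by
      refine hAcard.trans (Nat.mul_le_mul le_rfl ?_)
      simp only [hp, map_prod] at hcount
      convert hcount
    exact_mod_cast h2
  have hXk : X ^ (2 ^ d - k) ≤ X ^ (2 ^ d - 1) := pow_le_pow_right₀ hX (by omega)
  have hX3 : X ^ (2 ^ d - k) * X ^ (k - 1) = X ^ (2 ^ d - 1) := by
    rw [← pow_add]; congr 1; omega
  have hX4 : X ^ (2 ^ d - k) * X ^ k = X ^ 2 ^ d := by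
    rw [← pow_add]; congr 1; omega
  have hB0 : 0 ≤ B := by positivity
  have hC₁0 : 0 ≤ C₁ := by positivity
  clear_value k B C₁ D
  calc (#A : ℝ) ^ 2 ^ d
      ≤ (B * X) ^ (2 ^ d - k) * (k * (B * X) ^ (k - 1) +
          (E ^ k * 8 ^ ε * X ^ ε) * (C₁ * (1 + X ^ k * δ ^ 2))) := by
        refine h1.trans ?_
        gcongr
    _ = B ^ (2 ^ d - k) * (k * B ^ (k - 1)) * X ^ (2 ^ d - 1) * 1 +
          B ^ (2 ^ d - k) * (E ^ k * 8 ^ ε * C₁) *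
            (X ^ (2 ^ d - k) + X ^ 2 ^ d * δ ^ 2) * X ^ ε := by
        rw [← hX3, ← hX4, mul_pow, mul_pow]; ring
    _ ≤ B ^ (2 ^ d - k) * (k * B ^ (k - 1)) * (X ^ (2 ^ d - 1) + X ^ 2 ^ d * δ ^ 2) * X ^ ε +
          B ^ (2 ^ d - k) * (E ^ k * 8 ^ ε * C₁) *
            (X ^ (2 ^ d - 1) + X ^ 2 ^ d * δ ^ 2) * X ^ ε := by
        gcongr
        exact le_add_of_nonneg_right (by positivity)
    _ = B ^ (2 ^ d - k) * (k * B ^ (k - 1) + E ^ k * 8 ^ ε * C₁) * X ^ ε *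
          (X ^ (2 ^ d - 1) + X ^ 2 ^ d * δ ^ 2) := by ring
    _ ≤ _ := by
        have : 0 ≤ B ^ (2 ^ d - k) * (k * B ^ (k - 1) + E ^ k * 8 ^ ε * C₁) * X ^ ε *
          (X ^ (2 ^ d - 1) + X ^ 2 ^ d * δ ^ 2) := by positivity
        linarith

open Finset Classical in
/-- Spacing of the fractions `r / q ^ (d + 1)` with `‖q‖ ^ 2` in a dyadic interval. -/
theorem card_near_fractions_le {R : Type*} [CommRing R] [IsDomain R] (s : R →+* ℂ)
    (hs : Function.Injective s) {C : ℝ} (hC : LatticeBound s C) (hD : DivisorBound s)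
    (d : ℕ) (ε : ℝ) (hε : 0 < ε) (c : ℝ) (hc : 0 ≤ c) :
    ∃ C' : ℝ, 0 < C' ∧ ∀ X N : ℝ, 1 ≤ X → 1 ≤ N → ∀ F : Finset (R × R),
      (∀ p ∈ F, X ≤ ‖s p.1‖ ^ 2 ∧ ‖s p.1‖ ^ 2 ≤ 2 * X ∧ IsCoprime p.2 p.1) →
      (∀ p ∈ F, ∀ p' ∈ F, p.1 = p'.1 → p.1 ^ (d + 1) ∣ p.2 - p'.2 → p = p') →
      ∀ p₀ ∈ F, N * #{p ∈ F | NearRing s (c / √N)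
          (s p.2 / s p.1 ^ (d + 1) - s p₀.2 / s p₀.1 ^ (d + 1))} ≤
        C' * X ^ ε * (X ^ ((d : ℝ) + 2) + N * X ^ (1 - 1 / (2 : ℝ) ^ d) +
          N ^ (1 - 1 / (2 : ℝ) ^ d) * X ^ (1 + ((d : ℝ) + 1) / (2 : ℝ) ^ d)) := by
  have hC1 := hC.one_le
  obtain ⟨E, hE, hpow⟩ := card_near_powers_pow_le s hs hC hD d (ε * 2 ^ d) (by positivity)
  set k : ℕ := d + 1 with hk
  set M : ℝ := 1 + 2 ^ k * c ^ 2 with hM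
  have hM1 : 1 ≤ M := by rw [hM]; linarith [show 0 ≤ 2 ^ k * c ^ 2 by positivity]
  refine ⟨3 * C ^ 2 * M + C * M * ((1 + E) * M), by positivity, ?_⟩
  intro X N hX hN F hF hFinj p₀ hp₀
  have hX0 : 0 < X := by linarith
  have hN0 : 0 < N := by linarith
  obtain ⟨hp₀1, hp₀2, hp₀c⟩ := hF p₀ hp₀
  set α : ℂ := s p₀.2 / s p₀.1 ^ k with hα
  set η : ℝ := c / √N with hη
  have hη0 : 0 ≤ η := by positivity
  set G : Finset (R × R) := {p ∈ F | NearRing s η (s p.2 / s p.1 ^ k - α)} with hG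
  have hGmem : ∀ p ∈ G, p ∈ F ∧ NearRing s η (s p.2 / s p.1 ^ k - α) :=
    fun p hp => mem_filter.1 hp
  choose! w hw using fun p hp => (hGmem p hp).2
  set δ : ℝ := √(2 * X) ^ k * η with hδ
  have hδ0 : 0 ≤ δ := by positivity
  have hδ2 : δ ^ 2 = 2 ^ k * c ^ 2 * X ^ k / N := by
    rw [hδ, mul_pow, ← pow_mul, mul_comm k 2, pow_mul, Real.sq_sqrt (by positivity), hη,
      div_pow, Real.sq_sqrt hN0.le]
    ring
  have hkey : ∀ p ∈ G, ‖s p.1 ^ k * α - s (p.2 - w p * p.1 ^ k)‖ ≤ δ := by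
    intro p hp
    obtain ⟨h1, h2, _⟩ := hF p (hGmem p hp).1
    have hne : s p.1 ≠ 0 := by
      intro h
      rw [h] at h1
      simp at h1
      linarith
    have h3 : s p.1 ^ k * α - s (p.2 - w p * p.1 ^ k) =
        - (s p.1 ^ k * (s p.2 / s p.1 ^ k - α - s (w p))) := by
      rw [map_sub, map_mul, map_pow]
      field_simp
      ring
    rw [h3, norm_neg, norm_mul, norm_pow, hδ]
    gcongr
    · exact Real.le_sqrt_of_sq_le h2
    · exact hw p hp
  set A : Finset R := G.image Prod.fst with hA
  have hfib : ∀ q ∈ A, (#{p ∈ G | p.1 = q} : ℝ) ≤ C * (1 + δ ^ 2) := by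
    intro q _
    have hinj : Set.InjOn (fun p : R × R => p.2 - w p * p.1 ^ k)
        ({p ∈ G | p.1 = q} : Finset (R × R)) := by
      intro p hp p' hp' h
      simp only [coe_filter, Set.mem_ofPred_eq] at hp hp'
      refine hFinj p (hGmem p hp.1).1 p' (hGmem p' hp'.1).1 (hp.2.trans hp'.2.symm)
        ⟨w p - w p', ?_⟩
      simp only [hp.2, hp'.2] at h ⊢
      linear_combination h
    rw [← card_image_of_injOn hinj]
    refine hC _ (s q ^ k * α) _ hδ0 fun y hy => ?_
    obtain ⟨p, hp, rfl⟩ := mem_image.1 hy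
    rw [mem_filter] at hp
    rw [norm_sub_rev, ← hp.2]
    exact hkey p hp.1
  have hGA : (#G : ℝ) ≤ #A * (C * (1 + δ ^ 2)) := by
    calc (#G : ℝ) = ∑ q ∈ A, (#{p ∈ G | p.1 = q} : ℝ) := by
          exact_mod_cast card_eq_sum_card_image Prod.fst G
      _ ≤ ∑ q ∈ A, C * (1 + δ ^ 2) := sum_le_sum hfib
      _ = _ := by rw [sum_const, nsmul_eq_mul]
  have hAq : ∀ q ∈ A, ‖s q‖ ^ 2 ≤ 2 * X ∧ NearRing s δ (s q ^ k * α) := by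
    intro q hq
    obtain ⟨p, hp, rfl⟩ := mem_image.1 hq
    exact ⟨(hF p (hGmem p hp).1).2.1, _, hkey p hp⟩
  have hXε : 1 ≤ X ^ ε := Real.one_le_rpow hX hε.le
  set a : ℝ := X ^ (1 - 1 / (2 : ℝ) ^ d) with ha
  set b : ℝ := N ^ (1 - 1 / (2 : ℝ) ^ d) * X ^ (1 + ((d : ℝ) + 1) / (2 : ℝ) ^ d) with hb
  have ha0 : 0 ≤ a := by positivity
  have hb0 : 0 ≤ b := by positivity
  have hXd : X ^ ((d : ℝ) + 2) = X ^ (k + 1) := by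
    rw [← Real.rpow_natCast]; congr 1; rw [hk]; push_cast; ring
  rcases le_total N (X ^ k) with hNX | hNX
  · have hAcard : (#A : ℝ) ≤ 3 * C * X := by
      have := hC A 0 (√(2 * X)) (by positivity)
        (fun q hq => by simpa using Real.le_sqrt_of_sq_le (hAq q hq).1)
      rw [Real.sq_sqrt (by positivity)] at this
      calc (#A : ℝ) ≤ C * (1 + 2 * X) := this
        _ ≤ C * (3 * X) := by gcongr; linarith
        _ = _ := by ring
    calc N * (#G : ℝ) ≤ N * ((3 * C * X) * (C * (1 + δ ^ 2))) := by
          gcongr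
          exact hGA.trans (mul_le_mul_of_nonneg_right hAcard
            (mul_nonneg (by linarith) (by positivity)))
      _ = 3 * C ^ 2 * X * (N + 2 ^ k * c ^ 2 * X ^ k) := by
          rw [hδ2]; field_simp
      _ ≤ 3 * C ^ 2 * X * (X ^ k + 2 ^ k * c ^ 2 * X ^ k) := by gcongr
      _ = 3 * C ^ 2 * M * 1 * X ^ (k + 1) := by rw [hM, pow_succ]; ring
      _ ≤ (3 * C ^ 2 * M + C * M * ((1 + E) * M)) * X ^ ε *
            (X ^ (k + 1) + N * a + b) := by
          have h5 : X ^ (k + 1) ≤ X ^ (k + 1) + N * a + b := by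
            have : 0 ≤ N * a + b := by positivity
            linarith
          gcongr ?_ * ?_ * ?_
          exact le_add_of_nonneg_right (by positivity)
      _ = _ := by rw [hXd]
  · have hδM : 1 + δ ^ 2 ≤ M := by
      rw [hδ2, hM]
      gcongr
      rw [div_le_iff₀ hN0]
      gcongr
    have h1 := hpow X hX δ hδ0 p₀.1 p₀.2 hp₀c hp₀1 hp₀2 A hAq
    set κ : ℕ := 2 ^ d with hκ
    have hκ0 : κ ≠ 0 := by rw [hκ]; positivity
    have hκ1 : 1 ≤ κ := Nat.one_le_iff_ne_zero.2 hκ0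
    have hκr : ((2 : ℝ) ^ d) = κ := by rw [hκ]; push_cast; rfl
    have hκr0 : (κ : ℝ) ≠ 0 := by exact_mod_cast hκ0
    set b' : ℝ := b / N with hb'
    have haκ : a ^ κ = X ^ (κ - 1) := by
      rw [ha, hκr, ← Real.rpow_natCast, ← Real.rpow_mul hX0.le, ← Real.rpow_natCast]
      congr 1
      push_cast [hκ1]
      field_simp
    have hbκ : b' ^ κ = X ^ κ * X ^ k / N := by
      rw [hb', hb, hκr, div_pow, mul_pow, ← Real.rpow_natCast, ← Real.rpow_mul hN0.le,
        ← Real.rpow_natCast (X ^ _), ← Real.rpow_mul hX0.le, ← pow_add,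
        show (1 - 1 / (κ : ℝ)) * κ = ((κ - 1 : ℕ) : ℝ) by
          push_cast [hκ1]; field_simp,
        show (1 + ((d : ℝ) + 1) / κ) * κ = ((κ + k : ℕ) : ℝ) by
          rw [hk]; push_cast; field_simp,
        Real.rpow_natCast, Real.rpow_natCast]
      rw [div_eq_div_iff (by positivity) (by positivity)]
      obtain ⟨n, hn⟩ : ∃ n, κ = n + 1 := ⟨κ - 1, by omega⟩
      rw [hn, Nat.add_sub_cancel, pow_succ N n]
      ring
    have hXεκ : X ^ (ε * 2 ^ d) = (X ^ ε) ^ κ := by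
      rw [← Real.rpow_natCast (X ^ ε), ← Real.rpow_mul hX0.le, hκr]
    have hEM : 1 ≤ (1 + E) * M := by nlinarith
    have hAle : (#A : ℝ) ≤ (1 + E) * M * X ^ ε * (a + b') := by
      refine le_of_pow_le_pow_left₀ hκ0 (by positivity) ?_
      calc (#A : ℝ) ^ κ ≤ E * (X ^ ε) ^ κ * (a ^ κ + X ^ κ * δ ^ 2) := by
            rw [haκ, ← hXεκ]; exact h1
        _ ≤ E * (X ^ ε) ^ κ * (M * a ^ κ + M * b' ^ κ) := by
            refine mul_le_mul_of_nonneg_left (add_le_add ?_ ?_) (by positivity)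
            · exact le_mul_of_one_le_left (by positivity) hM1
            · rw [hδ2, hbκ]
              calc X ^ κ * (2 ^ k * c ^ 2 * X ^ k / N)
                  = (2 ^ k * c ^ 2) * (X ^ κ * X ^ k / N) := by ring
                _ ≤ _ := by gcongr; linarith
        _ = E * M * (X ^ ε) ^ κ * (a ^ κ + b' ^ κ) := by ring
        _ ≤ ((1 + E) * M) ^ κ * (X ^ ε) ^ κ * (a + b') ^ κ := by
            gcongr
            · calc E * M ≤ (1 + E) * M := by gcongr; linarith
                _ ≤ _ := le_self_pow₀ hEM hκ0
            · exact pow_add_pow_le ha0 (by positivity) hκ0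
        _ = _ := by simp only [mul_pow]
    calc N * (#G : ℝ) ≤ N * (((1 + E) * M * X ^ ε * (a + b')) * (C * M)) := by
          gcongr
          exact hGA.trans (by gcongr)
      _ = C * M * ((1 + E) * M) * X ^ ε * (N * a + b) := by
          rw [hb']; field_simp
      _ ≤ (3 * C ^ 2 * M + C * M * ((1 + E) * M)) * X ^ ε *
            (X ^ ((d : ℝ) + 2) + N * a + b) := by
          gcongr
          · exact le_add_of_nonneg_left (by positivity)
          · exact le_add_of_nonneg_left (by positivity)

open ComplexConjugate in
/-- The complex embeddings of an imaginary quadratic field are `σ` and its conjugate. -/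
theorem prod_sum_algHom_of_imaginary_quadratic {K : Type} [Field K] [NumberField K]
    (hdeg : Module.finrank ℚ K = 2) (σ : K →+* ℂ) (himag : ∃ x : K, (σ x).im ≠ 0) :
    (∀ x : K, ((Algebra.trace ℚ K x : ℚ) : ℂ) = σ x + conj (σ x)) ∧
      ∀ x : K, ((Algebra.norm ℚ x : ℚ) : ℂ) = σ x * conj (σ x) := by
  classical
  set f : K →ₐ[ℚ] ℂ := σ.toRatAlgHom with hf
  set g : K →ₐ[ℚ] ℂ := ((starRingEnd ℂ).comp σ).toRatAlgHom with hg
  have hfg : f ≠ g := by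
    obtain ⟨x, hx⟩ := himag
    intro h
    have h1 : σ x = conj (σ x) := DFunLike.congr_fun h x
    exact hx (Complex.conj_eq_iff_im.1 h1.symm)
  have huniv : (Finset.univ : Finset (K →ₐ[ℚ] ℂ)) = {f, g} := by
    symm
    apply Finset.eq_univ_of_card
    rw [Finset.card_pair hfg, AlgHom.card, hdeg]
  constructor
  · intro x
    have := trace_eq_sum_embeddings (K := ℚ) (L := K) ℂ (x := x)
    rw [huniv, Finset.sum_pair hfg, eq_ratCast] at this
    exact this
  · intro x
    have := Algebra.norm_eq_prod_embeddings ℚ ℂ x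
    rw [huniv, Finset.prod_pair hfg, eq_ratCast] at this
    exact this

open ComplexConjugate in
theorem discr_eq_neg_sq_of_imaginary_quadratic {K : Type} [Field K] [NumberField K]
    (hdeg : Module.finrank ℚ K = 2) (σ : K →+* ℂ) (himag : ∃ x : K, (σ x).im ≠ 0)
    (b : Module.Basis (Fin 2) ℤ (𝓞 K)) :
    (NumberField.discr K : ℝ) = -(2 * (σ (b 0 : K) * conj (σ (b 1 : K))).im) ^ 2 := by
  obtain ⟨htr, _⟩ := prod_sum_algHom_of_imaginary_quadratic hdeg σ himag
  have htr' : ∀ x : 𝓞 K, ((Algebra.trace ℤ (𝓞 K) x : ℤ) : ℝ) = 2 * (σ (x : K)).re := by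
    intro x
    have h1 : ((Algebra.trace ℤ (𝓞 K) x : ℤ) : ℚ) = Algebra.trace ℚ K (x : K) :=
      Algebra.coe_trace_int x
    have h2 := htr (x : K)
    rw [← h1, Complex.add_conj] at h2
    exact_mod_cast h2
  rw [← NumberField.discr_eq_discr K b, Algebra.discr_def, Matrix.det_fin_two]
  simp only [Algebra.traceMatrix_apply, Algebra.traceForm_apply]
  push_cast
  simp only [htr', map_mul, Complex.mul_re, Complex.mul_im, Complex.conj_re, Complex.conj_im]
  ring

theorem exists_basis_fin_two {K : Type} [Field K] [NumberField K]
    (hdeg : Module.finrank ℚ K = 2) : Nonempty (Module.Basis (Fin 2) ℤ (𝓞 K)) := by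
  have h : Module.finrank ℤ (𝓞 K) = 2 := by
    rw [NumberField.RingOfIntegers.rank, hdeg]
  exact ⟨(Module.finBasis ℤ (𝓞 K)).reindex (finCongr h)⟩

theorem eK_add {K : Type} [Field K] [NumberField K] (z w : ℂ) :
    eK K (z + w) = eK K z * eK K w := by
  rw [eK, eK, eK, ← Complex.exp_add, map_add]
  congr 1
  ring

theorem eK_eq {K : Type} [Field K] [NumberField K] (z : ℂ) :
    eK K z = Complex.exp (((2 * Real.pi * (2 * z.im / √(-(NumberField.discr K : ℝ))) : ℝ) : ℂ) *
      Complex.I) := by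
  rw [eK, ← sub_div, Complex.sub_conj]
  congr 1
  push_cast
  have hI : Complex.I ≠ 0 := Complex.I_ne_zero
  by_cases h : ((√(-(NumberField.discr K : ℝ)) : ℝ) : ℂ) = 0
  · simp [h]
  · field_simp

theorem eK_eq_one_iff {K : Type} [Field K] [NumberField K] (z : ℂ) :
    eK K z = 1 ↔ ∃ n : ℤ, 2 * z.im / √(-(NumberField.discr K : ℝ)) = n := by
  rw [eK_eq, Complex.exp_eq_one_iff]
  refine exists_congr fun n => ?_
  rw [show (n : ℂ) * (2 * Real.pi * Complex.I) = ((2 * Real.pi * n : ℝ) : ℂ) * Complex.I by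
    push_cast; ring, mul_left_inj' Complex.I_ne_zero, Complex.ofReal_inj,
    mul_right_inj' Real.two_pi_pos.ne']

theorem one_le_sqrt_neg_discr {K : Type} [Field K] [NumberField K]
    (h : (NumberField.discr K : ℝ) < 0) : 1 ≤ √(-(NumberField.discr K : ℝ)) := by
  have h1 : NumberField.discr K < 0 := by exact_mod_cast h
  have h2 : NumberField.discr K ≤ -1 := by omega
  rw [Real.one_le_sqrt]
  have h3 : (NumberField.discr K : ℝ) ≤ -1 := by exact_mod_cast h2
  linarith

theorem norm_eK_sub_one_le {K : Type} [Field K] [NumberField K]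
    (h : (NumberField.discr K : ℝ) < 0) (z : ℂ) : ‖eK K z - 1‖ ≤ 4 * Real.pi * ‖z‖ := by
  have h1 := one_le_sqrt_neg_discr h
  rw [eK_eq, mul_comm _ Complex.I]
  refine (Real.norm_exp_I_mul_ofReal_sub_one_le).trans ?_
  rw [Real.norm_eq_abs, abs_mul, abs_of_pos Real.two_pi_pos, abs_div, abs_mul, abs_two,
    abs_of_pos (by linarith : (0 : ℝ) < √(-(NumberField.discr K : ℝ)))]
  have h2 : 2 * |z.im| / √(-(NumberField.discr K : ℝ)) ≤ 2 * ‖z‖ := by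
    rw [div_le_iff₀ (by linarith)]
    have := Complex.abs_im_le_norm z
    nlinarith [norm_nonneg z]
  calc _ ≤ 2 * Real.pi * (2 * ‖z‖) := by gcongr
    _ = _ := by ring

open ComplexConjugate in
theorem abs_repr_mul_le {K : Type} [Field K] [NumberField K] (σ : K →+* ℂ)
    (b : Module.Basis (Fin 2) ℤ (𝓞 K)) (m : 𝓞 K) (i : Fin 2) :
    |(b.repr m i : ℝ)| * |(σ (b 0 : K) * conj (σ (b 1 : K))).im| ≤
      (‖σ (b 0 : K)‖ + ‖σ (b 1 : K)‖) * ‖σ (m : K)‖ := by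
  have hm : σ (m : K) = (b.repr m 0 : ℂ) * σ (b 0 : K) + (b.repr m 1 : ℂ) * σ (b 1 : K) := by
    conv_lhs => rw [← b.sum_repr m]
    rw [Fin.sum_univ_two]
    simp
  have key : ∀ j : Fin 2, |(b.repr m i : ℝ)| * |(σ (b 0 : K) * conj (σ (b 1 : K))).im| =
      |(σ (m : K) * conj (σ (b j : K))).im| → _ ≤ _ := fun j hj => by
    calc |(b.repr m i : ℝ)| * |(σ (b 0 : K) * conj (σ (b 1 : K))).im|
        ≤ ‖σ (m : K) * conj (σ (b j : K))‖ := hj ▸ Complex.abs_im_le_norm _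
      _ = ‖σ (b j : K)‖ * ‖σ (m : K)‖ := by rw [norm_mul, RCLike.norm_conj, mul_comm]
      _ ≤ (‖σ (b 0 : K)‖ + ‖σ (b 1 : K)‖) * ‖σ (m : K)‖ := by
          gcongr
          fin_cases j
          · exact le_add_of_nonneg_right (norm_nonneg _)
          · exact le_add_of_nonneg_left (norm_nonneg _)
  fin_cases i
  · apply key 1
    rw [← abs_mul, hm]
    congr 1
    simp [Complex.mul_im, Complex.mul_re]
    ring
  · apply key 0
    rw [← abs_mul, hm, ← abs_neg]
    congr 1
    simp [Complex.mul_im, Complex.mul_re]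
    ring

theorem eK_ringOfIntegers {K : Type} [Field K] [NumberField K]
    (hdeg : Module.finrank ℚ K = 2) (σ : K →+* ℂ) (himag : ∃ x : K, (σ x).im ≠ 0) (m : 𝓞 K) :
    eK K (σ (m : K)) = 1 := by
  obtain ⟨b⟩ := exists_basis_fin_two hdeg
  have hD := discr_eq_neg_sq_of_imaginary_quadratic hdeg σ himag b
  have hm : ∀ m : 𝓞 K,
      σ (m : K) = (b.repr m 0 : ℂ) * σ (b 0 : K) + (b.repr m 1 : ℂ) * σ (b 1 : K) := by
    intro m
    conv_lhs => rw [← b.sum_repr m]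
    rw [Fin.sum_univ_two]
    simp
  have hone := hm 1
  simp only [map_one] at hone
  set t : ℝ := (σ (b 0 : K) * starRingEnd ℂ (σ (b 1 : K))).im with ht
  have ht0 : t ≠ 0 := by
    intro h
    rw [h] at hD
    simp [NumberField.discr_ne_zero] at hD
  have him : (σ (m : K)).im =
      ((b.repr m 0 * b.repr 1 1 - b.repr m 1 * b.repr 1 0 : ℤ) : ℝ) * t := by
    have h1 : σ (m : K) = σ (m : K) * starRingEnd ℂ 1 := by simp
    rw [hone] at h1
    rw [h1, hm m, ht]
    simp [Complex.mul_im, Complex.mul_re]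
    ring
  rw [eK_eq_one_iff, hD, neg_neg, Real.sqrt_sq_eq_abs, him, abs_mul, abs_two]
  rcases abs_cases t with ⟨h, _⟩ | ⟨h, _⟩
  · refine ⟨b.repr m 0 * b.repr 1 1 - b.repr m 1 * b.repr 1 0, ?_⟩
    rw [h]
    field_simp
  · refine ⟨-(b.repr m 0 * b.repr 1 1 - b.repr m 1 * b.repr 1 0), ?_⟩
    rw [h]
    push_cast
    field_simp

theorem add_one_le_mul_pow_rpow {ε : ℝ} (hε : 0 < ε) {x : ℝ} (hx : 2 ≤ x) (e : ℕ) :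
    (e : ℝ) + 1 ≤ (1 + 1 / (ε * Real.log 2)) * (x ^ e) ^ ε := by
  have hlog : 0 < Real.log 2 := Real.log_pos (by norm_num)
  have h1 : (1 : ℝ) + e * (ε * Real.log 2) ≤ (x ^ e) ^ ε := by
    calc (1 : ℝ) + e * (ε * Real.log 2) ≤ Real.exp (e * (ε * Real.log 2)) := by
          have := Real.add_one_le_exp ((e : ℝ) * (ε * Real.log 2))
          linarith
      _ = ((2 : ℝ) ^ e) ^ ε := by
          rw [Real.rpow_def_of_pos (by positivity), Real.log_pow]
          ring_nf
      _ ≤ (x ^ e) ^ ε := by gcongr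
  calc (e : ℝ) + 1 ≤ (1 + 1 / (ε * Real.log 2)) * (1 + e * (ε * Real.log 2)) := by
        have h2 : (1 + 1 / (ε * Real.log 2)) * (1 + e * (ε * Real.log 2)) =
            1 + e + e * (ε * Real.log 2) + 1 / (ε * Real.log 2) := by
          field_simp
          ring
        rw [h2]
        have : 0 ≤ e * (ε * Real.log 2) := by positivity
        have : 0 < 1 / (ε * Real.log 2) := by positivity
        linarith
    _ ≤ _ := by gcongr

open Finset in
/-- The number of ideals dividing a nonzero ideal `I` is `O(N(I) ^ ε)`. -/
theorem exists_card_ideal_divisors_le (K : Type) [Field K] [NumberField K] (ε : ℝ) (hε : 0 < ε) :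
    ∃ C : ℝ, 0 < C ∧ ∀ I : Ideal (𝓞 K), I ≠ ⊥ → ∀ T : Finset (Ideal (𝓞 K)), (∀ J ∈ T, J ∣ I) →
      (#T : ℝ) ≤ C * (Ideal.absNorm I : ℝ) ^ ε := by
  classical
  set B : ℕ := ⌈(2 : ℝ) ^ (1 / ε)⌉₊ with hB
  have hfin : {I : Ideal (𝓞 K) | Ideal.absNorm I ≤ B}.Finite :=
    Ideal.finite_setOfPred_absNorm_le B
  set A : ℝ := 1 + 1 / (ε * Real.log 2) with hA
  have hlog : 0 < Real.log 2 := Real.log_pos (by norm_num)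
  have hA1 : 1 ≤ A := by
    have : 0 < 1 / (ε * Real.log 2) := by positivity
    linarith
  have hlarge : ∀ (x : ℝ) (e : ℕ), (2 : ℝ) ^ (1 / ε) ≤ x → (e : ℝ) + 1 ≤ (x ^ e) ^ ε := by
    intro x e hx
    have h2 : (0 : ℝ) < 2 ^ (1 / ε) := by positivity
    calc (e : ℝ) + 1 ≤ (2 : ℝ) ^ e := by
          exact_mod_cast Nat.lt_two_pow_self
      _ = (((2 : ℝ) ^ (1 / ε)) ^ e) ^ ε := by
          rw [Real.rpow_pow_comm (by norm_num), ← Real.rpow_mul (by norm_num), one_div,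
            inv_mul_cancel₀ hε.ne', Real.rpow_one]
      _ ≤ (x ^ e) ^ ε := by gcongr
  refine ⟨A ^ #hfin.toFinset, by positivity, fun I hI T hT => ?_⟩
  set f := UniqueFactorizationMonoid.normalizedFactors I with hf
  have hcard : #T ≤ ∏ P ∈ f.toFinset, (f.count P + 1) := by
    rw [← Multiset.card_Iic]
    refine card_le_card_of_injOn
      (fun J => UniqueFactorizationMonoid.normalizedFactors J) (fun J hJ => ?_) ?_
    · have hJ0 : J ≠ 0 := ne_zero_of_dvd_ne_zero hI (hT J hJ)
      simp only [coe_Iic, Set.mem_Iic]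
      exact (UniqueFactorizationMonoid.dvd_iff_normalizedFactors_le_normalizedFactors hJ0 hI).1
        (hT J hJ)
    · intro J hJ J' hJ' h
      have hJ0 : J ≠ 0 := ne_zero_of_dvd_ne_zero hI (hT J hJ)
      have hJ0' : J' ≠ 0 := ne_zero_of_dvd_ne_zero hI (hT J' hJ')
      exact associated_iff_eq.1
        ((UniqueFactorizationMonoid.associated_iff_normalizedFactors_eq_normalizedFactors
          hJ0 hJ0').2 h)
  have hnorm : (Ideal.absNorm I : ℝ) = ∏ P ∈ f.toFinset, (Ideal.absNorm P : ℝ) ^ f.count P := by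
    have h1 : I = f.prod :=
      (associated_iff_eq.1 (UniqueFactorizationMonoid.prod_normalizedFactors hI)).symm
    conv_lhs => rw [h1]
    rw [map_multiset_prod, prod_multiset_map_count]
    push_cast
    rfl
  have hterm : ∀ P ∈ f.toFinset, ((f.count P : ℝ) + 1) ≤
      (if P ∈ hfin.toFinset then A else 1) * ((Ideal.absNorm P : ℝ) ^ f.count P) ^ ε := by
    intro P hP
    rw [Multiset.mem_toFinset] at hP
    have hprime := UniqueFactorizationMonoid.prime_of_normalized_factor P hP
    have h2 : 2 ≤ Ideal.absNorm P := by
      have h0 : Ideal.absNorm P ≠ 0 := Ideal.absNorm_eq_zero_iff.not.2 hprime.ne_zero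
      have h1 : Ideal.absNorm P ≠ 1 := by
        rw [Ne, Ideal.absNorm_eq_one_iff]
        rintro rfl
        exact hprime.not_isUnit (by simp)
      omega
    split_ifs with h
    · exact add_one_le_mul_pow_rpow hε (by exact_mod_cast h2) _
    · rw [one_mul]
      apply hlarge
      rw [Set.Finite.mem_toFinset, Set.mem_ofPred_eq, not_le] at h
      exact (Nat.le_ceil _).trans (by exact_mod_cast h.le)
  calc (#T : ℝ) ≤ ∏ P ∈ f.toFinset, ((f.count P : ℝ) + 1) := by exact_mod_cast hcard
    _ ≤ ∏ P ∈ f.toFinset, ((if P ∈ hfin.toFinset then A else 1) *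
          ((Ideal.absNorm P : ℝ) ^ f.count P) ^ ε) :=
        prod_le_prod (fun _ _ => by positivity) hterm
    _ = A ^ #{P ∈ f.toFinset | P ∈ hfin.toFinset} * (Ideal.absNorm I : ℝ) ^ ε := by
        rw [prod_mul_distrib, prod_ite, prod_const_one, mul_one, prod_const, hnorm,
          Real.finsetProd_rpow _ _ (fun _ _ => by positivity)]
    _ ≤ A ^ #hfin.toFinset * (Ideal.absNorm I : ℝ) ^ ε := by
        refine mul_le_mul_of_nonneg_right (pow_le_pow_right₀ hA1 (card_le_card fun P hP => ?_))
          (by positivity)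
        exact (mem_filter.1 hP).2

open ComplexConjugate in
theorem im_mul_conj_basis_ne_zero {K : Type} [Field K] [NumberField K]
    (hdeg : Module.finrank ℚ K = 2) (σ : K →+* ℂ) (himag : ∃ x : K, (σ x).im ≠ 0)
    (b : Module.Basis (Fin 2) ℤ (𝓞 K)) : (σ (b 0 : K) * conj (σ (b 1 : K))).im ≠ 0 := by
  intro h
  have hD := discr_eq_neg_sq_of_imaginary_quadratic hdeg σ himag b
  rw [h] at hD
  simp [NumberField.discr_ne_zero] at hD

open Finset in
theorem exists_latticeBound {K : Type} [Field K] [NumberField K]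
    (hdeg : Module.finrank ℚ K = 2) (σ : K →+* ℂ) (himag : ∃ x : K, (σ x).im ≠ 0) :
    ∃ C : ℝ, LatticeBound (σ.comp (algebraMap (𝓞 K) K)) C := by
  classical
  obtain ⟨b⟩ := exists_basis_fin_two hdeg
  have ht := im_mul_conj_basis_ne_zero hdeg σ himag b
  set t := |(σ (b 0 : K) * starRingEnd ℂ (σ (b 1 : K))).im| with htdef
  have ht0 : 0 < t := abs_pos.2 ht
  set w := ‖σ (b 0 : K)‖ + ‖σ (b 1 : K)‖ with hw
  have hw0 : 0 ≤ w := by positivity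
  refine ⟨2 * (3 + 4 * w / t) ^ 2, fun S c ρ hρ hS => ?_⟩
  rcases S.eq_empty_or_nonempty with rfl | ⟨m₀, hm₀⟩
  · simp only [card_empty, Nat.cast_zero]
    positivity
  set T : ℤ := ⌈w * (2 * ρ) / t⌉ with hT
  have hT0 : 0 ≤ T := Int.ceil_nonneg (by positivity)
  have hcoord : ∀ m ∈ S, ∀ i, |b.repr (m - m₀) i| ≤ T := by
    intro m hm i
    have h1 := abs_repr_mul_le σ b (m - m₀) i
    have h2 : ‖σ ((m - m₀ : 𝓞 K) : K)‖ ≤ 2 * ρ := by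
      have e : σ ((m - m₀ : 𝓞 K) : K) =
          ((σ.comp (algebraMap (𝓞 K) K)) m - c) - ((σ.comp (algebraMap (𝓞 K) K)) m₀ - c) := by
        simp
      rw [e]
      refine (norm_sub_le _ _).trans ?_
      have := hS m hm
      have := hS m₀ hm₀
      linarith
    have h3 : (|b.repr (m - m₀) i| : ℝ) ≤ w * (2 * ρ) / t := by
      rw [le_div_iff₀ ht0]
      exact h1.trans (by gcongr)
    have h4 := h3.trans (Int.le_ceil _)
    exact_mod_cast h4
  have hcard : #S ≤ #(Icc (-T) T ×ˢ Icc (-T) T) := by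
    refine card_le_card_of_injOn (fun m => (b.repr (m - m₀) 0, b.repr (m - m₀) 1))
      (fun m hm => ?_) ?_
    · simp only [coe_product, coe_Icc, Set.mem_prod, Set.mem_Icc]
      exact ⟨abs_le.1 (hcoord m hm 0), abs_le.1 (hcoord m hm 1)⟩
    · intro m _ m' _ h
      have h' := Prod.mk.inj h
      have : b.repr (m - m₀) = b.repr (m' - m₀) := by
        ext i
        fin_cases i
        · exact h'.1
        · exact h'.2
      exact sub_left_injective (b.repr.injective this)
  rw [card_product, Int.card_Icc] at hcard
  have hTr : (T : ℝ) ≤ w * (2 * ρ) / t + 1 := (Int.ceil_lt_add_one _).le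
  have h5 : (((T + 1 - -T).toNat : ℕ) : ℝ) = 2 * T + 1 := by
    have : (((T + 1 - -T).toNat : ℕ) : ℤ) = T + 1 - -T := Int.toNat_of_nonneg (by omega)
    have h6 : (((T + 1 - -T).toNat : ℕ) : ℝ) = ((T + 1 - -T : ℤ) : ℝ) := by exact_mod_cast this
    rw [h6]
    push_cast
    ring
  have hTr0 : (0 : ℝ) ≤ T := by exact_mod_cast hT0
  calc (#S : ℝ) ≤ (2 * T + 1) * (2 * T + 1) := by
        rw [← h5]
        exact_mod_cast hcard
    _ ≤ ((3 + 4 * w / t) * (1 + ρ)) ^ 2 := by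
        rw [sq]
        have h7 : 2 * (T : ℝ) + 1 ≤ (3 + 4 * w / t) * (1 + ρ) := by
          have h8 : w * (2 * ρ) / t = 2 * (w / t) * ρ := by ring
          have h9 : 4 * w / t = 4 * (w / t) := by ring
          have h10 : 0 ≤ w / t := by positivity
          rw [h8] at hTr
          rw [h9]
          nlinarith
        gcongr
    _ ≤ 2 * (3 + 4 * w / t) ^ 2 * (1 + ρ ^ 2) := by
        rw [mul_pow]
        have : (1 + ρ) ^ 2 ≤ 2 * (1 + ρ ^ 2) := by nlinarith [sq_nonneg (1 - ρ)]
        calc _ ≤ (3 + 4 * w / t) ^ 2 * (2 * (1 + ρ ^ 2)) := by gcongr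
          _ = _ := by ring

theorem normSq_eq_absNorm_span {K : Type} [Field K] [NumberField K]
    (hdeg : Module.finrank ℚ K = 2) (σ : K →+* ℂ) (himag : ∃ x : K, (σ x).im ≠ 0) (m : 𝓞 K) :
    Complex.normSq (σ (m : K)) = (Ideal.absNorm (Ideal.span {m}) : ℝ) := by
  obtain ⟨_, hn⟩ := prod_sum_algHom_of_imaginary_quadratic hdeg σ himag
  have h := hn (m : K)
  rw [Complex.mul_conj, ← Algebra.coe_norm_int] at h
  have h1 : ((Algebra.norm ℤ m : ℤ) : ℝ) = Complex.normSq (σ (m : K)) := by exact_mod_cast h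
  have h2 : 0 ≤ Algebra.norm ℤ m := by
    have : (0 : ℝ) ≤ ((Algebra.norm ℤ m : ℤ) : ℝ) := h1 ▸ Complex.normSq_nonneg _
    exact_mod_cast this
  rw [Ideal.absNorm_span_singleton, ← h1, Nat.cast_natAbs, abs_of_nonneg h2]

theorem one_le_normSq {K : Type} [Field K] [NumberField K]
    (hdeg : Module.finrank ℚ K = 2) (σ : K →+* ℂ) (himag : ∃ x : K, (σ x).im ≠ 0) {m : 𝓞 K}
    (hm : m ≠ 0) : 1 ≤ Complex.normSq (σ (m : K)) := by
  rw [normSq_eq_absNorm_span hdeg σ himag]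
  have : Ideal.absNorm (Ideal.span {m}) ≠ 0 := by
    rw [Ne, Ideal.absNorm_eq_zero_iff, Ideal.span_singleton_eq_bot]
    exact hm
  exact_mod_cast Nat.one_le_iff_ne_zero.2 this

open Finset in
theorem divisorBound_ringOfIntegers {K : Type} [Field K] [NumberField K]
    (hdeg : Module.finrank ℚ K = 2) (σ : K →+* ℂ) (himag : ∃ x : K, (σ x).im ≠ 0) :
    DivisorBound (σ.comp (algebraMap (𝓞 K) K)) := by
  classical
  intro ε hε
  obtain ⟨C₀, hC₀⟩ := exists_latticeBound hdeg σ himag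
  obtain ⟨C, hC, hdiv⟩ := exists_card_ideal_divisors_le K (ε / 2) (by positivity)
  have hunit := hC₀.finite 1
  set U := hunit.toFinset with hU
  have hU0 : 0 < #U := card_pos.2 ⟨1, by simp [hU]⟩
  refine ⟨#U * C, by positivity, fun m hm S hS => ?_⟩
  have hnorm : ∀ u : (𝓞 K)ˣ, ‖(σ.comp (algebraMap (𝓞 K) K)) (u : 𝓞 K)‖ = 1 := by
    intro u
    have h1 := normSq_eq_absNorm_span hdeg σ himag (u : 𝓞 K)
    rw [Ideal.span_singleton_eq_top.2 u.isUnit, Ideal.absNorm_top, Complex.normSq_eq_norm_sq] at h1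
    have h2 := norm_nonneg (σ ((u : 𝓞 K) : K))
    have h3 : ‖σ ((u : 𝓞 K) : K)‖ = 1 := by
      push_cast at h1
      nlinarith
    exact h3
  have hcard : #S ≤ #U * #(S.image fun h => Ideal.span {h}) := by
    refine card_le_mul_card_image S #U fun J hJ => ?_
    obtain ⟨h₀, hh₀, rfl⟩ := mem_image.1 hJ
    have hh0 : h₀ ≠ 0 := ne_zero_of_dvd_ne_zero hm (hS _ hh₀)
    refine (card_le_card (t := U.image fun u => h₀ * u) fun h hh => ?_).trans card_image_le
    rw [mem_filter] at hh
    obtain ⟨u, hu⟩ := (Ideal.span_singleton_eq_span_singleton.1 hh.2).symm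
    refine mem_image.2 ⟨u, ?_, hu⟩
    rw [hU, Set.Finite.mem_toFinset, Set.mem_ofPred_eq]
    exact (hnorm u).le
  have hideal := hdiv (Ideal.span {m}) (by rwa [Ne, Ideal.span_singleton_eq_bot])
    (S.image fun h => Ideal.span {h}) (by
      intro J hJ
      obtain ⟨h, hh, rfl⟩ := mem_image.1 hJ
      rw [Ideal.dvd_span_singleton, Ideal.mem_span_singleton]
      exact hS h hh)
  rw [← normSq_eq_absNorm_span hdeg σ himag, Complex.normSq_eq_norm_sq, ← Real.rpow_natCast,
    ← Real.rpow_mul (norm_nonneg _)] at hideal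
  have he : ((2 : ℕ) : ℝ) * (ε / 2) = ε := by
    push_cast
    ring
  rw [he] at hideal
  calc (#S : ℝ) ≤ #U * #(S.image fun h => Ideal.span {h}) := by exact_mod_cast hcard
    _ ≤ #U * (C * ‖σ (m : K)‖ ^ ε) := by gcongr
    _ = #U * C * ‖(σ.comp (algebraMap (𝓞 K) K)) m‖ ^ ε := by rw [mul_assoc]; rfl

theorem eK_div_eq_of_mk_eq {K : Type} [Field K] [NumberField K]
    (hdeg : Module.finrank ℚ K = 2) (σ : K →+* ℂ) (himag : ∃ x : K, (σ x).im ≠ 0)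
    {M : ℕ} (hM : M ≠ 0) (n : 𝓞 K) {x y : 𝓞 K}
    (h : Ideal.Quotient.mk (Ideal.span {(M : 𝓞 K)}) x = Ideal.Quotient.mk _ y) :
    eK K (σ (n : K) * σ (x : K) / M) = eK K (σ (n : K) * σ (y : K) / M) := by
  rw [Ideal.Quotient.eq, Ideal.mem_span_singleton] at h
  obtain ⟨z, hz⟩ := h
  have hM' : (M : ℂ) ≠ 0 := by exact_mod_cast hM
  have e : σ (n : K) * σ (x : K) / M = σ (n : K) * σ (y : K) / M + σ ((n * z : 𝓞 K) : K) := by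
    have hx : x = y + M * z := by rw [← hz]; ring
    rw [hx]
    simp only [map_add, map_mul, map_natCast]
    field_simp
  rw [e, eK_add, eK_ringOfIntegers hdeg σ himag, mul_one]

/-- The additive character `x ↦ ẽ_K(n x / M)` of the finite group `𝓞_K / (M)`. -/
noncomputable def quotientChar {K : Type} [Field K] [NumberField K]
    (hdeg : Module.finrank ℚ K = 2) (σ : K →+* ℂ) (himag : ∃ x : K, (σ x).im ≠ 0)
    {M : ℕ} (hM : M ≠ 0) (n : 𝓞 K) :
    AddChar (𝓞 K ⧸ Ideal.span {(M : 𝓞 K)}) ℂ where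
  toFun g := eK K (σ (n : K) * σ ((Quotient.out g : 𝓞 K) : K) / M)
  map_zero_eq_one' := by
    rw [eK_div_eq_of_mk_eq hdeg σ himag hM n (y := 0) ?_]
    · simp [eK]
    · rw [map_zero]
      exact Quotient.out_eq _
  map_add_eq_mul' g h := by
    rw [eK_div_eq_of_mk_eq hdeg σ himag hM n (y := Quotient.out g + Quotient.out h) ?_, ← eK_add]
    · congr 1
      simp only [map_add]
      ring
    · rw [map_add]
      exact (Quotient.out_eq _).trans
        (congrArg₂ (· + ·) (Quotient.out_eq g).symm (Quotient.out_eq h).symm)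

theorem quotientChar_mk {K : Type} [Field K] [NumberField K]
    (hdeg : Module.finrank ℚ K = 2) (σ : K →+* ℂ) (himag : ∃ x : K, (σ x).im ≠ 0)
    {M : ℕ} (hM : M ≠ 0) (n x : 𝓞 K) :
    quotientChar hdeg σ himag hM n (Ideal.Quotient.mk _ x) =
      eK K (σ (n : K) * σ (x : K) / M) :=
  eK_div_eq_of_mk_eq hdeg σ himag hM n (Quotient.out_eq _)

theorem quotientChar_injOn {K : Type} [Field K] [NumberField K]
    (hdeg : Module.finrank ℚ K = 2) (σ : K →+* ℂ) (himag : ∃ x : K, (σ x).im ≠ 0)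
    (b : Module.Basis (Fin 2) ℤ (𝓞 K)) {N : ℝ} {M : ℕ} (hM : M ≠ 0)
    (hMN : 4 * √N * (‖σ (b 0 : K)‖ + ‖σ (b 1 : K)‖) < M)
    {S : Finset (𝓞 K)} (hS : ∀ n ∈ S, ‖σ (n : K)‖ ≤ √N) :
    Set.InjOn (quotientChar hdeg σ himag hM) S := by
  intro n hn n' hn' h
  have ht := im_mul_conj_basis_ne_zero hdeg σ himag b
  have hD : (NumberField.discr K : ℝ) < 0 := by
    rw [discr_eq_neg_sq_of_imaginary_quadratic hdeg σ himag b]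
    have : 0 < (2 * (σ (b 0 : K) * starRingEnd ℂ (σ (b 1 : K))).im) ^ 2 := by positivity
    linarith
  have hsqrt := one_le_sqrt_neg_discr hD
  have hM' : (0 : ℝ) < M := by positivity
  have him : ∀ i, (σ ((n - n' : 𝓞 K) : K) * σ (b i : K)).im = 0 := by
    intro i
    have h1 := DFunLike.congr_fun h (Ideal.Quotient.mk _ (b i))
    rw [quotientChar_mk, quotientChar_mk] at h1
    have h2 : eK K (σ ((n - n' : 𝓞 K) : K) * σ (b i : K) / M) = 1 := by
      have h3 : eK K (σ (n' : K) * σ (b i : K) / M) ≠ 0 := Complex.exp_ne_zero _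
      apply mul_right_cancel₀ h3
      rw [one_mul, ← eK_add, ← h1]
      congr 1
      simp only [map_sub]
      ring
    obtain ⟨z, hz⟩ := (eK_eq_one_iff _).1 h2
    rw [Complex.div_natCast_im] at hz
    have hnorm : |(σ ((n - n' : 𝓞 K) : K) * σ (b i : K)).im| ≤
        2 * √N * (‖σ (b 0 : K)‖ + ‖σ (b 1 : K)‖) := by
      refine (Complex.abs_im_le_norm _).trans ?_
      rw [norm_mul]
      gcongr
      · rw [show σ ((n - n' : 𝓞 K) : K) = σ (n : K) - σ (n' : K) by simp]
        refine (norm_sub_le _ _).trans ?_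
        have := hS n hn
        have := hS n' hn'
        linarith
      · fin_cases i
        · exact le_add_of_nonneg_right (norm_nonneg _)
        · exact le_add_of_nonneg_left (norm_nonneg _)
    have hz1 : |(z : ℝ)| < 1 := by
      rw [← hz, abs_div, abs_mul, abs_two, abs_div, abs_of_pos hM',
        abs_of_pos (by linarith : 0 < √(-(NumberField.discr K : ℝ))), div_lt_one (by linarith),
        ← mul_div_assoc, div_lt_iff₀ hM']
      nlinarith
    have hz0 : z = 0 := by
      have : |z| < 1 := by exact_mod_cast hz1
      exact Int.abs_lt_one_iff.1 this
    rw [hz0, Int.cast_zero, div_eq_zero_iff] at hz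
    rcases hz with hz | hz
    · rcases mul_eq_zero.1 hz with h0 | h0
      · norm_num at h0
      · exact (div_eq_zero_iff.1 h0).resolve_right hM'.ne'
    · linarith
  have h0 := him 0
  have h1 := him 1
  simp only [Complex.mul_im, Complex.conj_re, Complex.conj_im] at h0 h1 ht
  have hzero : σ ((n - n' : 𝓞 K) : K) = 0 := by
    apply Complex.ext
    · refine (mul_eq_zero.1 ?_).resolve_right ht
      linear_combination (σ (b 1 : K)).re * h0 - (σ (b 0 : K)).re * h1
    · refine (mul_eq_zero.1 ?_).resolve_right ht
      linear_combination (σ (b 0 : K)).im * h1 - (σ (b 1 : K)).im * h0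
  rw [map_eq_zero] at hzero
  exact sub_eq_zero.1 (RingOfIntegers.coe_eq_zero_iff.1 hzero)

/-- The images in `𝓞_K / (M)` of the integers with coordinates in `[-T, T]`. -/
noncomputable def boxImage {K : Type} [Field K] [NumberField K]
    (b : Module.Basis (Fin 2) ℤ (𝓞 K)) (M T : ℕ) : Finset (𝓞 K ⧸ Ideal.span {(M : 𝓞 K)}) :=
  by
    classical
    exact (Finset.Icc (-(T : ℤ)) T ×ˢ Finset.Icc (-(T : ℤ)) T).image
      fun v => Ideal.Quotient.mk _ (v.1 • b 0 + v.2 • b 1)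

theorem exists_of_mem_boxImage {K : Type} [Field K] [NumberField K] (σ : K →+* ℂ)
    (b : Module.Basis (Fin 2) ℤ (𝓞 K)) {M T : ℕ} {g : 𝓞 K ⧸ Ideal.span {(M : 𝓞 K)}}
    (hg : g ∈ boxImage b M T) : ∃ y : 𝓞 K, Ideal.Quotient.mk _ y = g ∧
      ‖σ (y : K)‖ ≤ T * (‖σ (b 0 : K)‖ + ‖σ (b 1 : K)‖) := by
  classical
  rw [boxImage, Finset.mem_image] at hg
  obtain ⟨⟨i, j⟩, hv, rfl⟩ := hg
  refine ⟨_, rfl, ?_⟩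
  simp only [Finset.mem_product, Finset.mem_Icc] at hv
  have hi : |(i : ℝ)| ≤ T := abs_le.2 (by exact_mod_cast hv.1)
  have hj : |(j : ℝ)| ≤ T := abs_le.2 (by exact_mod_cast hv.2)
  have e : σ ((i • b 0 + j • b 1 : 𝓞 K) : K) = (i : ℂ) * σ (b 0 : K) + (j : ℂ) * σ (b 1 : K) := by
    simp
  rw [e]
  refine (norm_add_le _ _).trans ?_
  rw [norm_mul, norm_mul, Complex.norm_intCast, Complex.norm_intCast, mul_add]
  gcongr

theorem card_boxImage {K : Type} [Field K] [NumberField K]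
    (b : Module.Basis (Fin 2) ℤ (𝓞 K)) {M T : ℕ} (h : 2 * T < M) :
    (boxImage b M T).card = (2 * T + 1) ^ 2 := by
  classical
  rw [boxImage, Finset.card_image_of_injOn, Finset.card_product, Int.card_Icc, sq]
  · congr 1 <;> omega
  · rintro ⟨i, j⟩ hv ⟨i', j'⟩ hv' he
    simp only [Finset.coe_product, Finset.coe_Icc, Set.mem_prod, Set.mem_Icc] at hv hv'
    rw [Ideal.Quotient.eq, Ideal.mem_span_singleton] at he
    obtain ⟨z, hz⟩ := he
    have hz' : (i - i') • b 0 + (j - j') • b 1 = (M : ℤ) • z := by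
      rw [show (M : ℤ) • z = (M : 𝓞 K) * z by simp [zsmul_eq_mul], ← hz]
      module
    have hc := congrArg b.repr hz'
    simp only [map_add, map_smul, Module.Basis.repr_self] at hc
    have h0 := DFunLike.congr_fun hc 0
    have h1 := DFunLike.congr_fun hc 1
    simp at h0 h1
    have hi : i - i' = 0 := Int.eq_zero_of_abs_lt_dvd ⟨_, h0⟩ (by rw [abs_lt]; omega)
    have hj : j - j' = 0 := Int.eq_zero_of_abs_lt_dvd ⟨_, h1⟩ (by rw [abs_lt]; omega)
    rw [Prod.mk.injEq]
    omega

theorem card_quotient_span_natCast {K : Type} [Field K] [NumberField K]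
    (hdeg : Module.finrank ℚ K = 2) (M : ℕ) :
    Nat.card (𝓞 K ⧸ Ideal.span {(M : 𝓞 K)}) = M ^ 2 := by
  have h := Ideal.absNorm_span_natCast (S := 𝓞 K) M
  rw [RingOfIntegers.rank, hdeg] at h
  exact h

theorem exists_natCast_mul_dvd {K : Type} [Field K] [NumberField K] {J : Type*} (F : Finset J)
    (f : J → 𝓞 K) (hf : ∀ p ∈ F, f p ≠ 0) (L : ℝ) :
    ∃ M : ℕ, L < M ∧ M ≠ 0 ∧ ∀ p ∈ F, f p ∣ (M : 𝓞 K) := by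
  obtain ⟨n, hn⟩ := exists_nat_gt L
  set A := ∏ p ∈ F, Ideal.absNorm (Ideal.span {f p}) with hA
  have hA0 : A ≠ 0 := by
    refine Finset.prod_ne_zero_iff.2 fun p hp => ?_
    rw [Ne, Ideal.absNorm_eq_zero_iff, Ideal.span_singleton_eq_bot]
    exact hf p hp
  refine ⟨(n + 1) * A, ?_, by positivity, fun p hp => ?_⟩
  · have h1 : n ≤ (n + 1) * A :=
      (Nat.le_succ n).trans (Nat.le_mul_of_pos_right _ (Nat.pos_of_ne_zero hA0))
    exact hn.trans_le (by exact_mod_cast h1)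
  · have h1 : f p ∣ ((Ideal.absNorm (Ideal.span {f p}) : ℕ) : 𝓞 K) :=
      Ideal.mem_span_singleton.1 (Ideal.absNorm_mem _)
    refine h1.trans (Nat.cast_dvd_cast ?_)
    exact (Finset.dvd_prod_of_mem (fun p => Ideal.absNorm (Ideal.span {f p})) hp).mul_left _

open Finset Classical Pointwise in
/-- The large sieve for fractions `r / q ^ (d + 1)` whose denominators satisfy
`X ≤ N(q) ≤ 2 X`. -/
theorem large_sieve_dyadic {K : Type} [Field K] [NumberField K]
    (hdeg : Module.finrank ℚ K = 2) (σ : K →+* ℂ) (himag : ∃ x : K, (σ x).im ≠ 0)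
    (d : ℕ) (ε : ℝ) (hε : 0 < ε) :
    ∃ C : ℝ, 0 < C ∧ ∀ X N : ℝ, 1 ≤ X → 1 ≤ N → ∀ F : Finset (𝓞 K × 𝓞 K),
      (∀ p ∈ F, X ≤ ‖σ (p.1 : K)‖ ^ 2 ∧ ‖σ (p.1 : K)‖ ^ 2 ≤ 2 * X ∧ IsCoprime p.2 p.1) →
      (∀ p ∈ F, ∀ p' ∈ F, p.1 = p'.1 → p.1 ^ (d + 1) ∣ p.2 - p'.2 → p = p') →
      ∀ S : Finset (𝓞 K), (∀ n ∈ S, ‖σ (n : K)‖ ^ 2 ≤ N) → ∀ a : 𝓞 K → ℂ,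
      ∑ p ∈ F, ‖∑ n ∈ S, a n * eK K (σ (n : K) * σ (p.2 : K) / σ (p.1 : K) ^ (d + 1))‖ ^ 2 ≤
        C * X ^ ε * (X ^ ((d : ℝ) + 2) + N * X ^ (1 - 1 / (2 : ℝ) ^ d) +
          N ^ (1 - 1 / (2 : ℝ) ^ d) * X ^ (1 + ((d : ℝ) + 1) / (2 : ℝ) ^ d)) *
          ∑ n ∈ S, ‖a n‖ ^ 2 := by
  obtain ⟨b⟩ := exists_basis_fin_two hdeg
  obtain ⟨C₀, hC₀⟩ := exists_latticeBound hdeg σ himag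
  set s := σ.comp (algebraMap (𝓞 K) K) with hs
  have hsinj : Function.Injective s :=
    σ.injective.comp (FaithfulSMul.algebraMap_injective (𝓞 K) K)
  obtain ⟨C', hC', hcount⟩ := card_near_fractions_le s hsinj hC₀
    (divisorBound_ringOfIntegers hdeg σ himag) d ε hε 1 zero_le_one
  set w := ‖σ (b 0 : K)‖ + ‖σ (b 1 : K)‖ with hw
  have hw0 : 0 ≤ w := by positivity
  set c := 1 / (8 * Real.pi * (w + 1)) with hc
  have hpi := Real.pi_gt_three
  have hc0 : 0 < c := by positivity
  have hcw : 8 * Real.pi * (c * w) ≤ 1 := by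
    rw [hc, ← mul_assoc, mul_one_div, ← div_div, div_self (by positivity), one_div_mul_eq_div,
      div_le_one (by positivity)]
    linarith
  have hc1 : 2 * c < 1 := by
    rw [hc, mul_one_div, div_lt_one (by positivity)]
    nlinarith
  have hD : (NumberField.discr K : ℝ) < 0 := by
    have := im_mul_conj_basis_ne_zero hdeg σ himag b
    rw [discr_eq_neg_sq_of_imaginary_quadratic hdeg σ himag b]
    have : 0 < (2 * (σ (b 0 : K) * starRingEnd ℂ (σ (b 1 : K))).im) ^ 2 := by positivity
    linarith
  refine ⟨4 * C' / c ^ 2, by positivity, fun X N hX hN F hF hF' S hS a => ?_⟩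
  set E := X ^ ((d : ℝ) + 2) + N * X ^ (1 - 1 / (2 : ℝ) ^ d) +
    N ^ (1 - 1 / (2 : ℝ) ^ d) * X ^ (1 + ((d : ℝ) + 1) / (2 : ℝ) ^ d) with hE
  have hE0 : 0 ≤ E := by positivity
  have hN0 : 0 < √N := Real.sqrt_pos.2 (by linarith)
  have hsqN : √N ^ 2 = N := Real.sq_sqrt (by linarith)
  have hq0 : ∀ p ∈ F, p.1 ≠ 0 := by
    intro p hp h
    have := (hF p hp).1
    rw [h] at this
    simp at this
    linarith
  obtain ⟨M, hML, hM, hdvd⟩ := exists_natCast_mul_dvd F (fun p => p.1 ^ (d + 1))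
    (fun p hp => pow_ne_zero _ (hq0 p hp)) (4 * √N * w)
  have hM0 : (0 : ℝ) < M := by positivity
  have hMC : (M : ℂ) ≠ 0 := by exact_mod_cast hM
  have hS' : ∀ n ∈ S, ‖σ (n : K)‖ ≤ √N := fun n hn => Real.le_sqrt_of_sq_le (hS n hn)
  choose! y hy using hdvd
  have hysigma : ∀ p ∈ F, σ (y p : K) / M = 1 / σ (p.1 : K) ^ (d + 1) := by
    intro p hp
    have h1 : (M : ℂ) = σ (p.1 : K) ^ (d + 1) * σ (y p : K) := by
      have := congrArg s (hy p hp)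
      simpa [hs] using this
    have h2 : σ (p.1 : K) ^ (d + 1) ≠ 0 := by
      intro h
      rw [h, zero_mul] at h1
      exact hMC h1
    rw [div_eq_div_iff hMC h2, h1]
    ring
  set T := ⌊c * M / √N⌋₊ with hT
  have hTle : (T : ℝ) ≤ c * M / √N := Nat.floor_le (by positivity)
  have hTM : 2 * T < M := by
    have h1 : c * M / √N ≤ c * M := div_le_self (by positivity) (Real.one_le_sqrt.2 hN)
    have h2 : (2 * T : ℝ) < M := by nlinarith
    exact_mod_cast h2
  have hGfin : Finite (𝓞 K ⧸ Ideal.span {(M : 𝓞 K)}) := by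
    apply Nat.finite_of_card_ne_zero
    rw [card_quotient_span_natCast hdeg]
    positivity
  let _ : Fintype (𝓞 K ⧸ Ideal.span {(M : 𝓞 K)}) := Fintype.ofFinite _
  have hGcard : (Fintype.card (𝓞 K ⧸ Ideal.span {(M : 𝓞 K)}) : ℝ) = M ^ 2 := by
    rw [← Nat.card_eq_fintype_card, card_quotient_span_natCast hdeg]
    push_cast
    rfl
  have hBcard := card_boxImage b hTM
  have hB0 : (boxImage b M T).Nonempty := by
    rw [← card_pos, hBcard]
    positivity
  have hB : ∀ n ∈ S, ∀ t ∈ boxImage b M T, ‖quotientChar hdeg σ himag hM n t - 1‖ ≤ 1 / 2 := by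
    intro n hn t ht
    obtain ⟨z, rfl, hz⟩ := exists_of_mem_boxImage σ b ht
    rw [quotientChar_mk]
    refine (norm_eK_sub_one_le hD _).trans ?_
    rw [norm_div, norm_mul, Complex.norm_natCast]
    calc 4 * Real.pi * (‖σ (n : K)‖ * ‖σ (z : K)‖ / M)
        ≤ 4 * Real.pi * (√N * ((c * M / √N) * w) / M) := by
          gcongr
          · exact hS' n hn
          · exact hz.trans (by gcongr)
      _ = 4 * Real.pi * (c * w) := by field_simp
      _ ≤ 1 / 2 := by linarith
  have hP : ∀ p₀ ∈ F, (#{p ∈ F | Ideal.Quotient.mk (Ideal.span {(M : 𝓞 K)}) (y p * p.2) -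
      Ideal.Quotient.mk _ (y p₀ * p₀.2) ∈ boxImage b M T - boxImage b M T} : ℝ) ≤
      C' * X ^ ε * E / N := by
    intro p₀ hp₀
    rw [le_div_iff₀ (by linarith), mul_comm]
    refine le_trans ?_ (hcount X N hX hN F hF hF' p₀ hp₀)
    gcongr with p hp
    intro hmem
    obtain ⟨t, ht, t', ht', htt⟩ := mem_sub.1 hmem
    obtain ⟨z, rfl, hz⟩ := exists_of_mem_boxImage σ b ht
    obtain ⟨z', rfl, hz'⟩ := exists_of_mem_boxImage σ b ht'
    rw [← map_sub, ← map_sub, eq_comm, Ideal.Quotient.eq, Ideal.mem_span_singleton] at htt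
    obtain ⟨v, hv⟩ := htt
    refine ⟨v, ?_⟩
    have hv' := congrArg s hv
    simp only [map_sub, map_mul, map_natCast] at hv'
    have e1 : s p.2 / s p.1 ^ (d + 1) = s (y p) * s p.2 / M := by
      have := hysigma p hp
      rw [mul_div_right_comm, show s (y p) / M = 1 / s p.1 ^ (d + 1) from this]
      ring
    have e2 : s p₀.2 / s p₀.1 ^ (d + 1) = s (y p₀) * s p₀.2 / M := by
      have := hysigma p₀ hp₀
      rw [mul_div_right_comm, show s (y p₀) / M = 1 / s p₀.1 ^ (d + 1) from this]
      ring
    have e3 : s p.2 / s p.1 ^ (d + 1) - s p₀.2 / s p₀.1 ^ (d + 1) - s v = (s z - s z') / M := by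
      rw [e1, e2]
      field_simp
      linear_combination hv'
    rw [e3, norm_div, Complex.norm_natCast, div_le_div_iff₀ hM0 hN0, one_mul]
    have h1 : ‖s z - s z'‖ ≤ 2 * (c * M / √N * w) := by
      refine (norm_sub_le _ _).trans ?_
      have h2 : (T : ℝ) * w ≤ c * M / √N * w := by gcongr
      have hz2 : ‖s z‖ ≤ T * w := hz
      have hz2' : ‖s z'‖ ≤ T * w := hz'
      linarith
    calc ‖s z - s z'‖ * √N ≤ 2 * (c * M / √N * w) * √N := by gcongr
      _ = 2 * (c * w) * M := by field_simp
      _ ≤ 1 * M := by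
          gcongr
          have : 0 ≤ c * w := by positivity
          nlinarith
      _ = M := one_mul _
  have key := large_sieve_addChar (quotientChar hdeg σ himag hM) S
    (quotientChar_injOn hdeg σ himag b hM hML hS') (boxImage b M T) hB0 hB F
    (fun p => Ideal.Quotient.mk _ (y p * p.2)) (C' * X ^ ε * E / N) (by positivity) hP a
  have hsum : ∑ p ∈ F, ‖∑ n ∈ S, a n *
        eK K (σ (n : K) * σ (p.2 : K) / σ (p.1 : K) ^ (d + 1))‖ ^ 2 =
      ∑ p ∈ F, ‖∑ n ∈ S, a n *
        quotientChar hdeg σ himag hM n (Ideal.Quotient.mk _ (y p * p.2))‖ ^ 2 := by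
    refine sum_congr rfl fun p hp => ?_
    congr 2
    refine sum_congr rfl fun n hn => ?_
    rw [quotientChar_mk]
    congr 2
    have := hysigma p hp
    calc σ (n : K) * σ (p.2 : K) / σ (p.1 : K) ^ (d + 1)
        = σ (n : K) * σ (p.2 : K) * (1 / σ (p.1 : K) ^ (d + 1)) := by ring
      _ = σ (n : K) * σ ((y p * p.2 : 𝓞 K) : K) / M := by
          rw [← this]
          simp only [map_mul]
          ring
  rw [hsum]
  refine key.trans ?_
  have hbox : (M : ℝ) ^ 2 / ((boxImage b M T).card : ℝ) ≤ N / c ^ 2 := by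
    rw [hBcard, div_le_div_iff₀ (by positivity) (by positivity)]
    have h1 : c * M / √N ≤ 2 * T + 1 := by
      have := (Nat.lt_floor_add_one (c * M / √N)).le
      have h0 : (0 : ℝ) ≤ T := Nat.cast_nonneg _
      linarith
    rw [div_le_iff₀ hN0] at h1
    push_cast
    calc (M : ℝ) ^ 2 * c ^ 2 = (c * M) ^ 2 := by ring
      _ ≤ ((2 * T + 1) * √N) ^ 2 := by gcongr
      _ = N * (2 * T + 1) ^ 2 := by rw [mul_pow, hsqN]; ring
  rw [hGcard]
  have hsum0 : 0 ≤ ∑ n ∈ S, ‖a n‖ ^ 2 := by positivity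
  calc 4 * (C' * X ^ ε * E / N) * ((M : ℝ) ^ 2 / ((boxImage b M T).card : ℝ)) * ∑ n ∈ S, ‖a n‖ ^ 2
      ≤ 4 * (C' * X ^ ε * E / N) * (N / c ^ 2) * ∑ n ∈ S, ‖a n‖ ^ 2 := by gcongr
    _ = 4 * C' / c ^ 2 * X ^ ε * E * ∑ n ∈ S, ‖a n‖ ^ 2 := by field_simp

theorem tsum_subtype_eq_sum {α β : Type*} [AddCommMonoid β] [TopologicalSpace β] {P : α → Prop}
    {A : Finset α} (h : ∀ x, x ∈ A ↔ P x) (f : α → β) :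
    ∑' x : {x // P x}, f x.1 = ∑ x ∈ A, f x := by
  obtain rfl : (fun x => x ∈ A) = P := funext fun x => propext (h x)
  exact Finset.tsum_subtype A f

/-- the large sieve with k-th power moduli in an imaginary quadratic number
field K (K is quadratic and admits a non-real complex embedding σ; norms are computed as
N(q) = |σ(q)|²).  For each modulus q, the inner sum runs over a complete set R q of
residues modulo q^k coprime to q.  Then, with κ = 2^{k-1},
Σ_{0 ≠ q, N(q) ≤ Q} Σ_{r mod q^k, (r,q)=1} |Σ_{N(n) ≤ N} a_n ẽ_K(nr/q^k)|²
  ≪_{k,ε} (QN)^ε (Q^{k+1} + N Q^{1-1/κ} + N^{1-1/κ} Q^{1+k/κ}) Σ_{N(n) ≤ N} |a_n|². -/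
theorem large_sieve_power_moduli (K : Type) [Field K] [NumberField K]
    (hdeg : Module.finrank ℚ K = 2)
    (σ : K →+* ℂ) (himag : ∃ x : K, (σ x).im ≠ 0)
    (k : ℕ) (hk : 1 ≤ k) (ε : ℝ) (hε : 0 < ε) :
    ∃ C : ℝ, ∀ Q N : ℝ, 1 ≤ Q → 1 ≤ N →
      ∀ a : 𝓞 K → ℂ, ∀ R : 𝓞 K → Finset (𝓞 K),
      (∀ q : 𝓞 K, q ≠ 0 → Complex.normSq (σ (q : K)) ≤ Q →
        (∀ r ∈ R q, IsCoprime r q) ∧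
        (∀ s : 𝓞 K, IsCoprime s q → ∃! r : 𝓞 K, r ∈ R q ∧ q ^ k ∣ s - r)) →
      (∑' q : {q : 𝓞 K // q ≠ 0 ∧ Complex.normSq (σ (q : K)) ≤ Q},
          ∑ r ∈ R q.1,
            ‖∑' n : {n : 𝓞 K // Complex.normSq (σ (n : K)) ≤ N},
                a n.1 * eK K (σ (n.1 : K) * σ (r : K) / σ (q.1 : K) ^ k)‖ ^ 2)
      ≤ C * (Q * N) ^ ε *
          (Q ^ ((k : ℝ) + 1) + N * Q ^ (1 - 1 / (2 : ℝ) ^ (k - 1)) +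
            N ^ (1 - 1 / (2 : ℝ) ^ (k - 1)) * Q ^ (1 + (k : ℝ) / (2 : ℝ) ^ (k - 1))) *
          ∑' n : {n : 𝓞 K // Complex.normSq (σ (n : K)) ≤ N}, ‖a n.1‖ ^ 2 := by
  classical
  obtain ⟨d, rfl⟩ : ∃ d, k = d + 1 := ⟨k - 1, by omega⟩
  obtain ⟨C₀, hC₀⟩ := exists_latticeBound hdeg σ himag
  obtain ⟨C, hC, hdyadic⟩ := large_sieve_dyadic hdeg σ himag d (ε / 2) (by positivity)
  set A := 1 + 1 / (ε / 2 * Real.log 2) with hA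
  have hlog : 0 < Real.log 2 := Real.log_pos (by norm_num)
  have hA0 : 0 < A := by positivity
  refine ⟨A * C, fun Q N hQ hN a R hR => ?_⟩
  have hQ0 : 0 < Q := by linarith
  have hmem : ∀ (B : ℝ), 1 ≤ B → ∀ x : 𝓞 K,
      x ∈ (hC₀.finite √B).toFinset ↔ Complex.normSq (σ (x : K)) ≤ B := by
    intro B hB x
    rw [Set.Finite.mem_toFinset, Set.mem_ofPred_eq, Complex.normSq_eq_norm_sq,
      Real.le_sqrt (norm_nonneg _) (by linarith)]
    rfl
  set S := (hC₀.finite √N).toFinset with hS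
  set D := {q ∈ (hC₀.finite √Q).toFinset | q ≠ 0} with hD
  have hDmem : ∀ q, q ∈ D ↔ q ≠ 0 ∧ Complex.normSq (σ (q : K)) ≤ Q := by
    intro q
    rw [hD, Finset.mem_filter, hmem Q hQ, and_comm]
  rw [tsum_subtype_eq_sum (hmem N hN) (fun n => ‖a n‖ ^ 2)]
  rw [tsum_subtype_eq_sum hDmem (fun q => ∑ r ∈ R q,
    ‖∑' n : {n : 𝓞 K // Complex.normSq (σ (n : K)) ≤ N},
      a n.1 * eK K (σ (n.1 : K) * σ (r : K) / σ (q : K) ^ (d + 1))‖ ^ 2)]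
  have hinner : ∀ q r : 𝓞 K, ∑' n : {n : 𝓞 K // Complex.normSq (σ (n : K)) ≤ N},
      a n.1 * eK K (σ (n.1 : K) * σ (r : K) / σ (q : K) ^ (d + 1)) =
      ∑ n ∈ S, a n * eK K (σ (n : K) * σ (r : K) / σ (q : K) ^ (d + 1)) := fun q r =>
    tsum_subtype_eq_sum (hmem N hN)
      (fun n => a n * eK K (σ (n : K) * σ (r : K) / σ (q : K) ^ (d + 1)))
  simp only [hinner]
  set E := Q ^ ((d : ℝ) + 2) + N * Q ^ (1 - 1 / (2 : ℝ) ^ d) +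
    N ^ (1 - 1 / (2 : ℝ) ^ d) * Q ^ (1 + ((d : ℝ) + 1) / (2 : ℝ) ^ d) with hE
  have hE0 : 0 ≤ E := by positivity
  have hEeq : Q ^ (((d + 1 : ℕ) : ℝ) + 1) + N * Q ^ (1 - 1 / (2 : ℝ) ^ (d + 1 - 1)) +
      N ^ (1 - 1 / (2 : ℝ) ^ (d + 1 - 1)) *
        Q ^ (1 + ((d + 1 : ℕ) : ℝ) / (2 : ℝ) ^ (d + 1 - 1)) = E := by
    rw [hE, Nat.add_sub_cancel, Nat.cast_add_one, add_assoc (d : ℝ), one_add_one_eq_two]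
  rw [hEeq]
  set W := ∑ n ∈ S, ‖a n‖ ^ 2 with hW
  have hW0 : 0 ≤ W := by positivity
  set level : 𝓞 K → ℕ := fun q => Nat.log 2 ⌊Complex.normSq (σ (q : K))⌋₊ with hlevel
  set J := Nat.log 2 ⌊Q⌋₊ with hJ
  have hQfloor : ⌊Q⌋₊ ≠ 0 := (Nat.floor_pos.2 hQ).ne'
  have hpowJ : ∀ j ≤ J, (2 : ℝ) ^ j ≤ Q := by
    intro j hj
    have h1 : 2 ^ j ≤ ⌊Q⌋₊ :=
      (Nat.pow_le_pow_right two_pos hj).trans (Nat.pow_log_le_self 2 hQfloor)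
    have h2 : ((2 ^ j : ℕ) : ℝ) ≤ ⌊Q⌋₊ := by exact_mod_cast h1
    push_cast at h2
    exact h2.trans (Nat.floor_le hQ0.le)
  have hmaps : ∀ q ∈ D, level q ∈ Finset.range (J + 1) := by
    intro q hq
    rw [Finset.mem_range, Nat.lt_succ_iff]
    exact Nat.log_mono_right (Nat.floor_le_floor ((hDmem q).1 hq).2)
  have hlev : ∀ q ∈ D, (2 : ℝ) ^ level q ≤ ‖σ (q : K)‖ ^ 2 ∧
      ‖σ (q : K)‖ ^ 2 ≤ 2 * (2 : ℝ) ^ level q := by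
    intro q hq
    have h1 := one_le_normSq hdeg σ himag ((hDmem q).1 hq).1
    have h2 : ⌊Complex.normSq (σ (q : K))⌋₊ ≠ 0 := (Nat.floor_pos.2 h1).ne'
    rw [← Complex.normSq_eq_norm_sq]
    constructor
    · have h3 : ((2 ^ level q : ℕ) : ℝ) ≤ ⌊Complex.normSq (σ (q : K))⌋₊ := by
        exact_mod_cast Nat.pow_log_le_self 2 h2
      push_cast at h3
      exact h3.trans (Nat.floor_le (by linarith))
    · have h3 : ⌊Complex.normSq (σ (q : K))⌋₊ + 1 ≤ 2 ^ (level q + 1) :=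
        Nat.lt_pow_succ_log_self one_lt_two _
      have h4 : ((⌊Complex.normSq (σ (q : K))⌋₊ : ℝ) + 1) ≤ (2 : ℝ) ^ (level q + 1) := by
        exact_mod_cast h3
      rw [pow_succ] at h4
      have := Nat.lt_floor_add_one (Complex.normSq (σ (q : K)))
      linarith
  have hblock : ∀ j ∈ Finset.range (J + 1),
      ∑ q ∈ D with level q = j, ∑ r ∈ R q,
        ‖∑ n ∈ S, a n * eK K (σ (n : K) * σ (r : K) / σ (q : K) ^ (d + 1))‖ ^ 2 ≤
      C * Q ^ (ε / 2) * E * W := by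
    intro j hj
    have hjQ := hpowJ j (Nat.lt_succ_iff.1 (Finset.mem_range.1 hj))
    set F : Finset (𝓞 K × 𝓞 K) := ({q ∈ D | level q = j}.sigma R).image fun x => (x.1, x.2)
      with hF
    have hFmem : ∀ p : 𝓞 K × 𝓞 K, p ∈ F ↔ p.1 ∈ {q ∈ D | level q = j} ∧ p.2 ∈ R p.1 := by
      rintro ⟨q, r⟩
      simp only [hF, Finset.mem_image, Finset.mem_sigma, Prod.mk.injEq, Sigma.exists]
      constructor
      · rintro ⟨q', r', h, rfl, rfl⟩
        exact h
      · exact fun h => ⟨q, r, h, rfl, rfl⟩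
    rw [← Finset.sum_finset_product' F _ R hFmem]
    have h1 : (1 : ℝ) ≤ 2 ^ j := one_le_pow₀ one_le_two
    refine (hdyadic (2 ^ j) N h1 hN F ?_ ?_ S ?_ a).trans ?_
    · intro p hp
      obtain ⟨hp1, hp2⟩ := (hFmem p).1 hp
      obtain ⟨hpD, rfl⟩ := Finset.mem_filter.1 hp1
      obtain ⟨h0, hle⟩ := (hDmem _).1 hpD
      exact ⟨(hlev _ hpD).1, (hlev _ hpD).2, (hR _ h0 hle).1 _ hp2⟩
    · rintro ⟨q, r⟩ hp ⟨q', r'⟩ hp' (rfl : q = q') hdvd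
      obtain ⟨hp1, hp2⟩ := (hFmem _).1 hp
      obtain ⟨hp1', hp2'⟩ := (hFmem _).1 hp'
      obtain ⟨h0, hle⟩ := (hDmem _).1 (Finset.mem_filter.1 hp1).1
      obtain ⟨hcop, huniq⟩ := hR _ h0 hle
      have := (huniq r (hcop r hp2)).unique ⟨hp2, by simp⟩ ⟨hp2', hdvd⟩
      exact congrArg (Prod.mk q) this
    · intro n hn
      rw [← Complex.normSq_eq_norm_sq]
      exact (hmem N hN n).1 hn
    · have h2 : (0 : ℝ) ≤ 1 - 1 / 2 ^ d := by
        rw [sub_nonneg, div_le_one (by positivity)]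
        exact one_le_pow₀ one_le_two
      rw [hE]
      gcongr
  have hcount : (J : ℝ) + 1 ≤ A * Q ^ (ε / 2) := by
    refine (add_one_le_mul_pow_rpow (half_pos hε) le_rfl J).trans ?_
    have := hpowJ J le_rfl
    gcongr
  have hQN : Q ^ ε ≤ (Q * N) ^ ε := by
    have : Q ≤ Q * N := le_mul_of_one_le_right hQ0.le hN
    gcongr
  rw [← Finset.sum_fiberwise_of_maps_to hmaps]
  calc _ ≤ ∑ _j ∈ Finset.range (J + 1), C * Q ^ (ε / 2) * E * W := Finset.sum_le_sum hblock
    _ = ((J : ℝ) + 1) * (C * Q ^ (ε / 2) * E * W) := by simp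
    _ ≤ A * Q ^ (ε / 2) * (C * Q ^ (ε / 2) * E * W) := by gcongr
    _ = A * C * Q ^ ε * E * W := by
        rw [show Q ^ ε = Q ^ (ε / 2) * Q ^ (ε / 2) by rw [← Real.rpow_add hQ0, add_halves]]
        ring
    _ ≤ A * C * (Q * N) ^ ε * E * W := by gcongr
end

section
/- Let K be an imaginary quadratic number field of class number one, Q, N ≥ 1, and (a_n)_{n ∈ 𝓞_K} any sequence of complex numbers. Then for any ε > 0, Σ_{q ∈ 𝓞_K \ {0}, N(q) ≤ Q} Σ_{a mod q², (a,q)=1} |Σ_{n ∈ 𝓞_K, N(n) ≤ N} a_n · ẽ_K(na/q²)|² ≪_ε (QN)^ε (Q³ + Q²√N + N) · Σ_{n ∈ 𝓞_K, N(n) ≤ N} |a_n|². -/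
open NumberField

open MeasureTheory UnitAddTorus in
theorem integral_mFourier_of_ne_zero {n : Fin 2 → ℤ} (hn : n ≠ 0) :
    ∫ x : UnitAddTorus (Fin 2), mFourier n x = 0 := by
  obtain ⟨i, hi⟩ := Function.ne_iff.1 hn
  have h : ∫ x : UnitAddTorus (Fin 2), mFourier n x
      = ∏ j, ∫ y : UnitAddCircle, fourier (n j) y := by
    simpa [mFourier] using integral_fintype_prod_volume_eq_prod (ι := Fin 2)
      (fun j (y : UnitAddCircle) => (fourier (n j) y : ℂ))
  rw [h]
  refine Finset.prod_eq_zero (Finset.mem_univ i) ?_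
  exact integral_eq_zero_of_add_right_eq_neg (μ := volume)
      (fourier_add_half_inv_index (T := 1) hi zero_lt_one)

open MeasureTheory UnitAddTorus in
theorem integral_norm_sq_sum_mFourier {ν : Type*} (F : Finset ν) (f : ν → Fin 2 → ℤ)
    (hf : Set.InjOn f F) (c : ν → ℂ) :
    ∫ x : UnitAddTorus (Fin 2), ‖∑ n ∈ F, c n * mFourier (f n) x‖ ^ 2 = ∑ n ∈ F, ‖c n‖ ^ 2 := by
  have hint : ∀ g : C(UnitAddTorus (Fin 2), ℂ), Integrable g := fun g =>
    g.continuous.integrable_of_hasCompactSupport (HasCompactSupport.of_compactSpace _)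
  have hexp : ∀ x : UnitAddTorus (Fin 2), ((‖∑ n ∈ F, c n * mFourier (f n) x‖ ^ 2 : ℝ) : ℂ)
      = ∑ n ∈ F, ∑ m ∈ F, (c n * (starRingEnd ℂ) (c m)) * mFourier (f n + -f m) x := by
    intro x
    rw [Complex.ofReal_pow, ← Complex.mul_conj', map_sum, Finset.sum_mul_sum]
    refine Finset.sum_congr rfl fun n _ => Finset.sum_congr rfl fun m _ => ?_
    rw [mFourier_add, mFourier_neg, map_mul]
    ring
  have hself : ∀ n ∈ F, ∑ m ∈ F, ∫ x : UnitAddTorus (Fin 2),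
      (c n * (starRingEnd ℂ) (c m)) * mFourier (f n + -f m) x = (‖c n‖ ^ 2 : ℝ) := by
    intro n hn
    rw [Finset.sum_eq_single_of_mem n hn]
    · have h1 : volume (Set.univ : Set (UnitAddTorus (Fin 2))) = 1 := by
        rw [volume_pi, Measure.pi_univ]
        simp
      simp [mFourier_zero, Complex.mul_conj', Measure.real, h1]
    · intro m hm hmn
      rw [integral_const_mul, integral_mFourier_of_ne_zero, mul_zero]
      rw [← sub_eq_add_neg, sub_ne_zero]
      exact fun h => hmn (hf hm hn h.symm)
  apply Complex.ofReal_injective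
  rw [← integral_complex_ofReal]
  simp_rw [hexp]
  rw [integral_finsetSum, Complex.ofReal_sum]
  · refine Finset.sum_congr rfl fun n hn => ?_
    rw [integral_finsetSum, hself n hn]
    exact fun m _ => (hint _).const_mul _
  · exact fun n _ => integrable_finsetSum _ fun m _ => (hint _).const_mul _

open MeasureTheory UnitAddTorus in
theorem volume_real_closedBall_unitAddTorus {δ : ℝ} (hδ : 0 ≤ δ) (hδ' : 2 * δ ≤ 1) :
    volume.real (Metric.closedBall (0 : UnitAddTorus (Fin 2)) δ) = (2 * δ) ^ 2 := by
  have h : volume (Metric.closedBall (0 : UnitAddTorus (Fin 2)) δ) =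
      ∏ i : Fin 2, volume (Metric.closedBall (0 : UnitAddCircle) δ) :=
    volume_pi_closedBall (α := fun _ : Fin 2 => UnitAddCircle) 0 hδ
  rw [Measure.real, h]
  simp only [AddCircle.volume_closedBall, min_eq_right hδ', Finset.prod_const, Finset.card_univ,
    Fintype.card_fin, ENNReal.toReal_pow]
  rw [ENNReal.toReal_ofReal (by positivity)]

theorem exists_coe_eq_abs_eq_norm (x : UnitAddCircle) :
    ∃ s : ℝ, (s : UnitAddCircle) = x ∧ |s| = ‖x‖ := by
  induction x using QuotientAddGroup.induction_on with
  | H s =>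
    refine ⟨s - round s, ?_, ?_⟩
    · rw [AddCircle.coe_sub, sub_eq_self]
      exact AddCircle.coe_eq_zero_iff 1 |>.2 ⟨round s, by simp⟩
    · exact (UnitAddCircle.norm_eq).symm

open UnitAddTorus in
theorem norm_mFourier_sub_one_le {δ : ℝ} {n : Fin 2 → ℤ} (hn : ∀ i, |(n i : ℝ)| * δ ≤ 1 / 32)
    {x : UnitAddTorus (Fin 2)} (hx : ‖x‖ ≤ δ) : ‖mFourier n x - 1‖ ≤ 1 / 2 := by
  choose s hs hs' using fun i => exists_coe_eq_abs_eq_norm (x i)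
  have hb : ∀ i, |n i * s i| ≤ 1 / 32 := fun i => by
    rw [abs_mul, hs' i]
    exact (mul_le_mul_of_nonneg_left ((norm_le_pi_norm x i).trans hx) (abs_nonneg _)).trans (hn i)
  have he : mFourier n x
      = Complex.exp (Complex.I * ((2 * Real.pi * (n 0 * s 0 + n 1 * s 1) : ℝ) : ℂ)) := by
    simp only [mFourier, ContinuousMap.coe_mk, Fin.prod_univ_two, ← hs]
    rw [fourier_coe_apply, fourier_coe_apply, ← Complex.exp_add]
    congr 1
    push_cast
    ring
  rw [he]
  refine Real.norm_exp_I_mul_ofReal_sub_one_le.trans ?_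
  have h0 := abs_le.1 (hb 0)
  have h1 := abs_le.1 (hb 1)
  rw [Real.norm_eq_abs, abs_mul, abs_of_pos Real.two_pi_pos]
  have h : |n 0 * s 0 + n 1 * s 1| ≤ 1 / 16 := abs_le.2 ⟨by linarith, by linarith⟩
  nlinarith [Real.pi_lt_four, Real.pi_pos]

open MeasureTheory UnitAddTorus in
theorem le_norm_setIntegral_mFourier {δ : ℝ} (hδ : 0 ≤ δ) (hδ' : 2 * δ ≤ 1) {n : Fin 2 → ℤ}
    (hn : ∀ i, |(n i : ℝ)| * δ ≤ 1 / 32) :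
    2 * δ ^ 2 ≤ ‖∫ x in Metric.closedBall (0 : UnitAddTorus (Fin 2)) δ, mFourier n x‖ := by
  set B := Metric.closedBall (0 : UnitAddTorus (Fin 2)) δ
  have hV : volume.real B = (2 * δ) ^ 2 := volume_real_closedBall_unitAddTorus hδ hδ'
  have hint : ∀ g : C(UnitAddTorus (Fin 2), ℂ), Integrable g := fun g =>
    g.continuous.integrable_of_hasCompactSupport (HasCompactSupport.of_compactSpace _)
  have h1 : ‖∫ x in B, (mFourier n x - 1)‖ ≤ 1 / 2 * volume.real B :=
    norm_setIntegral_le_of_norm_le_const (measure_lt_top _ _) fun x hx =>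
      norm_mFourier_sub_one_le hn (by simpa [B] using hx)
  rw [integral_sub (hint _).integrableOn (integrable_const _), setIntegral_const, hV] at h1
  have h2 := norm_sub_norm_le (((2 * δ) ^ 2) • (1 : ℂ)) (∫ x in B, mFourier n x)
  rw [norm_sub_rev, norm_smul, norm_one, mul_one, Real.norm_eq_abs,
    abs_of_nonneg (by positivity)] at h2
  linarith

open MeasureTheory in
theorem sq_setIntegral_le {α : Type*} [MeasurableSpace α] {μ : Measure α} [IsFiniteMeasure μ]
    {B : Set α} {g : α → ℝ} (hg : Integrable g μ) (hg2 : Integrable (fun x => g x ^ 2) μ) :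
    (∫ x in B, g x ∂μ) ^ 2 ≤ μ.real B * ∫ x in B, g x ^ 2 ∂μ := by
  set I := ∫ x in B, g x ∂μ
  set V := μ.real B
  have hV : 0 ≤ V := measureReal_nonneg
  have key : ∀ l : ℝ, 0 ≤ ∫ x in B, g x ^ 2 ∂μ - 2 * l * I + l ^ 2 * V := by
    intro l
    have h : 0 ≤ ∫ x in B, (g x - l) ^ 2 ∂μ := integral_nonneg fun x => sq_nonneg _
    have h' : ∀ x, (g x - l) ^ 2 = g x ^ 2 - 2 * l * g x + l ^ 2 := fun x => by ring
    simp_rw [h'] at h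
    have hsub : Integrable (fun x => g x ^ 2 - 2 * l * g x) (μ.restrict B) :=
      hg2.integrableOn.sub (hg.integrableOn.const_mul _)
    rwa [integral_add hsub (integrable_const _),
      integral_sub hg2.integrableOn (hg.integrableOn.const_mul _), integral_const_mul,
      setIntegral_const, smul_eq_mul, mul_comm V] at h
  rcases hV.eq_or_lt with h0 | h0
  · have : I = 0 := by
      have : μ B = 0 := (measureReal_eq_zero_iff).1 h0.symm
      simp [I, Measure.restrict_eq_zero.2 this]
    simp [this, ← h0]
  · have := mul_nonneg hV (key (I / V))
    have h2 : V * (∫ x in B, g x ^ 2 ∂μ - 2 * (I / V) * I + (I / V) ^ 2 * V)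
      = V * ∫ x in B, g x ^ 2 ∂μ - I ^ 2 := by field_simp; ring
    linarith

open MeasureTheory UnitAddTorus in
theorem large_sieve_unitAddTorus {ι ν : Type*} (s : Finset ι) (t : ι → UnitAddTorus (Fin 2))
    (F : Finset ν) (f : ν → Fin 2 → ℤ) (hf : Set.InjOn f F) (a : ν → ℂ) {δ P : ℝ} (hδ : 0 < δ)
    (hδ' : 2 * δ ≤ 1) (hF : ∀ n ∈ F, ∀ i, |(f n i : ℝ)| * δ ≤ 1 / 32)
    (hP : ∀ y, ∀ s' ⊆ s, (∀ r ∈ s', ‖y - t r‖ ≤ δ) → (s'.card : ℝ) ≤ P) :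
    ∑ r ∈ s, ‖∑ n ∈ F, a n * mFourier (f n) (t r)‖ ^ 2 ≤ P / δ ^ 2 * ∑ n ∈ F, ‖a n‖ ^ 2 := by
  classical
  set B := Metric.closedBall (0 : UnitAddTorus (Fin 2)) δ with hB
  have hV : volume.real B = (2 * δ) ^ 2 := volume_real_closedBall_unitAddTorus hδ.le hδ'
  have hP0 : 0 ≤ P := by simpa using hP 0 ∅ (Finset.empty_subset _)
  set c : ν → ℂ := fun n => ∫ x in B, mFourier (f n) x with hc
  have hcn : ∀ n ∈ F, 2 * δ ^ 2 ≤ ‖c n‖ := fun n hn =>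
    le_norm_setIntegral_mFourier hδ.le hδ' (hF n hn)
  have hc0 : ∀ n ∈ F, c n ≠ 0 := fun n hn =>
    norm_pos_iff.1 (lt_of_lt_of_le (by positivity) (hcn n hn))
  set T : C(UnitAddTorus (Fin 2), ℂ) := ∑ n ∈ F, (a n / c n) • mFourier (f n) with hT
  have hTx : ∀ x, T x = ∑ n ∈ F, a n / c n * mFourier (f n) x := fun x => by
    simp [hT, ContinuousMap.sum_apply]
  have hcomp : ∀ {E : Type} [NormedAddCommGroup E] (g : C(UnitAddTorus (Fin 2), E)),
      Integrable g := fun g =>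
    g.continuous.integrable_of_hasCompactSupport (HasCompactSupport.of_compactSpace _)
  have hBm : MeasurableSet B := Metric.isClosed_closedBall.measurableSet
  have hadd : ∀ n x y, mFourier (f n) (x + y) = mFourier (f n) x * mFourier (f n) y := by
    intro n x y
    simp only [mFourier, ContinuousMap.coe_mk, ← Finset.prod_mul_distrib]
    refine Finset.prod_congr rfl fun i _ => ?_
    simp [fourier_apply, AddCircle.toCircle_add]
  have hS : ∀ r, ∑ n ∈ F, a n * mFourier (f n) (t r) = ∫ y in B, T (t r + y) := by
    intro r
    simp_rw [hTx, hadd]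
    rw [integral_finsetSum]
    · refine Finset.sum_congr rfl fun n hn => ?_
      simp_rw [← mul_assoc]
      rw [integral_const_mul]
      change _ = _ * c n
      field_simp [hc0 n hn]
    · exact fun n _ => (((hcomp (mFourier (f n))).const_mul _).const_mul _).integrableOn
  have hle : ∀ r, ‖∑ n ∈ F, a n * mFourier (f n) (t r)‖ ^ 2
      ≤ (2 * δ) ^ 2 * ∫ y, B.indicator (fun _ => (1 : ℝ)) (y - t r) * ‖T y‖ ^ 2 := by
    intro r
    have h1 : ‖∫ y in B, T (t r + y)‖ ^ 2 ≤ (∫ y in B, ‖T (t r + y)‖) ^ 2 :=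
      pow_le_pow_left₀ (norm_nonneg _) (norm_integral_le_integral_norm _) 2
    have h2 := sq_setIntegral_le (μ := volume) (B := B) (g := fun y => ‖T (t r + y)‖)
      (hcomp ⟨_, by fun_prop⟩) (hcomp ⟨fun y => ‖T (t r + y)‖ ^ 2, by fun_prop⟩)
    have h3 : ∫ y in B, ‖T (t r + y)‖ ^ 2
        = ∫ y, B.indicator (fun _ => (1 : ℝ)) (y - t r) * ‖T y‖ ^ 2 := by
      rw [← integral_indicator hBm, ← integral_add_left_eq_self
        (fun y => B.indicator (fun _ => (1 : ℝ)) (y - t r) * ‖T y‖ ^ 2) (t r)]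
      refine integral_congr_ae (.of_forall fun y => ?_)
      by_cases hy : y ∈ B <;> simp [hy]
    rw [hS, ← h3, ← hV]
    exact h1.trans h2
  have hind : ∀ r, Integrable fun y => B.indicator (fun _ => (1 : ℝ)) (y - t r) * ‖T y‖ ^ 2 := by
    intro r
    refine (hcomp (⟨fun y => ‖T y‖ ^ 2, by fun_prop⟩ : C(_, ℝ))).bdd_mul (c := 1) ?_ ?_
    · exact ((measurable_const.indicator hBm).comp
        (measurable_id.sub_const (t r))).aestronglyMeasurable
    · refine .of_forall fun y => ?_
      by_cases hy : y - t r ∈ B <;> simp [hy]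
  calc ∑ r ∈ s, ‖∑ n ∈ F, a n * mFourier (f n) (t r)‖ ^ 2
      ≤ ∑ r ∈ s, (2 * δ) ^ 2 * ∫ y, B.indicator (fun _ => (1 : ℝ)) (y - t r) * ‖T y‖ ^ 2 :=
        Finset.sum_le_sum fun r _ => hle r
    _ = (2 * δ) ^ 2 * ∫ y, ∑ r ∈ s, B.indicator (fun _ => (1 : ℝ)) (y - t r) * ‖T y‖ ^ 2 := by
        rw [← Finset.mul_sum, integral_finsetSum _ fun r _ => hind r]
    _ ≤ (2 * δ) ^ 2 * ∫ y, P * ‖T y‖ ^ 2 := by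
        refine mul_le_mul_of_nonneg_left (integral_mono (integrable_finsetSum _ fun r _ => hind r)
          ((hcomp (⟨fun y => ‖T y‖ ^ 2, by fun_prop⟩ : C(_, ℝ))).const_mul P) fun y => ?_)
          (by positivity)
        simp only
        rw [← Finset.sum_mul]
        refine mul_le_mul_of_nonneg_right ?_ (by positivity)
        have h : ∑ r ∈ s, B.indicator (fun _ => (1 : ℝ)) (y - t r)
            = ((s.filter fun r => y - t r ∈ B).card : ℝ) := by
          simp [Set.indicator_apply]
        rw [h]
        exact hP y _ (Finset.filter_subset _ _) fun r hr => by
          simpa [hB] using (Finset.mem_filter.1 hr).2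
    _ = (2 * δ) ^ 2 * (P * ∑ n ∈ F, ‖a n / c n‖ ^ 2) := by
        simp_rw [hTx]
        rw [integral_const_mul, integral_norm_sq_sum_mFourier F f hf]
    _ ≤ (2 * δ) ^ 2 * (P * ∑ n ∈ F, ‖a n‖ ^ 2 / (2 * δ ^ 2) ^ 2) := by
        gcongr with n hn
        rw [norm_div, div_pow]
        gcongr
        exact hcn n hn
    _ = P / δ ^ 2 * ∑ n ∈ F, ‖a n‖ ^ 2 := by
        rw [← Finset.sum_div]
        field_simp

theorem card_le_of_separated {ι : Type*} {s : Finset ι} {f : ι → ℂ}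
    (hsep : ∀ x ∈ s, ∀ y ∈ s, x ≠ y → 1 ≤ ‖f x - f y‖) (z : ℂ) {ρ : ℝ}
    (hs : ∀ x ∈ s, ‖f x - z‖ ≤ ρ) : (s.card : ℝ) ≤ 16 * (1 + ρ) ^ 2 := by
  rcases s.eq_empty_or_nonempty with rfl | ⟨x0, hx0⟩
  · simp only [Finset.card_empty, Nat.cast_zero]; positivity
  have hρ : 0 ≤ ρ := (norm_nonneg _).trans (hs x0 hx0)
  set I := Finset.Icc ⌊-(2 * ρ)⌋ ⌊2 * ρ⌋
  have hmaps : ∀ x ∈ s, (⌊2 * (f x - z).re⌋, ⌊2 * (f x - z).im⌋) ∈ I ×ˢ I := by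
    intro x hx
    have h1 := abs_le.1 ((Complex.abs_re_le_norm (f x - z)).trans (hs x hx))
    have h2 := abs_le.1 ((Complex.abs_im_le_norm (f x - z)).trans (hs x hx))
    simp only [I, Finset.mem_product, Finset.mem_Icc]
    exact ⟨⟨Int.floor_le_floor (by linarith), Int.floor_le_floor (by linarith)⟩,
      ⟨Int.floor_le_floor (by linarith), Int.floor_le_floor (by linarith)⟩⟩
  have hinj : Set.InjOn (fun x => (⌊2 * (f x - z).re⌋, ⌊2 * (f x - z).im⌋)) s := by
    intro x hx y hy hxy
    by_contra hne
    have h1 := hsep x hx y hy hne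
    simp only [Prod.mk.injEq] at hxy
    have hr := abs_lt.1 (Int.abs_sub_lt_one_of_floor_eq_floor hxy.1)
    have hi := abs_lt.1 (Int.abs_sub_lt_one_of_floor_eq_floor hxy.2)
    simp only [Complex.sub_re, Complex.sub_im] at hr hi
    have h2 : ‖f x - f y‖ ^ 2 = ((f x).re - (f y).re) ^ 2 + ((f x).im - (f y).im) ^ 2 := by
      rw [Complex.sq_norm, Complex.normSq_apply, Complex.sub_re, Complex.sub_im]; ring
    nlinarith
  have hcard := Finset.card_le_card_of_injOn _ hmaps hinj
  rw [Finset.card_product] at hcard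
  have hI : (I.card : ℝ) ≤ 4 * ρ + 2 := by
    rw [Int.card_Icc]
    have h0 : 0 ≤ ⌊2 * ρ⌋ := Int.floor_nonneg.2 (by linarith)
    have h1 : ⌊-(2 * ρ)⌋ ≤ 0 := Int.floor_nonpos (by linarith)
    have h2 := Int.floor_le (2 * ρ)
    have h3 := Int.lt_floor_add_one (-(2 * ρ))
    have h4 : (((⌊2 * ρ⌋ + 1 - ⌊-(2 * ρ)⌋).toNat : ℤ) : ℝ) = ⌊2 * ρ⌋ + 1 - ⌊-(2 * ρ)⌋ := by
      rw [Int.toNat_of_nonneg (by linarith)]; push_cast; ring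
    rw [← Int.cast_natCast, h4]
    linarith
  calc (s.card : ℝ) ≤ I.card * I.card := mod_cast hcard
    _ ≤ (4 * ρ + 2) * (4 * ρ + 2) := by gcongr
    _ ≤ 16 * (1 + ρ) ^ 2 := by nlinarith

theorem card_le_of_card_fiber_le {α β : Type*} [DecidableEq β] {s : Finset α} {f : α → β} {c : ℝ}
    (h : ∀ b ∈ s.image f, ((s.filter fun x => f x = b).card : ℝ) ≤ c) :
    (s.card : ℝ) ≤ c * (s.image f).card := by
  rw [Finset.card_eq_sum_card_image f s]
  push_cast
  calc _ ≤ ∑ b ∈ s.image f, c := Finset.sum_le_sum h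
    _ = _ := by rw [Finset.sum_const, nsmul_eq_mul, mul_comm]

section Counting

variable {O : Type*} [CommRing O] {σ : O →+* ℂ}

theorem card_le_of_norm_sub_le (hsep : ∀ x : O, x ≠ 0 → 1 ≤ ‖σ x‖) {s : Finset O} (z : ℂ) {ρ : ℝ}
    (hs : ∀ x ∈ s, ‖σ x - z‖ ≤ ρ) : (s.card : ℝ) ≤ 16 * (1 + ρ) ^ 2 :=
  card_le_of_separated (f := σ) (fun x _ y _ hxy => by
    rw [← map_sub]; exact hsep _ (sub_ne_zero.2 hxy)) z hs

/-- Bound for the number of values `k` of bounded size such that `a₀ k / q₀ ^ 2` is close to an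
element of the ring. -/
theorem card_values_le (hsep : ∀ x : O, x ≠ 0 → 1 ≤ ‖σ x‖) {q₀ a₀ : O} (hco : IsCoprime a₀ q₀)
    {X Y : ℝ} (hq₀ : X / 2 < ‖σ q₀‖ ^ 2) {𝒦 : Finset O}
    (hnorm : ∀ k ∈ 𝒦, ‖σ k‖ ≤ 2 * X)
    (hclose : ∀ k ∈ 𝒦, ∃ b : O, ‖σ (b * q₀ ^ 2 - a₀ * k)‖ ≤ Y) :
    (𝒦.card : ℝ) ≤ 16 * (1 + 8) ^ 2 * (16 * (1 + Y) ^ 2) := by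
  classical
  choose! b hb using hclose
  refine (card_le_of_card_fiber_le (f := fun k => b k * q₀ ^ 2 - a₀ * k)
    (c := 16 * (1 + 8) ^ 2) ?_).trans ?_
  · intro j hj
    obtain ⟨k', hk', hj'⟩ := Finset.mem_image.1 hj
    have hdiv : ∀ k ∈ 𝒦.filter (fun k => b k * q₀ ^ 2 - a₀ * k = j), ∃ c, k - k' = q₀ ^ 2 * c := by
      intro k hk
      have h1 := (Finset.mem_filter.1 hk).2
      have hc : IsCoprime (q₀ ^ 2) a₀ := hco.symm.pow_left
      refine hc.dvd_of_dvd_mul_left ⟨b k - b k', ?_⟩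
      linear_combination hj' - h1
    choose! c hc using hdiv
    have hinj : Set.InjOn c (𝒦.filter (fun k => b k * q₀ ^ 2 - a₀ * k = j)) := by
      intro x hx y hy hxy
      have h1 := hc x hx
      have h2 := hc y hy
      rw [hxy] at h1
      exact sub_left_injective (h1.trans h2.symm)
    rw [← Finset.card_image_of_injOn hinj]
    refine card_le_of_norm_sub_le hsep 0 fun x hx => ?_
    obtain ⟨k, hk, rfl⟩ := Finset.mem_image.1 hx
    have h1 : ‖σ (k - k')‖ ≤ 2 * X + 2 * X := by
      rw [map_sub]
      exact (norm_sub_le _ _).trans (add_le_add (hnorm k (Finset.mem_filter.1 hk).1) (hnorm k' hk'))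
    rw [hc k hk, map_mul, map_pow, norm_mul, norm_pow] at h1
    rw [sub_zero]
    by_contra hlt
    push Not at hlt
    nlinarith
  · refine mul_le_mul_of_nonneg_left (card_le_of_norm_sub_le hsep 0 fun x hx => ?_) (by norm_num)
    obtain ⟨k, hk, rfl⟩ := Finset.mem_image.1 hx
    rw [sub_zero]
    exact hb k hk

variable [IsDomain O]

/-- A set is bounded through the differences of the squares of its elements, each of which factors
in few ways. -/
theorem card_sq_le_of_sq_sub_sq [DecidableEq O] (h2 : (2 : O) ≠ 0) (A : Finset O) {D : ℝ}
    (hD0 : 0 ≤ D)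
    (hD : ∀ q₁ ∈ A, ∀ q₂ ∈ A, q₁ ^ 2 - q₂ ^ 2 ≠ 0 → ∀ s : Finset O,
      (∀ u ∈ s, u ∣ q₁ ^ 2 - q₂ ^ 2) → (s.card : ℝ) ≤ D) :
    (A.card : ℝ) ^ 2 ≤
      2 * A.card + D * ((A ×ˢ A).image fun p => p.1 ^ 2 - p.2 ^ 2).card := by
  set g : O × O → O := fun p => p.1 ^ 2 - p.2 ^ 2 with hg
  have hzero : (((A ×ˢ A).filter fun p => g p = 0).card : ℝ) ≤ 2 * A.card := by
    have hsub : ((A ×ˢ A).filter fun p => g p = 0) ⊆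
        A.image (fun q => (q, q)) ∪ A.image (fun q => (q, -q)) := by
      rintro ⟨q₁, q₂⟩ hp
      simp only [Finset.mem_filter, Finset.mem_product, hg] at hp
      simp only [Finset.mem_union, Finset.mem_image, Prod.mk.injEq]
      rcases sq_eq_sq_iff_eq_or_eq_neg.1 (sub_eq_zero.1 hp.2) with h | h
      · exact .inl ⟨q₁, hp.1.1, rfl, h⟩
      · exact .inr ⟨q₁, hp.1.1, rfl, by rw [h, neg_neg]⟩
    have := (Finset.card_le_card hsub).trans ((Finset.card_union_le _ _).trans
      (add_le_add Finset.card_image_le Finset.card_image_le))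
    rw [two_mul]
    exact_mod_cast this
  have hne : (((A ×ˢ A).filter fun p => g p ≠ 0).card : ℝ) ≤ D * ((A ×ˢ A).image g).card := by
    refine (card_le_of_card_fiber_le (f := g) (c := D) ?_).trans
      (mul_le_mul_of_nonneg_left
        (mod_cast Finset.card_le_card (Finset.image_subset_image (Finset.filter_subset _ _))) hD0)
    intro k hk
    obtain ⟨p, hp, rfl⟩ := Finset.mem_image.1 hk
    obtain ⟨hp1, hp2⟩ := Finset.mem_filter.1 hp
    rw [Finset.mem_product] at hp1
    have hinj : Set.InjOn (fun p : O × O => p.1 - p.2)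
        (((A ×ˢ A).filter fun p => g p ≠ 0).filter fun p' => g p' = g p) := by
      rintro ⟨x1, x2⟩ hx ⟨y1, y2⟩ hy hxy
      have hx' := (Finset.mem_filter.1 hx).2
      have hy' := (Finset.mem_filter.1 hy).2
      simp only [hg] at hx' hy' hxy hp2
      have hu : x1 - x2 ≠ 0 := by
        intro h
        exact hp2 (by rw [← hx']; linear_combination (x1 + x2) * h)
      have hv : x1 + x2 = y1 + y2 := by
        refine mul_left_cancel₀ hu ?_
        linear_combination hx' - hy' - (y1 + y2) * hxy
      have h1 : x1 = y1 := mul_left_cancel₀ h2 (by linear_combination hxy + hv)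
      have h2 : x2 = y2 := by linear_combination hv - h1
      rw [h1, h2]
    rw [← Finset.card_image_of_injOn hinj]
    refine hD _ hp1.1 _ hp1.2 hp2 _ fun u hu => ?_
    obtain ⟨p', hp', rfl⟩ := Finset.mem_image.1 hu
    have := (Finset.mem_filter.1 hp').2
    simp only [hg] at this
    exact ⟨p'.1 + p'.2, by rw [← this]; ring⟩
  have hsum : ((A ×ˢ A).card : ℝ) = ((A ×ˢ A).filter fun p => g p = 0).card +
      ((A ×ˢ A).filter fun p => g p ≠ 0).card :=
    mod_cast (Finset.card_filter_add_card_filter_not (s := A ×ˢ A) fun p => g p = 0).symm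
  rw [Finset.card_product, Nat.cast_mul, ← sq] at hsum
  linarith

theorem le_of_sq_le_two_mul_add {A E z y : ℝ} (hE : 0 ≤ E) (hz : 1 ≤ z) (hy : 0 ≤ y)
    (h : A ^ 2 ≤ 2 * A + E * z * (1 + y) ^ 2) : A ≤ (2 + E) * z * (1 + y) := by
  by_contra! hlt
  have hzy : 1 ≤ z * (1 + y) := by nlinarith
  have hEz : 0 ≤ E * z * (1 + y) := by positivity
  have hA : 1 + y ≤ A := by nlinarith
  have h1 : A * ((2 + E) * z * (1 + y)) < A * A := mul_lt_mul_of_pos_left hlt (by linarith)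
  have h3 : 2 * A * 1 ≤ 2 * A * (z * (1 + y)) := mul_le_mul_of_nonneg_left hzy (by linarith)
  have h4 : E * z * (1 + y) * (1 + y) ≤ E * z * (1 + y) * A := mul_le_mul_of_nonneg_left hA hEz
  nlinarith

/-- Spacing of the fractions `a / q ^ 2` with `q` in a dyadic block. -/
theorem card_close_fractions_le (hsep : ∀ x : O, x ≠ 0 → 1 ≤ ‖σ x‖) {ε C : ℝ} (hε : 0 < ε)
    (hdiv : ∀ k : O, k ≠ 0 → ∀ s : Finset O, (∀ u ∈ s, u ∣ k) → (s.card : ℝ) ≤ C * ‖σ k‖ ^ ε)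
    (c₀ : ℝ) :
    ∃ C' : ℝ, ∀ X η : ℝ, 1 ≤ X → 0 ≤ η → η * X ≤ c₀ → ∀ q₀ a₀ : O, IsCoprime a₀ q₀ →
      X / 2 < ‖σ q₀‖ ^ 2 → ‖σ q₀‖ ^ 2 ≤ X → ∀ T : Finset (O × O),
      (∀ p ∈ T, p.1 ≠ 0 ∧ ‖σ p.1‖ ^ 2 ≤ X ∧
        ∃ m : O, ‖σ p.2 / σ p.1 ^ 2 - σ a₀ / σ q₀ ^ 2 - σ m‖ ≤ η) →
      (∀ q a a' : O, (q, a) ∈ T → (q, a') ∈ T → q ^ 2 ∣ a - a' → a = a') →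
      (T.card : ℝ) ≤ C' * X ^ ε * (1 + η * X ^ 2) := by
  classical
  have hC : 0 ≤ C := by
    have := hdiv 1 one_ne_zero ∅ (by simp)
    simpa using this
  set E : ℝ := C * 2 ^ ε * (16 * (1 + 8) ^ 2 * (16 * 4)) with hE
  have hE0 : 0 ≤ E := by positivity
  refine ⟨16 * (1 + c₀) ^ 2 * (2 + E), fun X η hX hη hηX q₀ a₀ hco hq₀ hq₀' T hT hTu => ?_⟩
  have hσ0 : ∀ x : O, x ≠ 0 → σ x ≠ 0 := fun x hx =>
    norm_pos_iff.1 (zero_lt_one.trans_le (hsep x hx))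
  have h2 : (2 : O) ≠ 0 := fun h => two_ne_zero (α := ℂ)
    (by simpa only [map_ofNat, map_zero] using congrArg σ h)
  have hq₀0 : σ q₀ ≠ 0 := by
    intro h
    rw [h] at hq₀
    norm_num at hq₀
    linarith
  choose! hTne hTX m hm using hT
  set b : O × O → O := fun p => p.2 - m p * p.1 ^ 2 with hb
  have hbη : ∀ p ∈ T, ‖σ (b p) - σ a₀ / σ q₀ ^ 2 * σ p.1 ^ 2‖ ≤ η * X := by
    intro p hp
    have h : σ (b p) - σ a₀ / σ q₀ ^ 2 * σ p.1 ^ 2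
        = (σ p.2 / σ p.1 ^ 2 - σ a₀ / σ q₀ ^ 2 - σ (m p)) * σ p.1 ^ 2 := by
      have := hσ0 _ (hTne p hp)
      simp only [hb, map_sub, map_mul, map_pow]
      field_simp
      ring
    rw [h, norm_mul, norm_pow]
    exact mul_le_mul (hm p hp) (hTX p hp) (by positivity) hη
  set A := T.image Prod.fst with hA
  have hfib : (T.card : ℝ) ≤ 16 * (1 + c₀) ^ 2 * A.card := by
    refine card_le_of_card_fiber_le fun q hq => ?_
    have hinj : Set.InjOn b (T.filter fun p => p.1 = q) := by
      rintro ⟨q1, x⟩ hx ⟨q2, y⟩ hy hxy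
      obtain ⟨hx1, hx2⟩ := Finset.mem_filter.1 hx
      obtain ⟨hy1, hy2⟩ := Finset.mem_filter.1 hy
      simp only at hx2 hy2
      subst hx2 hy2
      simp only [hb] at hxy
      rw [hTu _ x y hx1 hy1 ⟨m (q2, x) - m (q2, y), by linear_combination hxy⟩]
    rw [← Finset.card_image_of_injOn hinj]
    refine card_le_of_norm_sub_le hsep (σ a₀ / σ q₀ ^ 2 * σ q ^ 2) fun x hx => ?_
    obtain ⟨p, hp, rfl⟩ := Finset.mem_image.1 hx
    obtain ⟨hp1, rfl⟩ := Finset.mem_filter.1 hp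
    exact (hbη p hp1).trans hηX
  have hAX : ∀ q ∈ A, ‖σ q‖ ^ 2 ≤ X := by
    intro q hq
    obtain ⟨p, hp, rfl⟩ := Finset.mem_image.1 hq
    exact hTX p hp
  have hAb : ∀ q ∈ A, ∃ b : O, ‖σ (b * q₀ ^ 2 - a₀ * q ^ 2)‖ ≤ η * X ^ 2 := by
    intro q hq
    obtain ⟨p, hp, rfl⟩ := Finset.mem_image.1 hq
    refine ⟨b p, ?_⟩
    have h : σ (b p * q₀ ^ 2 - a₀ * p.1 ^ 2)
        = (σ (b p) - σ a₀ / σ q₀ ^ 2 * σ p.1 ^ 2) * σ q₀ ^ 2 := by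
      simp only [map_sub, map_mul, map_pow]
      field_simp
    rw [h, norm_mul, norm_pow, show η * X ^ 2 = η * X * X by ring]
    exact mul_le_mul (hbη p hp) hq₀' (by positivity) (by positivity)
  have hdiff : ∀ q₁ ∈ A, ∀ q₂ ∈ A, ‖σ (q₁ ^ 2 - q₂ ^ 2)‖ ≤ 2 * X := by
    intro q₁ h₁ q₂ h₂
    rw [map_sub, map_pow, map_pow, two_mul]
    refine (norm_sub_le _ _).trans (add_le_add ?_ ?_) <;> rw [norm_pow]
    exacts [hAX _ h₁, hAX _ h₂]
  have hsq := card_sq_le_of_sq_sub_sq h2 A (D := C * (2 * X) ^ ε) (by positivity)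
    fun q₁ h₁ q₂ h₂ hne s hs => (hdiv _ hne s hs).trans (by gcongr; exact hdiff _ h₁ _ h₂)
  have hval := card_values_le hsep hco (Y := 2 * (η * X ^ 2)) hq₀
    (𝒦 := (A ×ˢ A).image fun p => p.1 ^ 2 - p.2 ^ 2)
    (by
      intro k hk
      obtain ⟨p, hp, rfl⟩ := Finset.mem_image.1 hk
      exact hdiff _ (Finset.mem_product.1 hp).1 _ (Finset.mem_product.1 hp).2)
    (by
      intro k hk
      obtain ⟨p, hp, rfl⟩ := Finset.mem_image.1 hk
      obtain ⟨b₁, h₁⟩ := hAb _ (Finset.mem_product.1 hp).1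
      obtain ⟨b₂, h₂⟩ := hAb _ (Finset.mem_product.1 hp).2
      refine ⟨b₁ - b₂, ?_⟩
      rw [show (b₁ - b₂) * q₀ ^ 2 - a₀ * (p.1 ^ 2 - p.2 ^ 2)
        = (b₁ * q₀ ^ 2 - a₀ * p.1 ^ 2) - (b₂ * q₀ ^ 2 - a₀ * p.2 ^ 2) by ring, map_sub, two_mul]
      exact (norm_sub_le _ _).trans (add_le_add h₁ h₂))
  have hy : 0 ≤ η * X ^ 2 := by positivity
  have hXε : 1 ≤ X ^ ε := Real.one_le_rpow hX hε.le
  have hAcard : (A.card : ℝ) ≤ (2 + E) * X ^ ε * (1 + η * X ^ 2) := by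
    refine le_of_sq_le_two_mul_add hE0 hXε hy (hsq.trans (add_le_add le_rfl ?_))
    calc C * (2 * X) ^ ε * _
        ≤ C * (2 * X) ^ ε * (16 * (1 + 8) ^ 2 * (16 * (1 + 2 * (η * X ^ 2)) ^ 2)) := by
          gcongr
      _ ≤ C * (2 * X) ^ ε * (16 * (1 + 8) ^ 2 * (16 * (4 * (1 + η * X ^ 2) ^ 2))) := by
          gcongr
          nlinarith
      _ = E * X ^ ε * (1 + η * X ^ 2) ^ 2 := by
          rw [hE, Real.mul_rpow (by norm_num) (by linarith)]
          ring
  calc (T.card : ℝ) ≤ 16 * (1 + c₀) ^ 2 * A.card := hfib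
    _ ≤ 16 * (1 + c₀) ^ 2 * ((2 + E) * X ^ ε * (1 + η * X ^ 2)) := by gcongr
    _ = _ := by ring

end Counting

theorem ncard_dvd_mul_le {M : Type*} [CommMonoidWithZero M] [DecompositionMonoid M] {x y : M}
    (hx : {z | z ∣ x}.Finite) (hy : {z | z ∣ y}.Finite) :
    {z | z ∣ x * y}.ncard ≤ {z | z ∣ x}.ncard * {z | z ∣ y}.ncard := by
  rw [← Set.ncard_prod]
  refine (Set.ncard_le_ncard ?_ ((hx.prod hy).image fun p => p.1 * p.2)).trans
    (Set.ncard_image_le (hx.prod hy))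
  intro z hz
  obtain ⟨a, b, ha, hb, rfl⟩ := exists_dvd_and_dvd_of_dvd_mul hz
  exact ⟨(a, b), ⟨ha, hb⟩, rfl⟩

theorem add_one_le_mul_rpow {ε : ℝ} (hε : 0 < ε) (i : ℕ) :
    (i : ℝ) + 1 ≤ (1 + 1 / (2 ^ ε - 1)) * ((2 : ℝ) ^ ε) ^ i := by
  set t : ℝ := 2 ^ ε - 1 with ht
  have ht0 : 0 < t := sub_pos.2 (Real.one_lt_rpow one_lt_two hε)
  have h1 : 1 + (i : ℝ) * t ≤ ((2 : ℝ) ^ ε) ^ i := by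
    have := one_add_mul_le_pow (a := t) (by linarith) i
    rwa [ht, add_sub_cancel, ← ht] at this
  refine le_trans ?_ (mul_le_mul_of_nonneg_left h1 (by positivity))
  have h2 : (1 + 1 / t) * (1 + i * t) = 1 + i + i * t + 1 / t := by field_simp; ring
  rw [h2]
  have : 0 ≤ i * t + 1 / t := by positivity
  linarith

section DivisorBound

variable {K : Type*} [Field K] [NumberField K]

/-- The divisor bound for ideals. -/
theorem exists_ncard_ideal_dvd_le {ε : ℝ} (hε : 0 < ε) :
    ∃ C : ℝ, ∀ I : Ideal (𝓞 K), I ≠ 0 →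
      ({J | J ∣ I}.ncard : ℝ) ≤ C * (Ideal.absNorm I : ℝ) ^ ε := by
  classical
  have hfin : ∀ I : Ideal (𝓞 K), I ≠ 0 → {J | J ∣ I}.Finite := fun I hI =>
    Set.finite_coe_iff.1 (@Finite.of_fintype _ (UniqueFactorizationMonoid.fintypeSubtypeDvd I hI))
  have hS : {p : Ideal (𝓞 K) | Prime p ∧ (Ideal.absNorm p : ℝ) ^ ε < 2}.Finite := by
    refine (Ideal.finite_setOfPred_absNorm_le (S := 𝓞 K) ⌊(2 : ℝ) ^ (1 / ε)⌋₊).subset ?_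
    rintro p ⟨_, hp⟩
    refine Nat.le_floor ?_
    rw [one_div, Real.le_rpow_inv_iff_of_pos (by positivity) (by positivity) hε]
    exact hp.le
  set S := hS.toFinset
  set M : ℝ := 1 + 1 / (2 ^ ε - 1)
  have hM : 1 ≤ M := by
    have : 0 < (2 : ℝ) ^ ε - 1 := sub_pos.2 (Real.one_lt_rpow one_lt_two hε)
    simp only [M, le_add_iff_nonneg_right]
    positivity
  have hnorm : ∀ p : Ideal (𝓞 K), Prime p → 2 ≤ Ideal.absNorm p := by
    intro p hp
    have h0 : Ideal.absNorm p ≠ 0 := by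
      rw [Ne, Ideal.absNorm_eq_zero_iff]; exact hp.ne_zero
    have h1 : Ideal.absNorm p ≠ 1 := by
      rw [Ne, Ideal.absNorm_eq_one_iff, ← Ideal.one_eq_top]; exact hp.ne_one
    omega
  have key : ∀ I : Ideal (𝓞 K), I ≠ 0 → ({J | J ∣ I}.ncard : ℝ) ≤
      M ^ (S.filter fun p => p ∣ I).card * (Ideal.absNorm I : ℝ) ^ ε := by
    intro I
    induction I using UniqueFactorizationMonoid.induction_on_coprime with
    | h0 => exact fun h => absurd rfl h
    | @h1 x hx =>
      intro _
      obtain rfl : x = 1 := (Ideal.isUnit_iff.1 hx).trans Ideal.one_eq_top.symm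
      have : {J : Ideal (𝓞 K) | J ∣ 1} = {1} := by
        ext J
        rw [Set.mem_ofPred_eq, ← isUnit_iff_dvd_one, Ideal.isUnit_iff, Ideal.one_eq_top,
          Set.mem_singleton_iff]
      rw [this, Set.ncard_singleton]
      simpa using one_le_pow₀ hM
    | @hpr p i hp =>
      intro _
      have hcard : {J | J ∣ p ^ i}.ncard ≤ i + 1 := by
        have : {J | J ∣ p ^ i} ⊆ (fun j => p ^ j) '' (Finset.range (i + 1) : Set ℕ) := by
          intro J hJ
          obtain ⟨j, hj, hJ⟩ := (dvd_prime_pow hp i).1 hJ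
          exact ⟨j, by simpa [Nat.lt_succ_iff] using hj, (associated_iff_eq.1 hJ).symm⟩
        refine (Set.ncard_le_ncard this (Set.toFinite _)).trans ((Set.ncard_image_le).trans ?_)
        simp
      have hpow : (Ideal.absNorm (p ^ i) : ℝ) ^ ε = ((Ideal.absNorm p : ℝ) ^ ε) ^ i := by
        rw [map_pow, Nat.cast_pow, ← Real.rpow_natCast, ← Real.rpow_natCast,
          ← Real.rpow_mul (by positivity), ← Real.rpow_mul (by positivity), mul_comm]
      rw [hpow]
      refine (Nat.cast_le.2 hcard).trans ?_
      push_cast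
      rcases Nat.eq_zero_or_pos i with rfl | hi
      · simpa using one_le_pow₀ hM
      by_cases hpS : (Ideal.absNorm p : ℝ) ^ ε < 2
      · have hmem : p ∈ S.filter fun q => q ∣ p ^ i :=
          Finset.mem_filter.2 ⟨hS.mem_toFinset.2 ⟨hp, hpS⟩, dvd_pow_self p hi.ne'⟩
        have hc : (S.filter fun q => q ∣ p ^ i).card ≠ 0 := Finset.card_ne_zero_of_mem hmem
        refine (add_one_le_mul_rpow hε i).trans ?_
        have h2 : (2 : ℝ) ≤ Ideal.absNorm p := mod_cast hnorm p hp
        gcongr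
        exact le_self_pow₀ hM hc
      · push Not at hpS
        have h1 : (i : ℝ) + 1 ≤ 2 ^ i := mod_cast (Nat.lt_two_pow_self (n := i))
        calc (i : ℝ) + 1 ≤ 1 * 2 ^ i := by rwa [one_mul]
          _ ≤ _ := by
            gcongr
            exact one_le_pow₀ hM
    | @hcp x y hxy hx hy =>
      intro h0
      obtain ⟨hx0, hy0⟩ := mul_ne_zero_iff.1 h0
      have hF : (S.filter fun p => p ∣ x).card + (S.filter fun p => p ∣ y).card
          ≤ (S.filter fun p => p ∣ x * y).card := by
        rw [← Finset.card_union_of_disjoint]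
        · refine Finset.card_le_card fun p hp => ?_
          simp only [Finset.mem_union, Finset.mem_filter] at hp ⊢
          rcases hp with ⟨h, h'⟩ | ⟨h, h'⟩
          exacts [⟨h, h'.mul_right y⟩, ⟨h, h'.mul_left x⟩]
        · rw [Finset.disjoint_left]
          intro p hpx hpy
          obtain ⟨hp, hpx⟩ := Finset.mem_filter.1 hpx
          exact (hS.mem_toFinset.1 hp).1.not_isUnit (hxy hpx (Finset.mem_filter.1 hpy).2)
      calc ({J | J ∣ x * y}.ncard : ℝ)
          ≤ {J | J ∣ x}.ncard * {J | J ∣ y}.ncard :=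
            mod_cast ncard_dvd_mul_le (hfin x hx0) (hfin y hy0)
        _ ≤ (M ^ (S.filter fun p => p ∣ x).card * (Ideal.absNorm x : ℝ) ^ ε) *
            (M ^ (S.filter fun p => p ∣ y).card * (Ideal.absNorm y : ℝ) ^ ε) := by
            gcongr
            exacts [hx hx0, hy hy0]
        _ = M ^ ((S.filter fun p => p ∣ x).card + (S.filter fun p => p ∣ y).card) *
            (Ideal.absNorm (x * y) : ℝ) ^ ε := by
            rw [map_mul, Nat.cast_mul, Real.mul_rpow (by positivity) (by positivity), pow_add]
            ring
        _ ≤ _ := by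
            gcongr
  refine ⟨M ^ S.card, fun I hI => (key I hI).trans ?_⟩
  gcongr
  exact Finset.filter_subset _ _

end DivisorBound

section ImaginaryQuadratic

variable {K : Type*} [Field K] [NumberField K]

theorem univ_algHom_eq (hdeg : Module.finrank ℚ K = 2) (σ : K →+* ℂ)
    (himag : ∃ x : K, (σ x).im ≠ 0) [DecidableEq (K →ₐ[ℚ] ℂ)] :
    (Finset.univ : Finset (K →ₐ[ℚ] ℂ)) =
      {σ.toRatAlgHom, ((starRingEnd ℂ).comp σ).toRatAlgHom} ∧
      σ.toRatAlgHom ≠ ((starRingEnd ℂ).comp σ).toRatAlgHom := by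
  have hne : σ.toRatAlgHom ≠ ((starRingEnd ℂ).comp σ).toRatAlgHom := by
    obtain ⟨x, hx⟩ := himag
    intro h
    have : σ x = (starRingEnd ℂ) (σ x) := DFunLike.congr_fun h x
    exact hx (Complex.conj_eq_iff_im.1 this.symm)
  refine ⟨(Finset.eq_univ_of_card _ ?_).symm, hne⟩
  rw [Finset.card_pair hne, AlgHom.card, hdeg]

theorem norm_eq_normSq (hdeg : Module.finrank ℚ K = 2) (σ : K →+* ℂ)
    (himag : ∃ x : K, (σ x).im ≠ 0) (x : K) :
    (Algebra.norm ℚ x : ℝ) = ‖σ x‖ ^ 2 := by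
  classical
  obtain ⟨h, hne⟩ := univ_algHom_eq hdeg σ himag
  have h1 := Algebra.norm_eq_prod_embeddings ℚ ℂ x
  rw [h, Finset.prod_pair hne] at h1
  apply Complex.ofReal_injective
  rw [Complex.ofReal_pow, ← Complex.mul_conj']
  simpa using h1

theorem trace_eq_two_mul_re (hdeg : Module.finrank ℚ K = 2) (σ : K →+* ℂ)
    (himag : ∃ x : K, (σ x).im ≠ 0) (x : K) :
    (Algebra.trace ℚ K x : ℝ) = 2 * (σ x).re := by
  classical
  obtain ⟨h, hne⟩ := univ_algHom_eq hdeg σ himag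
  have h1 := trace_eq_sum_embeddings (K := ℚ) (L := K) ℂ (x := x)
  rw [h, Finset.sum_pair hne] at h1
  have h2 := congrArg Complex.re h1
  simp at h2
  linarith

theorem absNorm_span_eq (hdeg : Module.finrank ℚ K = 2) (σ : K →+* ℂ)
    (himag : ∃ x : K, (σ x).im ≠ 0) (x : 𝓞 K) :
    (Ideal.absNorm (Ideal.span {x}) : ℝ) = ‖σ (x : K)‖ ^ 2 := by
  have h1 := norm_eq_normSq hdeg σ himag (x : K)
  rw [← Algebra.coe_norm_int] at h1
  rw [Ideal.absNorm_span_singleton, ← abs_of_nonneg (sq_nonneg ‖σ (x : K)‖), ← h1,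
    Nat.cast_natAbs]
  simp

theorem one_le_norm_of_ne_zero (hdeg : Module.finrank ℚ K = 2) (σ : K →+* ℂ)
    (himag : ∃ x : K, (σ x).im ≠ 0) {x : 𝓞 K} (hx : x ≠ 0) : 1 ≤ ‖σ (x : K)‖ := by
  have h1 := absNorm_span_eq hdeg σ himag x
  have h2 : Ideal.absNorm (Ideal.span {x}) ≠ 0 := by
    rw [Ne, Ideal.absNorm_eq_zero_iff, Ideal.span_singleton_eq_bot]
    exact hx
  have h3 : (1 : ℝ) ≤ Ideal.absNorm (Ideal.span {x}) := mod_cast Nat.one_le_iff_ne_zero.2 h2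
  rw [h1] at h3
  by_contra! hlt
  nlinarith [norm_nonneg (σ (x : K))]

/-- The divisor bound for elements of the ring of integers. -/
theorem exists_card_dvd_le (hdeg : Module.finrank ℚ K = 2) (σ : K →+* ℂ)
    (himag : ∃ x : K, (σ x).im ≠ 0) {ε : ℝ} (hε : 0 < ε) :
    ∃ C : ℝ, ∀ k : 𝓞 K, k ≠ 0 → ∀ s : Finset (𝓞 K), (∀ u ∈ s, u ∣ k) →
      (s.card : ℝ) ≤ C * ‖σ (k : K)‖ ^ ε := by
  classical
  have hsep : ∀ x : 𝓞 K, x ≠ 0 → 1 ≤ ‖(σ.comp (algebraMap (𝓞 K) K)) x‖ := fun x hx =>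
    one_le_norm_of_ne_zero hdeg σ himag hx
  obtain ⟨C, hC⟩ := exists_ncard_ideal_dvd_le (K := K) (half_pos hε)
  refine ⟨16 * (1 + 1) ^ 2 * C, fun k hk s hs => ?_⟩
  have hk0 : Ideal.span {k} ≠ 0 := by
    rw [Ne, Ideal.zero_eq_bot, Ideal.span_singleton_eq_bot]; exact hk
  have hfin : {J | J ∣ Ideal.span {k}}.Finite :=
    Set.finite_coe_iff.1 (@Finite.of_fintype _ (UniqueFactorizationMonoid.fintypeSubtypeDvd _ hk0))
  have himg : ((s.image fun u => Ideal.span {u}).card : ℝ) ≤ C * ‖σ (k : K)‖ ^ ε := by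
    have h1 : (s.image fun u => Ideal.span {u}).card ≤ {J | J ∣ Ideal.span {k}}.ncard := by
      rw [← Set.ncard_coe_finset]
      refine Set.ncard_le_ncard ?_ hfin
      intro J hJ
      obtain ⟨u, hu, rfl⟩ := Finset.mem_image.1 hJ
      exact Ideal.dvd_iff_le.2 (Ideal.span_singleton_le_span_singleton.2 (hs u hu))
    refine (Nat.cast_le.2 h1).trans ((hC _ hk0).trans_eq ?_)
    rw [absNorm_span_eq hdeg σ himag, ← Real.rpow_natCast, ← Real.rpow_mul (norm_nonneg _)]
    congr 2
    push_cast
    ring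
  refine (card_le_of_card_fiber_le (f := fun u => Ideal.span {u})
    (c := 16 * (1 + 1 : ℝ) ^ 2) ?_).trans ?_
  · intro J hJ
    obtain ⟨u₀, hu₀, rfl⟩ := Finset.mem_image.1 hJ
    have hass : ∀ u ∈ s.filter (fun u => Ideal.span {u} = Ideal.span {u₀}),
        ∃ w : (𝓞 K)ˣ, u₀ * w = u := fun u hu =>
      (Ideal.span_singleton_eq_span_singleton.1 (Finset.mem_filter.1 hu).2).symm
    choose! w hw using hass
    have hinj : Set.InjOn (fun u => (w u : 𝓞 K))
        (s.filter (fun u => Ideal.span {u} = Ideal.span {u₀})) := by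
      intro x hx y hy hxy
      rw [← hw x hx, ← hw y hy]
      exact congrArg _ hxy
    rw [← Finset.card_image_of_injOn hinj]
    refine card_le_of_norm_sub_le hsep 0 fun x hx => ?_
    obtain ⟨u, hu, rfl⟩ := Finset.mem_image.1 hx
    have h1 := absNorm_span_eq hdeg σ himag (w u : 𝓞 K)
    rw [Ideal.span_singleton_eq_top.2 (w u).isUnit, Ideal.absNorm_top] at h1
    rw [sub_zero]
    change ‖σ ((w u : 𝓞 K) : K)‖ ≤ 1
    by_contra! hlt
    push_cast at h1
    nlinarith
  · rw [mul_assoc _ C]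
    exact mul_le_mul_of_nonneg_left himg (by positivity)

theorem exists_integral_generator (hdeg : Module.finrank ℚ K = 2) (σ : K →+* ℂ)
    (himag : ∃ x : K, (σ x).im ≠ 0) :
    ∃ ω : 𝓞 K, (∀ n : 𝓞 K, ∃ x y : ℤ, n = x + y * ω) ∧
      (2 * (σ (ω : K)).im) ^ 2 = -(discr K : ℝ) := by
  set b : Module.Basis (Fin 2) ℤ (𝓞 K) :=
    Module.finBasisOfFinrankEq ℤ (𝓞 K) ((RingOfIntegers.rank K).trans hdeg)
  have hrepr : ∀ n : 𝓞 K, n = b.repr n 0 * b 0 + b.repr n 1 * b 1 := by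
    intro n
    have := b.sum_repr n
    simpa [Fin.sum_univ_two, zsmul_eq_mul] using this.symm
  set u := b.repr 1 0
  set v := b.repr 1 1
  have h1 : (1 : 𝓞 K) = u * b 0 + v * b 1 := hrepr 1
  have hco : IsCoprime u v := by
    rw [Int.isCoprime_iff_gcd_eq_one]
    obtain ⟨u', hu'⟩ : (Int.gcd u v : ℤ) ∣ u := Int.gcd_dvd_left ..
    obtain ⟨v', hv'⟩ : (Int.gcd u v : ℤ) ∣ v := Int.gcd_dvd_right ..
    set g : ℤ := (Int.gcd u v : ℤ) with hg
    have h2 : b 0 = g • ((u' * b 0 + v' * b 1) * b 0) := by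
      rw [zsmul_eq_mul, ← mul_assoc]
      have : (g : 𝓞 K) * (u' * b 0 + v' * b 1) = 1 := by
        rw [h1, hu', hv']; push_cast; ring
      rw [this, one_mul]
    have h3 := congrArg (fun z => b.repr z 0) h2
    simp only [map_zsmul, Finsupp.smul_apply, Module.Basis.repr_self, Finsupp.single_eq_same,
      smul_eq_mul] at h3
    have h4 : g ∣ 1 := ⟨_, h3⟩
    have h5 := Int.natAbs_dvd_natAbs.2 h4
    simpa [hg] using h5
  obtain ⟨r, s, hrs⟩ := hco
  refine ⟨r * b 1 - s * b 0, fun n => ?_, ?_⟩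
  · refine ⟨b.repr n 0 * r + b.repr n 1 * s, b.repr n 1 * u - b.repr n 0 * v, ?_⟩
    have hrs' : (r : 𝓞 K) * u + s * v = 1 := mod_cast hrs
    conv_lhs => rw [hrepr n]
    push_cast
    set p : 𝓞 K := (b.repr n 0 : 𝓞 K)
    set q : 𝓞 K := (b.repr n 1 : 𝓞 K)
    linear_combination (-(p * b 0 + q * b 1)) * hrs' - (p * r + q * s) * h1
  · have htr : ∀ x : 𝓞 K, ((Algebra.trace ℤ (𝓞 K) x : ℤ) : ℝ) = 2 * (σ (x : K)).re := by
      intro x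
      rw [← trace_eq_two_mul_re hdeg σ himag, ← Algebra.coe_trace_int]
      simp
    have hd : (discr K : ℝ)
        = 2 * (σ (b 0 : K) * σ (b 0 : K)).re * (2 * (σ (b 1 : K) * σ (b 1 : K)).re)
        - 2 * (σ (b 0 : K) * σ (b 1 : K)).re * (2 * (σ (b 1 : K) * σ (b 0 : K)).re) := by
      rw [← discr_eq_discr K b, Algebra.discr_def, Matrix.det_fin_two]
      simp only [Algebra.traceMatrix_apply, Algebra.traceForm_apply]
      push_cast
      rw [htr, htr, htr, htr]
      simp only [map_mul]
    have h1' : (1 : ℂ) = u * σ (b 0 : K) + v * σ (b 1 : K) := by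
      have := congrArg (fun z : 𝓞 K => σ (z : K)) h1
      simpa using this
    have hre := congrArg Complex.re h1'
    have him := congrArg Complex.im h1'
    simp at hre him
    have hω : (σ ((r * b 1 - s * b 0 : 𝓞 K) : K)).im
        = (σ (b 0 : K)).re * (σ (b 1 : K)).im - (σ (b 0 : K)).im * (σ (b 1 : K)).re := by
      have hrs' : (r : ℝ) * u + s * v = 1 := mod_cast hrs
      simp
      linear_combination (r * (σ (b 1 : K)).im - s * (σ (b 0 : K)).im) * hre
        - (r * (σ (b 1 : K)).re - s * (σ (b 0 : K)).re) * him
        + ((σ (b 0 : K)).re * (σ (b 1 : K)).im - (σ (b 0 : K)).im * (σ (b 1 : K)).re) * hrs'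
    rw [hω, hd]
    simp only [Complex.mul_re]
    ring

end ImaginaryQuadratic

section LargeSieve

variable {K : Type} [Field K] [NumberField K]

theorem eK_eq_exp (z : ℂ) (hD : (discr K : ℝ) < 0) :
    eK K z = Complex.exp (2 * Real.pi * Complex.I *
      ((2 * z.im / Real.sqrt (-(discr K : ℝ)) : ℝ) : ℂ)) := by
  have hs : ((Real.sqrt (-(discr K : ℝ)) : ℝ) : ℂ) ≠ 0 :=
    Complex.ofReal_ne_zero.2 (Real.sqrt_pos.2 (by linarith)).ne'
  rw [eK, ← sub_div, Complex.sub_conj]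
  congr 2
  push_cast
  field_simp

open UnitAddTorus in
/-- The additive characters of the ring of integers as the monomials on the torus. The last
clause expresses that the lattice is its own dual. -/
theorem exists_torus_coordinates (hdeg : Module.finrank ℚ K = 2) (σ : K →+* ℂ)
    (himag : ∃ x : K, (σ x).im ≠ 0) :
    ∃ (f : 𝓞 K → Fin 2 → ℤ) (t : ℂ → UnitAddTorus (Fin 2)) (c : ℝ), 0 < c ∧
      Function.Injective f ∧ (∀ n i, |(f n i : ℝ)| ≤ c * ‖σ (n : K)‖) ∧
      (∀ (n : 𝓞 K) z, eK K (σ (n : K) * z) = mFourier (f n) (t z)) ∧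
      ∀ z w, ∃ m : 𝓞 K, ‖z - w - σ (m : K)‖ ≤ c * ‖t z - t w‖ := by
  obtain ⟨ω, hω, hωD⟩ := exists_integral_generator hdeg σ himag
  have hD : (discr K : ℝ) < 0 := by
    have h0 : (discr K : ℝ) ≠ 0 := mod_cast discr_ne_zero K
    have := sq_nonneg (2 * (σ (ω : K)).im)
    exact lt_of_le_of_ne (by linarith) h0
  set s := Real.sqrt (-(discr K : ℝ)) with hs
  have hs0 : 0 < s := Real.sqrt_pos.2 (by linarith)
  have hs2 : (2 * (σ (ω : K)).im) ^ 2 = s ^ 2 := by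
    rw [hs, Real.sq_sqrt (by linarith), hωD]
  set W : ℂ := σ (ω : K)
  set ℓ : ℂ → ℝ := fun z => 2 * z.im / s with hℓ
  have hW0 : W.im ≠ 0 := fun h => by rw [h] at hs2; nlinarith
  obtain ⟨τ, hτ, hτ2⟩ : ∃ τ : ℤ, 2 * W.im = τ * s ∧ τ * τ = 1 := by
    rcases sq_eq_sq_iff_eq_or_eq_neg.1 hs2 with h | h
    · exact ⟨1, by simpa using h, by norm_num⟩
    · exact ⟨-1, by simpa using h, by norm_num⟩
  have hτ2' : (τ : ℝ) * τ = 1 := mod_cast hτ2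
  have hWabs : |W.im| = s / 2 := by
    have h1 : |2 * W.im| = |s| := (sq_eq_sq_iff_abs_eq_abs _ _).1 hs2
    rw [abs_mul, abs_of_pos hs0, abs_two] at h1
    linarith
  obtain ⟨A, B, hAB⟩ := hω (ω * ω)
  have hAB' : W * W = A + B * W := by
    have := congrArg (fun z : 𝓞 K => σ (z : K)) hAB
    simpa using this
  choose x y hxy using hω
  have hxy' : ∀ n : 𝓞 K, σ (n : K) = x n + y n * W := fun n => by
    have := congrArg (fun z : 𝓞 K => σ (z : K)) (hxy n)
    simpa using this
  have hy : ∀ n, |(y n : ℝ)| ≤ 2 / s * ‖σ (n : K)‖ := by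
    intro n
    have h1 := Complex.abs_im_le_norm (σ (n : K))
    have h2 : (σ (n : K)).im = y n * W.im := by rw [hxy' n]; simp
    rw [h2, abs_mul, hWabs] at h1
    rw [div_mul_eq_mul_div, le_div_iff₀ hs0]
    linarith
  have hx : ∀ n, |(x n : ℝ)| ≤ (1 + 2 / s * ‖W‖) * ‖σ (n : K)‖ := by
    intro n
    have h1 : ((x n : ℝ) : ℂ) = σ (n : K) - y n * W := by rw [hxy' n]; push_cast; ring
    have h2 : |(x n : ℝ)| = ‖σ (n : K) - y n * W‖ := by
      rw [← h1, Complex.norm_real, Real.norm_eq_abs]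
    have h3 : ‖(y n : ℂ)‖ = |(y n : ℝ)| := by
      rw [← Complex.ofReal_intCast, Complex.norm_real, Real.norm_eq_abs]
    rw [h2]
    refine (norm_sub_le _ _).trans ?_
    rw [norm_mul, h3]
    nlinarith [mul_le_mul_of_nonneg_right (hy n) (norm_nonneg W)]
  set c₁ : ℝ := 1 + 2 / s * ‖W‖ + 2 / s
  set c₂ : ℝ := 1 + ‖W‖ + s with hc₂
  have hc₁ : 0 < c₁ := by positivity
  have hc₂0 : 0 < c₂ := by positivity
  refine ⟨fun n => ![x n, y n], fun z => ![(ℓ z : UnitAddCircle), (ℓ (W * z) : UnitAddCircle)],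
    c₁ + c₂, by positivity, ?_, ?_, ?_, ?_⟩
  · intro n m h
    have h0 : x n = x m := congrFun h 0
    have h1 : y n = y m := congrFun h 1
    rw [hxy n, hxy m, h0, h1]
  · intro n i
    have h0 : 0 ≤ 2 / s * ‖W‖ := by positivity
    have h1 : 0 ≤ 2 / s := by positivity
    fin_cases i
    · exact (hx n).trans (mul_le_mul_of_nonneg_right (by simp only [c₁]; linarith) (norm_nonneg _))
    · exact (hy n).trans (mul_le_mul_of_nonneg_right (by simp only [c₁]; linarith [norm_nonneg W])
        (norm_nonneg _))
  · intro n z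
    rw [eK_eq_exp _ hD]
    simp only [mFourier, ContinuousMap.coe_mk, Fin.prod_univ_two, Matrix.cons_val_zero,
      Matrix.cons_val_one]
    rw [fourier_coe_apply, fourier_coe_apply, ← Complex.exp_add]
    congr 1
    have h1 : (2 * (σ (n : K) * z).im / s : ℝ) = x n * ℓ z + y n * ℓ (W * z) := by
      rw [hxy' n, hℓ]
      simp [add_mul, mul_assoc]
      ring
    rw [← hs, h1]
    push_cast
    ring
  · intro z w
    set e := ‖(![(ℓ z : UnitAddCircle), (ℓ (W * z) : UnitAddCircle)] : UnitAddTorus (Fin 2)) -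
      ![(ℓ w : UnitAddCircle), (ℓ (W * w) : UnitAddCircle)]‖ with he
    have he0 : 0 ≤ e := norm_nonneg _
    have hround : ∀ p q : ℝ, ‖(p : UnitAddCircle) - (q : UnitAddCircle)‖ ≤ e →
        |p - q - round (p - q)| ≤ e := by
      intro p q h
      rwa [← AddCircle.coe_sub, UnitAddCircle.norm_eq] at h
    have hz0 := hround _ _ (norm_le_pi_norm
      ((![(ℓ z : UnitAddCircle), (ℓ (W * z) : UnitAddCircle)] :
      UnitAddTorus (Fin 2)) - ![(ℓ w : UnitAddCircle), (ℓ (W * w) : UnitAddCircle)]) 0)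
    have hz1 := hround _ _ (norm_le_pi_norm
      ((![(ℓ z : UnitAddCircle), (ℓ (W * z) : UnitAddCircle)] :
      UnitAddTorus (Fin 2)) - ![(ℓ w : UnitAddCircle), (ℓ (W * w) : UnitAddCircle)]) 1)
    set k₀ := round (ℓ z - ℓ w)
    set k₁ := round (ℓ (W * z) - ℓ (W * w))
    set m : 𝓞 K := ((τ * k₁ - τ * k₀ * B : ℤ) : 𝓞 K) + ((τ * k₀ : ℤ) : 𝓞 K) * ω with hm
    have hmσ : σ (m : K) = ((τ * k₁ - τ * k₀ * B : ℝ) : ℂ) + ((τ * k₀ : ℝ) : ℂ) * W := by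
      simp [hm, W]
    refine ⟨m, ?_⟩
    set v := z - w - σ (m : K) with hv
    have hWs : W.im / s = τ / 2 := by
      rw [div_eq_iff hs0.ne']; linarith
    have hv0 : ℓ v = ℓ z - ℓ w - k₀ := by
      have h1 : ℓ (σ (m : K)) = k₀ := by
        have : ℓ (σ (m : K)) = 2 * (τ * k₀) * (W.im / s) := by
          rw [hℓ, hmσ]; simp; ring
        rw [this, hWs]
        linear_combination (k₀ : ℝ) * hτ2'
      rw [← h1, hℓ, hv]
      simp
      ring
    have hv1 : ℓ (W * v) = ℓ (W * z) - ℓ (W * w) - k₁ := by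
      have h1 : ℓ (W * σ (m : K)) = k₁ := by
        have h2 : W * σ (m : K) = ((τ * k₀ * A : ℝ) : ℂ) + ((τ * k₁ : ℝ) : ℂ) * W := by
          rw [hmσ]
          push_cast
          linear_combination (τ * k₀ : ℂ) * hAB'
        have : ℓ (W * σ (m : K)) = 2 * (τ * k₁) * (W.im / s) := by
          rw [h2, hℓ]; simp; ring
        rw [this, hWs]
        linear_combination (k₁ : ℝ) * hτ2'
      rw [← h1, hℓ, hv]
      simp
      ring
    rw [← hv0] at hz0
    rw [← hv1] at hz1
    have him : v.im = s / 2 * ℓ v := by rw [hℓ]; field_simp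
    have hre : v.re * W.im = s / 2 * ℓ (W * v) - W.re * v.im := by
      rw [hℓ]; simp; field_simp; ring
    have himb : |v.im| ≤ s / 2 * e := by
      rw [him, abs_mul, abs_of_pos (by positivity)]
      gcongr
    have hreb : |v.re| ≤ (1 + ‖W‖) * e := by
      have h1 : |v.re| * (s / 2) ≤ s / 2 * e + ‖W‖ * (s / 2 * e) := by
        rw [← hWabs, ← abs_mul, hre, hWabs]
        refine (abs_sub _ _).trans (add_le_add ?_ ?_)
        · rw [abs_mul, abs_of_pos (by positivity : 0 < s / 2)]
          gcongr
        · rw [abs_mul]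
          gcongr
          exact Complex.abs_re_le_norm W
      have h2 : 0 < s / 2 := by positivity
      refine le_of_mul_le_mul_right ?_ h2
      linarith
    calc ‖v‖ ≤ |v.re| + |v.im| := Complex.norm_le_abs_re_add_abs_im v
      _ ≤ (1 + ‖W‖) * e + s / 2 * e := add_le_add hreb himb
      _ ≤ (c₁ + c₂) * e := by
        rw [hc₂]
        have : 0 ≤ s / 2 * e + c₁ * e := by positivity
        nlinarith

/-- The large sieve for moduli `q` with norm in a dyadic interval. -/
theorem exists_large_sieve_dyadic (hdeg : Module.finrank ℚ K = 2) (σ : K →+* ℂ)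
    (himag : ∃ x : K, (σ x).im ≠ 0) {ε : ℝ} (hε : 0 < ε) :
    ∃ C : ℝ, 0 ≤ C ∧ ∀ X w : ℝ, 1 ≤ X → X ≤ w → ∀ S F : Finset (𝓞 K), ∀ R : 𝓞 K → Finset (𝓞 K),
      (∀ q ∈ S, q ≠ 0 ∧ X / 2 < ‖σ (q : K)‖ ^ 2 ∧ ‖σ (q : K)‖ ^ 2 ≤ X) →
      (∀ q ∈ S, (∀ r ∈ R q, IsCoprime r q) ∧ ∀ r ∈ R q, ∀ r' ∈ R q, q ^ 2 ∣ r - r' → r = r') →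
      (∀ n ∈ F, ‖σ (n : K)‖ ≤ w) → ∀ a : 𝓞 K → ℂ,
      ∑ q ∈ S, ∑ r ∈ R q, ‖∑ n ∈ F, a n * eK K (σ (n : K) * σ (r : K) / σ (q : K) ^ 2)‖ ^ 2
        ≤ C * X ^ ε * (w ^ 2 + X ^ 2 * w) * ∑ n ∈ F, ‖a n‖ ^ 2 := by
  classical
  obtain ⟨f, t, c, hc, hf, hfc, heK, ht⟩ := exists_torus_coordinates hdeg σ himag
  obtain ⟨C, hC⟩ := exists_card_dvd_le hdeg σ himag hε
  obtain ⟨C', hC'⟩ := card_close_fractions_le (σ := σ.comp (algebraMap (𝓞 K) K))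
    (fun x hx => one_le_norm_of_ne_zero hdeg σ himag hx) hε hC 1
  set κ : ℝ := 32 * c + 2
  have hκ : 0 < κ := by positivity
  refine ⟨max C' 0 * κ ^ 2, by positivity, fun X w hX hXw S F R hS hR hF a => ?_⟩
  have hw : 0 < w := by linarith
  have hX0 : 0 < X := by linarith
  set δ : ℝ := 1 / (κ * w) with hδ
  have hδ0 : 0 < δ := by positivity
  have hδw : δ * (κ * w) = 1 := by rw [hδ]; field_simp
  have hcδw : c * (2 * δ) * w ≤ 1 := by
    have : 0 ≤ δ * w * (30 * c + 2) := by positivity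
    simp only [κ] at hδw
    linarith
  have hηX : c * (2 * δ) * X ≤ 1 :=
    (mul_le_mul_of_nonneg_left hXw (by positivity)).trans hcδw
  have hηX2 : c * (2 * δ) * X ^ 2 ≤ X ^ 2 / w := by
    rw [le_div_iff₀ hw]
    nlinarith [mul_le_mul_of_nonneg_right hcδw (sq_nonneg X)]
  have hsieve := large_sieve_unitAddTorus (S.sigma R)
    (fun p => t (σ (p.2 : K) / σ (p.1 : K) ^ 2)) F f hf.injOn a (δ := δ)
    (P := max C' 0 * X ^ ε * (1 + X ^ 2 / w)) hδ0 ?_ ?_ ?_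
  · rw [Finset.sum_sigma] at hsieve
    simp only [← heK, ← mul_div_assoc] at hsieve
    refine hsieve.trans_eq ?_
    congr 1
    rw [hδ]
    field_simp
  · simp only [κ] at hδw
    have : 0 ≤ δ * (32 * c * w + 2 * (w - 1)) := by
      have : 0 ≤ w - 1 := by linarith
      positivity
    linarith
  · intro n hn i
    have h1 : |(f n i : ℝ)| ≤ c * w := (hfc n i).trans (by gcongr; exact hF n hn)
    have h2 := mul_le_mul_of_nonneg_right h1 hδ0.le
    simp only [κ] at hδw
    have : 0 ≤ δ * w := by positivity
    linarith
  · intro y s' hs' hy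
    rcases s'.eq_empty_or_nonempty with rfl | ⟨p₀, hp₀⟩
    · simp only [Finset.card_empty, Nat.cast_zero]
      positivity
    have hmem : ∀ p ∈ s', p.1 ∈ S ∧ p.2 ∈ R p.1 := fun p hp => Finset.mem_sigma.1 (hs' hp)
    obtain ⟨hq₀, ha₀⟩ := hmem p₀ hp₀
    have hinj : Function.Injective (fun p : (_ : 𝓞 K) × 𝓞 K => (p.1, p.2)) := by
      rintro ⟨_, _⟩ ⟨_, _⟩ h
      simpa using h
    have hcard := hC' X (c * (2 * δ)) hX (by positivity) hηX p₀.1 p₀.2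
      ((hR _ hq₀).1 _ ha₀) (hS _ hq₀).2.1 (hS _ hq₀).2.2 (s'.image fun p => (p.1, p.2)) ?_ ?_
    · rw [Finset.card_image_of_injective _ hinj] at hcard
      refine hcard.trans ?_
      gcongr
      exact le_max_left _ _
    · intro p hp
      obtain ⟨p, hps, rfl⟩ := Finset.mem_image.1 hp
      refine ⟨(hS _ (hmem p hps).1).1, (hS _ (hmem p hps).1).2.2, ?_⟩
      obtain ⟨m, hm⟩ := ht (σ (p.2 : K) / σ (p.1 : K) ^ 2) (σ (p₀.2 : K) / σ (p₀.1 : K) ^ 2)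
      refine ⟨m, hm.trans ?_⟩
      gcongr
      rw [← sub_sub_sub_cancel_left _ _ y]
      refine (norm_sub_le _ _).trans ?_
      linarith [hy p hps, hy p₀ hp₀]
    · intro q r r' hr hr' hdvd
      obtain ⟨⟨_, _⟩, hp, h⟩ := Finset.mem_image.1 hr
      obtain ⟨⟨_, _⟩, hp', h'⟩ := Finset.mem_image.1 hr'
      simp only [Prod.mk.injEq] at h h'
      obtain ⟨rfl, rfl⟩ := h
      obtain ⟨rfl, rfl⟩ := h'
      exact (hR _ (hmem _ hp).1).2 _ (hmem _ hp).2 _ (hmem _ hp').2 hdvd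

/-- The large sieve for square moduli with finite index sets. -/
theorem exists_large_sieve_finset (hdeg : Module.finrank ℚ K = 2) (σ : K →+* ℂ)
    (himag : ∃ x : K, (σ x).im ≠ 0) {ε : ℝ} (hε : 0 < ε) :
    ∃ C : ℝ, 0 ≤ C ∧ ∀ Q N : ℝ, 1 ≤ Q → 1 ≤ N → ∀ S F : Finset (𝓞 K), ∀ R : 𝓞 K → Finset (𝓞 K),
      (∀ q ∈ S, q ≠ 0 ∧ ‖σ (q : K)‖ ^ 2 ≤ Q) →
      (∀ q ∈ S, (∀ r ∈ R q, IsCoprime r q) ∧ ∀ r ∈ R q, ∀ r' ∈ R q, q ^ 2 ∣ r - r' → r = r') →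
      (∀ n ∈ F, ‖σ (n : K)‖ ^ 2 ≤ N) → ∀ a : 𝓞 K → ℂ,
      ∑ q ∈ S, ∑ r ∈ R q, ‖∑ n ∈ F, a n * eK K (σ (n : K) * σ (r : K) / σ (q : K) ^ 2)‖ ^ 2
        ≤ C * Q ^ ε * (Q ^ 3 + Q ^ 2 * Real.sqrt N + N) * ∑ n ∈ F, ‖a n‖ ^ 2 := by
  classical
  obtain ⟨C₀, hC₀, hblock⟩ := exists_large_sieve_dyadic hdeg σ himag hε
  have h2ε : (2 : ℝ) ^ (-ε) < 1 := Real.rpow_lt_one_of_one_lt_of_neg one_lt_two (by linarith)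
  set C₁ : ℝ := 2 * C₀ / (1 - 2 ^ (-ε)) with hC₁
  have hC₁0 : 0 ≤ C₁ := div_nonneg (by positivity) (by linarith)
  have hC₁eq : C₁ * 2 ^ (-ε) + 2 * C₀ = C₁ := by
    have : 1 - (2 : ℝ) ^ (-ε) ≠ 0 := by linarith
    rw [hC₁]
    field_simp
    ring
  refine ⟨C₁, hC₁0, fun Q N hQ hN S F R hS hR hF a => ?_⟩
  set A := ∑ n ∈ F, ‖a n‖ ^ 2
  have hA : 0 ≤ A := Finset.sum_nonneg fun _ _ => by positivity
  set H := Q ^ 3 + Q ^ 2 * Real.sqrt N + N with hH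
  have hH0 : 0 ≤ H := by positivity
  set g : 𝓞 K → ℝ := fun q =>
    ∑ r ∈ R q, ‖∑ n ∈ F, a n * eK K (σ (n : K) * σ (r : K) / σ (q : K) ^ 2)‖ ^ 2
  have key : ∀ k : ℕ, ∀ Y : ℝ, 0 < Y → Y ≤ Q → Y < 2 ^ k → ∀ T ⊆ S,
      (∀ q ∈ T, ‖σ (q : K)‖ ^ 2 ≤ Y) → ∑ q ∈ T, g q ≤ C₁ * Y ^ ε * H * A := by
    have hsmall : ∀ Y : ℝ, 0 < Y → Y < 1 → ∀ T ⊆ S,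
        (∀ q ∈ T, ‖σ (q : K)‖ ^ 2 ≤ Y) → ∑ q ∈ T, g q ≤ C₁ * Y ^ ε * H * A := by
      intro Y hY hY1 T hT hTY
      have : T = ∅ := by
        refine Finset.eq_empty_of_forall_notMem fun q hq => ?_
        have h1 := one_le_norm_of_ne_zero hdeg σ himag (hS q (hT hq)).1
        nlinarith [hTY q hq]
      rw [this, Finset.sum_empty]
      positivity
    intro k
    induction k with
    | zero => exact fun Y hY _ hY1 => hsmall Y hY (by simpa using hY1)
    | succ k ih =>
      intro Y hY hYQ hYk T hT hTY
      rcases lt_or_ge Y 1 with hY1 | hY1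
      · exact hsmall Y hY hY1 T hT hTY
      rw [← Finset.sum_filter_add_sum_filter_not T (fun q => ‖σ (q : K)‖ ^ 2 ≤ Y / 2)]
      have hlow := ih (Y / 2) (by linarith) (by linarith) (by rw [pow_succ] at hYk; linarith)
        (T.filter fun q => ‖σ (q : K)‖ ^ 2 ≤ Y / 2) ((Finset.filter_subset _ _).trans hT)
        fun q hq => (Finset.mem_filter.1 hq).2
      have hhigh := hblock Y (max (Real.sqrt N) Y) hY1 (le_max_right _ _)
        (T.filter fun q => ¬ ‖σ (q : K)‖ ^ 2 ≤ Y / 2) F R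
        (fun q hq => by
          obtain ⟨hqT, hq⟩ := Finset.mem_filter.1 hq
          exact ⟨(hS q (hT hqT)).1, not_le.1 hq, hTY q hqT⟩)
        (fun q hq => hR q (hT (Finset.mem_filter.1 hq).1))
        (fun n hn => (Real.le_sqrt_of_sq_le (hF n hn)).trans (le_max_left _ _)) a
      have hw : max (Real.sqrt N) Y ^ 2 + Y ^ 2 * max (Real.sqrt N) Y ≤ 2 * H := by
        have hN0 : 0 ≤ Real.sqrt N := Real.sqrt_nonneg N
        have hN2 : Real.sqrt N ^ 2 = N := Real.sq_sqrt (by linarith)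
        have h2 : Y ^ 2 ≤ Q ^ 2 := by gcongr
        have h3 : Y ^ 3 ≤ Q ^ 3 := by gcongr
        have h23 : Y ^ 2 ≤ Y ^ 3 := pow_le_pow_right₀ hY1 (by norm_num)
        have h4 : Y ^ 2 * Real.sqrt N ≤ Q ^ 2 * Real.sqrt N := by gcongr
        have h5 : 0 ≤ Q ^ 2 * Real.sqrt N := by positivity
        have h6 : 0 ≤ Q ^ 3 := by positivity
        rcases le_total (Real.sqrt N) Y with h | h
        · rw [max_eq_right h]
          nlinarith
        · rw [max_eq_left h]
          nlinarith
      have hYε : (Y / 2) ^ ε = Y ^ ε * 2 ^ (-ε) := by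
        rw [Real.div_rpow hY.le zero_le_two, Real.rpow_neg zero_le_two, div_eq_mul_inv]
      calc _ ≤ C₁ * (Y / 2) ^ ε * H * A + C₀ * Y ^ ε * (2 * H) * A := by
            refine add_le_add hlow (hhigh.trans ?_)
            gcongr
        _ = (C₁ * 2 ^ (-ε) + 2 * C₀) * Y ^ ε * H * A := by rw [hYε]; ring
        _ = C₁ * Y ^ ε * H * A := by rw [hC₁eq]
  obtain ⟨k, hk⟩ := pow_unbounded_of_one_lt Q one_lt_two
  exact key k Q (by linarith) le_rfl hk S subset_rfl fun q hq => (hS q hq).2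

theorem finite_setOf_normSq_le (hdeg : Module.finrank ℚ K = 2) (σ : K →+* ℂ)
    (himag : ∃ x : K, (σ x).im ≠ 0) (B : ℝ) :
    {x : 𝓞 K | Complex.normSq (σ (x : K)) ≤ B}.Finite := by
  by_contra hinf
  obtain ⟨s, hs, hcard⟩ := Set.Infinite.exists_subset_card_eq hinf
    (⌊16 * (1 + Real.sqrt B) ^ 2⌋₊ + 1)
  have h := card_le_of_norm_sub_le (σ := σ.comp (algebraMap (𝓞 K) K))
    (fun x hx => one_le_norm_of_ne_zero hdeg σ himag hx) (s := s) 0 (ρ := Real.sqrt B)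
    fun x hx => by
      have hx' : Complex.normSq (σ (x : K)) ≤ B := hs hx
      rw [Complex.normSq_eq_norm_sq] at hx'
      rw [sub_zero]
      exact Real.le_sqrt_of_sq_le hx'
  rw [hcard] at h
  push_cast at h
  exact absurd h (not_le.2 (Nat.lt_floor_add_one _))

end LargeSieve

/-- the large sieve with square moduli in an imaginary quadratic number field
K of class number one (K is quadratic with a non-real complex embedding σ and
classNumber K = 1; norms are N(q) = |σ(q)|²).  For each modulus q, the inner sum runs over
a complete set R q of residues modulo q² coprime to q.  Then
Σ_{0 ≠ q, N(q) ≤ Q} Σ_{a mod q², (a,q)=1} |Σ_{N(n) ≤ N} a_n ẽ_K(na/q²)|²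
  ≪_ε (QN)^ε (Q³ + Q²√N + N) Σ_{N(n) ≤ N} |a_n|². -/
theorem large_sieve_square_moduli (K : Type) [Field K] [NumberField K]
    (hdeg : Module.finrank ℚ K = 2)
    (σ : K →+* ℂ) (himag : ∃ x : K, (σ x).im ≠ 0)
    (hcl : NumberField.classNumber K = 1)
    (ε : ℝ) (hε : 0 < ε) :
    ∃ C : ℝ, ∀ Q N : ℝ, 1 ≤ Q → 1 ≤ N →
      ∀ a : 𝓞 K → ℂ, ∀ R : 𝓞 K → Finset (𝓞 K),
      (∀ q : 𝓞 K, q ≠ 0 → Complex.normSq (σ (q : K)) ≤ Q →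
        (∀ r ∈ R q, IsCoprime r q) ∧
        (∀ s : 𝓞 K, IsCoprime s q → ∃! r : 𝓞 K, r ∈ R q ∧ q ^ 2 ∣ s - r)) →
      (∑' q : {q : 𝓞 K // q ≠ 0 ∧ Complex.normSq (σ (q : K)) ≤ Q},
          ∑ r ∈ R q.1,
            ‖∑' n : {n : 𝓞 K // Complex.normSq (σ (n : K)) ≤ N},
                a n.1 * eK K (σ (n.1 : K) * σ (r : K) / σ (q.1 : K) ^ 2)‖ ^ 2)
      ≤ C * (Q * N) ^ ε * (Q ^ 3 + Q ^ 2 * Real.sqrt N + N) *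
          ∑' n : {n : 𝓞 K // Complex.normSq (σ (n : K)) ≤ N}, ‖a n.1‖ ^ 2 := by
  obtain ⟨C, hC, h⟩ := exists_large_sieve_finset hdeg σ himag hε
  refine ⟨C, fun Q N hQ hN a R hR => ?_⟩
  have hSfin : {q : 𝓞 K | q ≠ 0 ∧ Complex.normSq (σ (q : K)) ≤ Q}.Finite :=
    (finite_setOf_normSq_le hdeg σ himag Q).subset fun q hq => hq.2
  have hFfin := finite_setOf_normSq_le hdeg σ himag N
  have hS : ∀ q, q ∈ hSfin.toFinset ↔ q ≠ 0 ∧ Complex.normSq (σ (q : K)) ≤ Q := fun q => by simp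
  have hF : ∀ n, n ∈ hFfin.toFinset ↔ Complex.normSq (σ (n : K)) ≤ N := fun n => by simp
  have : Fintype {q : 𝓞 K // q ≠ 0 ∧ Complex.normSq (σ (q : K)) ≤ Q} :=
    Fintype.subtype hSfin.toFinset hS
  have : Fintype {n : 𝓞 K // Complex.normSq (σ (n : K)) ≤ N} :=
    Fintype.subtype hFfin.toFinset hF
  have hinner : ∀ u v : ℂ, ∑ n : {n : 𝓞 K // Complex.normSq (σ (n : K)) ≤ N},
      a n.1 * eK K (σ (n.1 : K) * u / v) =
      ∑ n ∈ hFfin.toFinset, a n * eK K (σ (n : K) * u / v) := fun u v =>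
    (Finset.sum_subtype hFfin.toFinset hF fun n => a n * eK K (σ (n : K) * u / v)).symm
  simp only [tsum_fintype, hinner]
  rw [← Finset.sum_subtype hFfin.toFinset hF fun n => ‖a n‖ ^ 2]
  rw [← Finset.sum_subtype hSfin.toFinset hS fun q => ∑ r ∈ R q,
    ‖∑ n ∈ hFfin.toFinset, a n * eK K (σ (n : K) * σ (r : K) / σ (q : K) ^ 2)‖ ^ 2]
  refine (h Q N hQ hN hSfin.toFinset hFfin.toFinset R ?_ ?_ ?_ a).trans ?_
  · intro q hq
    rw [← Complex.normSq_eq_norm_sq]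
    exact (hS q).1 hq
  · intro q hq
    obtain ⟨hq0, hqQ⟩ := (hS q).1 hq
    obtain ⟨hco, hex⟩ := hR q hq0 hqQ
    refine ⟨hco, fun r hr r' hr' hdvd => ?_⟩
    exact (hex r (hco r hr)).unique ⟨hr, by simp⟩ ⟨hr', hdvd⟩
  · intro n hn
    rw [← Complex.normSq_eq_norm_sq]
    exact (hF n).1 hn
  · have : Q ≤ Q * N := le_mul_of_one_le_right (by linarith) hN
    gcongr
end
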